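/- Let n ≥ 4, let M be a closed connected topological n-manifold, and let f : M → M be a regular homeomorphism. Let σ be a saddle periodic point of f of Morse index n−1 such that W^u_σ ∩ W^s_q = ∅ for every saddle periodic point q ≠ σ, let ω be the sink periodic point with cl(W^u_σ) = W^u_σ ∪ {ω}, and set S_σ = W^u_σ ∪ {ω}. Then there exist a compact neighbourhood N ⊆ W^s_ω ∪ W^s_σ of S_σ, a homeomorphism e : S^{n−1} × [−1,1] → N with e(S^{n−1} × {0}) = S_σ, and an integer m > 0 such that f^m(N) ⊆ int N. -/

import Mathlib

open Filter Topology

/-- `M` is a topological `n`-manifold without boundary: every point has an open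
neighbourhood homeomorphic to `ℝⁿ`. -/
def IsChartedEuclidean (n : ℕ) (M : Type*) [TopologicalSpace M] : Prop :=
  ∀ x : M, ∃ U : Set M, IsOpen U ∧ x ∈ U ∧ Nonempty (U ≃ₜ EuclideanSpace ℝ (Fin n))

/-- An `ε`-chain of the map `f` from `x` to `y`. -/
def IsEpsChain {M : Type*} [PseudoMetricSpace M] (f : M → M) (ε : ℝ) (x y : M) : Prop :=
  ∃ k : ℕ, 0 < k ∧ ∃ (c : Fin (k + 1) → M) (m : Fin k → ℕ),
    c 0 = x ∧ c (Fin.last k) = y ∧ (∀ i, 1 ≤ m i) ∧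
    ∀ i : Fin k, dist (f^[m i] (c i.castSucc)) (c i.succ) < ε

/-- A point is chain recurrent for `f` if for every `ε > 0` there is an `ε`-chain
from the point to itself. -/
def ChainRecurrent {M : Type*} [PseudoMetricSpace M] (f : M → M) (x : M) : Prop :=
  ∀ ε : ℝ, 0 < ε → IsEpsChain f ε x x

/-- The chain recurrent set of `f`. -/
def chainRecurrentSet {M : Type*} [PseudoMetricSpace M] (f : M → M) : Set M :=
  {x | ChainRecurrent f x}

/-- The canonical hyperbolic model map `a_{i,δu,δs} : ℝⁿ → ℝⁿ`,
`a(x₁,…,xₙ) = (2δu·x₁, 2x₂, …, 2x_i, (δs/2)·x_{i+1}, x_{i+2}/2, …, xₙ/2)`. -/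
noncomputable def modelMap (n i : ℕ) (δu δs : ℝ) :
    EuclideanSpace ℝ (Fin n) → EuclideanSpace ℝ (Fin n) :=
  fun x => WithLp.toLp 2 fun j =>
    if (j : ℕ) < i then (if (j : ℕ) = 0 then 2 * δu else 2) * x j
    else (if (j : ℕ) = i then δs / 2 else 1 / 2) * x j

/-- A point `p` is a topologically hyperbolic periodic point of the homeomorphism `f`
with Morse index `i`: `p` is periodic of some least period `m` and `f^m` is conjugate,
in a neighbourhood of `p`, to the model map `a_{i,δu,δs}` on `ℝⁿ`. -/
def TopHyperbolic {M : Type*} [MetricSpace M] (n : ℕ) (f : M ≃ₜ M) (p : M) (i : ℕ) : Prop :=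
  ∃ m : ℕ, 0 < m ∧ Function.IsPeriodicPt (⇑f) m p ∧ Function.minimalPeriod (⇑f) p = m ∧
    ∃ δu δs : ℝ, (δu = 1 ∨ δu = -1) ∧ (δs = 1 ∨ δs = -1) ∧
      ∃ (U : Set M) (_ : IsOpen U) (_ : p ∈ U) (h : U ≃ₜ EuclideanSpace ℝ (Fin n)),
        ∀ x : U, (⇑f)^[m] (x : M) = ((h.symm (modelMap n i δu δs (h x)) : U) : M)

/-- A homeomorphism is regular if its chain recurrent set is finite and consists of
topologically hyperbolic periodic points (of some Morse index `i ∈ {0,…,n}`). -/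
def RegularHomeo {M : Type*} [MetricSpace M] (n : ℕ) (f : M ≃ₜ M) : Prop :=
  (chainRecurrentSet (⇑f)).Finite ∧
    ∀ p ∈ chainRecurrentSet (⇑f), ∃ i ≤ n, TopHyperbolic n f p i

/-- The stable manifold `W^s_p = {q : f^{km}(q) → p, k → +∞}`, `m` the least period. -/
def stableSet {M : Type*} [MetricSpace M] (f : M ≃ₜ M) (p : M) : Set M :=
  {q | Tendsto (fun k : ℕ => (⇑f)^[k * Function.minimalPeriod (⇑f) p] q) atTop (𝓝 p)}

/-- The unstable manifold `W^u_p = {q : f^{-km}(q) → p, k → +∞}`, `m` the least period. -/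
def unstableSet {M : Type*} [MetricSpace M] (f : M ≃ₜ M) (p : M) : Set M :=
  {q | Tendsto (fun k : ℕ => (⇑f.symm)^[k * Function.minimalPeriod (⇑f) p] q) atTop (𝓝 p)}

/-- A saddle periodic point: topologically hyperbolic of Morse index `0 < i < n`. -/
def IsSaddlePt {M : Type*} [MetricSpace M] (n : ℕ) (f : M ≃ₜ M) (p : M) : Prop :=
  ∃ i, 0 < i ∧ i < n ∧ TopHyperbolic n f p i

/-- A subset `S ⊆ M` is a locally flat `k`-dimensional submanifold of the `n`-manifold
`M`: every `x ∈ S` has an open neighbourhood `U` and a homeomorphism `ψ : U ≃ₜ ℝⁿ` with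
`ψ(U ∩ S) = ℝᵏ × {0}`. -/
def IsLocallyFlatSubmanifold (n k : ℕ) {M : Type*} [TopologicalSpace M] (S : Set M) : Prop :=
  ∀ x ∈ S, ∃ U : Set M, IsOpen U ∧ x ∈ U ∧
    ∃ ψ : U ≃ₜ EuclideanSpace ℝ (Fin n),
      ψ '' {y : U | (y : M) ∈ S} = {y | ∀ j : Fin n, k ≤ (j : ℕ) → y j = 0}

open Filter Topology

/-- Extension of a supported homeomorphism through an open partial homeomorphism. -/
theorem ext_lemma {A X : Type*} [TopologicalSpace A] [TopologicalSpace X]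
    (φ : OpenPartialHomeomorph A X) (h : A ≃ₜ A) (S : Set A) (hS : S ⊆ φ.source)
    (hid : ∀ x, x ∉ S → h x = x) (hcl : IsClosed (φ '' S)) :
    ∃ H : X ≃ₜ X, (∀ x ∈ φ.source, H (φ x) = φ (h x)) ∧ ∀ y, y ∉ φ '' S → H y = y := by
  classical
  have key : ∀ h : A ≃ₜ A, (∀ x, x ∉ S → h x = x) → ∃ H : X → X, Continuous H ∧
      (∀ x ∈ φ.source, H (φ x) = φ (h x)) ∧ (∀ y, y ∉ φ '' S → H y = y) ∧
      (∀ x ∈ φ.source, h x ∈ φ.source) := by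
    intro h hid
    have hsrc : ∀ x ∈ φ.source, h x ∈ φ.source := by
      intro x hx
      by_cases hxS : x ∈ S
      · by_contra hc
        have h1 : h x ∉ S := fun h' => hc (hS h')
        have h2 := hid _ h1
        have := h.injective h2
        rw [this] at hc; exact hc hx
      · rw [hid x hxS]; exact hx
    refine ⟨fun y => if y ∈ φ.target then φ (h (φ.symm y)) else y, ?_, ?_, ?_, hsrc⟩
    · rw [continuous_iff_continuousAt]
      intro y
      by_cases hy : y ∈ φ.target
      · have h1 : ContinuousAt (fun y => φ (h (φ.symm y))) y := by
          refine ContinuousAt.comp (g := φ) ?_ ?_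
          · exact φ.continuousAt (hsrc _ (φ.map_target hy))
          · exact h.continuous.continuousAt.comp (φ.symm.continuousAt (by simpa using hy))
        refine h1.congr ?_
        filter_upwards [φ.open_target.mem_nhds hy] with z hz
        simp [hz]
      · have hy' : y ∈ (φ '' S)ᶜ := by
          rintro ⟨x, hx, rfl⟩
          exact hy (φ.map_source (hS hx))
        refine continuousAt_id.congr ?_
        filter_upwards [hcl.isOpen_compl.mem_nhds hy'] with z hz
        by_cases hzt : z ∈ φ.target
        · have : φ.symm z ∉ S := fun h' => hz ⟨_, h', φ.right_inv hzt⟩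
          simp [hzt, hid _ this]
        · simp [hzt]
    · intro x hx
      simp [φ.map_source hx, φ.left_inv hx]
    · intro y hy
      by_cases hzt : y ∈ φ.target
      · have : φ.symm y ∉ S := fun h' => hy ⟨_, h', φ.right_inv hzt⟩
        simp [hzt, hid _ this]
      · simp [hzt]
  have hid' : ∀ x, x ∉ S → h.symm x = x := by
    intro x hx
    rw [Homeomorph.symm_apply_eq]; exact (hid x hx).symm
  obtain ⟨H, hc, h1, h2, h3⟩ := key h hid
  obtain ⟨H', hc', h1', h2', h3'⟩ := key h.symm hid'
  have inv : ∀ y, H' (H y) = y := by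
    intro y
    by_cases hy : y ∈ φ.target
    · obtain ⟨x, hx, rfl⟩ : ∃ x ∈ φ.source, φ x = y := ⟨_, φ.map_target hy, φ.right_inv hy⟩
      rw [h1 x hx, h1' _ (h3 x hx)]; simp
    · have hy' : y ∉ φ '' S := by
        rintro ⟨x, hx, rfl⟩
        exact hy (φ.map_source (hS hx))
      rw [h2 y hy', h2' y hy']
  have inv' : ∀ y, H (H' y) = y := by
    intro y
    by_cases hy : y ∈ φ.target
    · obtain ⟨x, hx, rfl⟩ : ∃ x ∈ φ.source, φ x = y := ⟨_, φ.map_target hy, φ.right_inv hy⟩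
      rw [h1' x hx, h1 _ (h3' x hx)]; simp
    · have hy' : y ∉ φ '' S := by
        rintro ⟨x, hx, rfl⟩
        exact hy (φ.map_source (hS hx))
      rw [h2' y hy', h2 y hy']
  exact ⟨⟨⟨H, H', inv, inv'⟩, hc, hc'⟩, h1, h2⟩

section Parabolic
variable {Y : Type*} [NormedAddCommGroup Y]

noncomputable def pA (p : Y × ℝ) : ℝ := √((√(p.2 ^ 2 + ‖p.1‖ ^ 2) + p.2) / 2)
noncomputable def pB (p : Y × ℝ) : ℝ := √((√(p.2 ^ 2 + ‖p.1‖ ^ 2) - p.2) / 2)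

theorem pA_nonneg (p : Y × ℝ) : 0 ≤ pA p := Real.sqrt_nonneg _
theorem pB_nonneg (p : Y × ℝ) : 0 ≤ pB p := Real.sqrt_nonneg _
theorem pA_cont : Continuous (pA : Y × ℝ → ℝ) := by unfold pA; fun_prop
theorem pB_cont : Continuous (pB : Y × ℝ → ℝ) := by unfold pB; fun_prop

theorem pAB_aux (p : Y × ℝ) : pA p ^ 2 = (√(p.2 ^ 2 + ‖p.1‖ ^ 2) + p.2) / 2 ∧
    pB p ^ 2 = (√(p.2 ^ 2 + ‖p.1‖ ^ 2) - p.2) / 2 := by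
  have h : |p.2| ≤ √(p.2 ^ 2 + ‖p.1‖ ^ 2) := Real.abs_le_sqrt (by nlinarith [sq_nonneg ‖p.1‖])
  obtain ⟨h1, h2⟩ := abs_le.1 h
  exact ⟨Real.sq_sqrt (by linarith), Real.sq_sqrt (by linarith)⟩

theorem pAB_snd (p : Y × ℝ) : pA p ^ 2 - pB p ^ 2 = p.2 := by
  obtain ⟨h1, h2⟩ := pAB_aux p
  rw [h1, h2]; ring

theorem pAB_norm (p : Y × ℝ) : 2 * pA p * pB p = ‖p.1‖ := by
  obtain ⟨h1, h2⟩ := pAB_aux p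
  have h3 : (2 * pA p * pB p) ^ 2 = ‖p.1‖ ^ 2 := by
    have : (2 * pA p * pB p) ^ 2 = 4 * pA p ^ 2 * pB p ^ 2 := by ring
    rw [this, h1, h2]
    have := Real.sq_sqrt (show 0 ≤ p.2 ^ 2 + ‖p.1‖ ^ 2 by positivity)
    nlinarith
  have := pA_nonneg p
  have := pB_nonneg p
  exact (sq_eq_sq₀ (by positivity) (by positivity)).1 h3

theorem pAB_unique (p : Y × ℝ) (a b : ℝ) (ha : 0 ≤ a) (hb : 0 ≤ b) (h1 : a ^ 2 - b ^ 2 = p.2)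
    (h2 : 2 * a * b = ‖p.1‖) : pA p = a ∧ pB p = b := by
  have h : √(p.2 ^ 2 + ‖p.1‖ ^ 2) = a ^ 2 + b ^ 2 := by
    rw [← h1, ← h2, ← Real.sqrt_sq (show 0 ≤ a ^ 2 + b ^ 2 by positivity)]
    congr 1; ring
  unfold pA pB
  rw [h, ← h1]
  constructor
  · rw [show (a ^ 2 + b ^ 2 + (a ^ 2 - b ^ 2)) / 2 = a ^ 2 by ring, Real.sqrt_sq ha]
  · rw [show (a ^ 2 + b ^ 2 - (a ^ 2 - b ^ 2)) / 2 = b ^ 2 by ring, Real.sqrt_sq hb]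

variable [NormedSpace ℝ Y]

noncomputable def vmap (k : ℝ → ℝ → ℝ) (p : Y × ℝ) : Y × ℝ :=
  (k (pA p) (pB p) • p.1, pA p ^ 2 - (k (pA p) (pB p) * pB p) ^ 2)

theorem vmap_AB (k : ℝ → ℝ → ℝ) (p : Y × ℝ) (hk : 0 ≤ k (pA p) (pB p)) :
    pA (vmap k p) = pA p ∧ pB (vmap k p) = k (pA p) (pB p) * pB p := by
  apply pAB_unique _ _ _ (pA_nonneg p) (mul_nonneg hk (pB_nonneg p))
  · rfl
  · simp only [vmap, norm_smul, Real.norm_of_nonneg hk, ← pAB_norm p]; ring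

theorem vmap_inv (k k' : ℝ → ℝ → ℝ) (p : Y × ℝ) (hk : 0 ≤ k (pA p) (pB p))
    (h : k' (pA p) (k (pA p) (pB p) * pB p) * k (pA p) (pB p) = 1) :
    vmap k' (vmap k p) = p := by
  obtain ⟨h1, h2⟩ := vmap_AB k p hk
  unfold vmap at h1 h2 ⊢
  rw [h1, h2]
  ext1
  · simp [smul_smul, h]
  · simp only
    rw [← mul_assoc, h, one_mul, pAB_snd]

theorem vmap_id (k : ℝ → ℝ → ℝ) (p : Y × ℝ) (hk : k (pA p) (pB p) = 1) : vmap k p = p := by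
  unfold vmap
  rw [hk]; ext1
  · simp
  · simp [pAB_snd]

theorem vmap_cont (k : ℝ → ℝ → ℝ) (hk : Continuous (fun q : ℝ × ℝ => k q.1 q.2)) :
    Continuous (vmap k : Y × ℝ → Y × ℝ) := by
  have h : Continuous (fun p : Y × ℝ => k (pA p) (pB p)) :=
    hk.comp (pA_cont.prodMk pB_cont)
  unfold vmap
  have := pA_cont (Y := Y)
  have := pB_cont (Y := Y)
  fun_prop

/-- piecewise linear factor -/
noncomputable def plk (p q p' q' : ℝ → ℝ) (a b : ℝ) : ℝ :=
  (p' a + (q' a - p' a) / (q a - p a) * (min (max b (p a)) (q a) - p a) + (max b (q a) - q a)) /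
    max b (p a)

end Parabolic

structure PLdata (p q p' q' : ℝ → ℝ) : Prop where
  cp : Continuous p
  cq : Continuous q
  cp' : Continuous p'
  cq' : Continuous q'
  p0 : ∀ a, 0 < p a
  pq : ∀ a, p a < q a
  p0' : ∀ a, 0 < p' a
  pq' : ∀ a, p' a < q' a

theorem PLdata.swap {p q p' q' : ℝ → ℝ} (d : PLdata p q p' q') : PLdata p' q' p q :=
  ⟨d.cp', d.cq', d.cp, d.cq, d.p0', d.pq', d.p0, d.pq⟩

theorem PLdata.cont {p q p' q' : ℝ → ℝ} (d : PLdata p q p' q') :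
    Continuous (fun r : ℝ × ℝ => plk p q p' q' r.1 r.2) := by
  obtain ⟨_, _, _, _, h0, h1, h2, h3⟩ := d
  unfold plk
  refine Continuous.div (Continuous.add (Continuous.add (by fun_prop) (Continuous.mul
    (Continuous.div (by fun_prop) (by fun_prop) ?_) (by fun_prop))) (by fun_prop)) (by fun_prop) ?_
  · intro x; have := h1 x.1; linarith
  · intro x; have := h0 x.1; have := le_max_right x.2 (p x.1); linarith

theorem PLdata.eval {p q p' q' : ℝ → ℝ} (d : PLdata p q p' q') (a b : ℝ) (hb : 0 ≤ b) :
    (b ≤ p a → plk p q p' q' a b * b = p' a / p a * b) ∧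
    (p a ≤ b → b ≤ q a →
      plk p q p' q' a b * b = p' a + (q' a - p' a) / (q a - p a) * (b - p a)) ∧
    (q a ≤ b → plk p q p' q' a b * b = q' a + (b - q a)) := by
  have h0 := d.p0 a; have h1 := d.pq a
  unfold plk
  refine ⟨fun h => ?_, fun h h' => ?_, fun h => ?_⟩
  · rw [max_eq_right h, max_eq_right (h.trans h1.le), min_eq_left h1.le]
    simp
  · rw [max_eq_left h, max_eq_right h', min_eq_left h', div_mul_cancel₀ _ (by linarith)]
    ring
  · rw [max_eq_left (h1.le.trans h), max_eq_left h, min_eq_right h,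
      div_mul_cancel₀ _ (by linarith), div_mul_cancel₀ _ (by linarith)]
    ring

theorem PLdata.factor_low {p q p' q' : ℝ → ℝ} (d : PLdata p q p' q') (a b : ℝ)
    (h : b ≤ p a) : plk p q p' q' a b = p' a / p a := by
  have h1 := d.pq a
  unfold plk
  rw [max_eq_right h, max_eq_right (h.trans h1.le), min_eq_left h1.le]; simp

theorem PLdata.pos {p q p' q' : ℝ → ℝ} (d : PLdata p q p' q') (a b : ℝ) :
    0 < plk p q p' q' a b := by
  have h0 := d.p0 a; have h1 := d.pq a; have h2 := d.p0' a; have h3 := d.pq' a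
  unfold plk
  refine div_pos ?_ (lt_max_of_lt_right h0)
  have : 0 ≤ (q' a - p' a) / (q a - p a) := div_nonneg (by linarith) (by linarith)
  have h4 : 0 ≤ min (max b (p a)) (q a) - p a := by
    rw [sub_nonneg]; exact le_min (le_max_right _ _) h1.le
  have h5 := le_max_right b (q a)
  have := mul_nonneg this h4
  linarith

theorem PLdata.inv {p q p' q' : ℝ → ℝ} (d : PLdata p q p' q') (a b : ℝ) (hb : 0 ≤ b) :
    plk p' q' p q a (plk p q p' q' a b * b) * plk p q p' q' a b = 1 := by
  have h0 := d.p0 a; have h1 := d.pq a; have h2 := d.p0' a; have h3 := d.pq' a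
  have hpos := d.pos a b
  rcases le_or_gt b (p a) with h | h
  · have e1 := (d.eval a b hb).1 h
    rw [e1, d.factor_low a b h, d.swap.factor_low]
    · field_simp
    · calc p' a / p a * b ≤ p' a / p a * p a := by gcongr
        _ = p' a := by field_simp
  · have hb' : 0 < b := h0.trans h
    have hc : 0 ≤ plk p q p' q' a b * b := by positivity
    suffices plk p' q' p q a (plk p q p' q' a b * b) * (plk p q p' q' a b * b) = b by
      have := congrArg (· / b) this
      simp only [← mul_assoc] at this
      rwa [mul_div_cancel_right₀ _ hb'.ne', div_self hb'.ne'] at this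
    rcases le_or_gt b (q a) with h' | h'
    · have e1 := (d.eval a b hb).2.1 h.le h'
      have hs : 0 ≤ (q' a - p' a) / (q a - p a) := div_nonneg (by linarith) (by linarith)
      have h6 : (q' a - p' a) / (q a - p a) * (b - p a) ≤ q' a - p' a := by
        calc _ ≤ (q' a - p' a) / (q a - p a) * (q a - p a) := by gcongr
          _ = _ := div_mul_cancel₀ _ (by linarith)
      have h7 := mul_nonneg hs (sub_nonneg.2 h.le)
      rw [(d.swap.eval a _ hc).2.1 (by linarith) (by linarith), e1]
      have : q a - p a ≠ 0 := by linarith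
      have : q' a - p' a ≠ 0 := by linarith
      field_simp
      ring
    · have e1 := (d.eval a b hb).2.2 h'.le
      rw [(d.swap.eval a _ hc).2.2 (by linarith), e1]; ring

section VH
variable {Y : Type*} [NormedAddCommGroup Y] [NormedSpace ℝ Y]

theorem exists_VH {p q p' q' : ℝ → ℝ} (d : PLdata p q p' q') :
    ∃ H : (Y × ℝ) ≃ₜ (Y × ℝ), (∀ x, pA (H x) = pA x) ∧
      (∀ x, pB (H x) = plk p q p' q' (pA x) (pB x) * pB x) ∧
      (∀ x, plk p q p' q' (pA x) (pB x) = 1 → H x = x) := by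
  refine ⟨⟨⟨vmap (plk p q p' q'), vmap (plk p' q' p q), ?_, ?_⟩, vmap_cont _ d.cont,
    vmap_cont _ d.swap.cont⟩, ?_, ?_, ?_⟩
  · intro x; exact vmap_inv _ _ _ (d.pos _ _).le (d.inv _ _ (pB_nonneg _))
  · intro x; exact vmap_inv _ _ _ (d.swap.pos _ _).le (d.swap.inv _ _ (pB_nonneg _))
  · intro x; exact (vmap_AB _ _ (d.pos _ _).le).1
  · intro x; exact (vmap_AB _ _ (d.pos _ _).le).2
  · intro x hx; exact vmap_id _ _ hx
end VH

open Filter Topology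

section S4
variable {Y : Type*} [NormedAddCommGroup Y]

theorem pB_eq_zero (p : Y × ℝ) : pB p = 0 ↔ p.1 = 0 ∧ 0 ≤ p.2 := by
  constructor
  · intro h
    have h1 := pAB_norm p; have h2 := pAB_snd p
    rw [h] at h1 h2
    refine ⟨by rw [← norm_eq_zero, ← h1]; simp, by rw [← h2]; nlinarith [sq_nonneg (pA p)]⟩
  · rintro ⟨h1, h2⟩
    exact (pAB_unique p (√p.2) 0 (Real.sqrt_nonneg _) le_rfl (by simp [Real.sq_sqrt h2])
      (by simp [h1])).2

theorem pAB_compact [ProperSpace Y] (A B : ℝ) : IsCompact {x : Y × ℝ | pA x ≤ A ∧ pB x ≤ B} := by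
  refine Metric.isCompact_of_isClosed_isBounded ?_ ?_
  · exact (isClosed_le pA_cont continuous_const).inter (isClosed_le pB_cont continuous_const)
  · refine (Metric.isBounded_iff_subset_closedBall 0).2 ⟨2 * A * B + A ^ 2 + B ^ 2, ?_⟩
    rintro x ⟨h1, h2⟩
    have a0 := pA_nonneg x; have b0 := pB_nonneg x
    have e1 := pAB_norm x; have e2 := pAB_snd x
    rw [mem_closedBall_zero_iff, Prod.norm_def]
    have : pA x ^ 2 ≤ A ^ 2 := by gcongr
    have : pB x ^ 2 ≤ B ^ 2 := by gcongr
    have h3 : 2 * pA x * pB x ≤ 2 * A * B := by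
      have : 0 ≤ A := a0.trans h1
      gcongr
    have h4 : 0 ≤ 2 * A * B := le_trans (by positivity) h3
    have h5 := sq_nonneg A; have h6 := sq_nonneg B
    have h7 := sq_nonneg (pA x); have h8 := sq_nonneg (pB x)
    refine max_le (by linarith) ?_
    rw [Real.norm_eq_abs, abs_le]; constructor <;> linarith

theorem exists_minor [ProperSpace Y] (U : Set (Y × ℝ)) (hU : IsOpen U)
    (hR : ∀ x, pB x = 0 → x ∈ U) :
    ∃ δ : ℝ → ℝ, Continuous δ ∧ (∀ a, 0 < δ a) ∧ (∀ a, δ a ≤ 1) ∧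
      ∀ x, pB x ≤ δ (pA x) → x ∈ U := by
  obtain ⟨g, hg⟩ := exists_continuous_forall_mem_convex_of_local_const
    (t := fun a : ℝ => {d : ℝ | 0 < d ∧ d ≤ 1 ∧ ∀ x : Y × ℝ, pA x = a → pB x ≤ d → x ∈ U})
    (by
      intro a d1 h1 d2 h2 s t hs ht hst
      simp only [smul_eq_mul, Set.mem_ofPred_eq] at *
      obtain ⟨h11, h12, h13⟩ := h1
      obtain ⟨h21, h22, h23⟩ := h2
      have hle : s * d1 + t * d2 ≤ max d1 d2 := by
        calc _ ≤ s * max d1 d2 + t * max d1 d2 := by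
              gcongr
              · exact le_max_left _ _
              · exact le_max_right _ _
          _ = max d1 d2 := by rw [← add_mul, hst, one_mul]
      have hge : min d1 d2 ≤ s * d1 + t * d2 := by
        calc min d1 d2 = s * min d1 d2 + t * min d1 d2 := by rw [← add_mul, hst, one_mul]
          _ ≤ _ := by
              gcongr
              · exact min_le_left _ _
              · exact min_le_right _ _
      refine ⟨lt_of_lt_of_le (lt_min h11 h21) hge, hle.trans (max_le h12 h22), fun x hx hb => ?_⟩
      rcases le_max_iff.1 (hb.trans hle) with h | h
      · exact h13 x hx h
      · exact h23 x hx h)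
    (by
      intro a0
      have hK := (pAB_compact (Y := Y) (a0 + 1) 1).diff hU
      obtain ⟨d, hd0, hd⟩ : ∃ d, 0 < d ∧ ∀ x ∈ {x : Y × ℝ | pA x ≤ a0 + 1 ∧ pB x ≤ 1} \ U,
          d < pB x := by
        rcases Set.eq_empty_or_nonempty ({x : Y × ℝ | pA x ≤ a0 + 1 ∧ pB x ≤ 1} \ U) with h | h
        · exact ⟨1, one_pos, by rw [h]; simp⟩
        · obtain ⟨x0, hx0, hmin⟩ := hK.exists_isMinOn h pB_cont.continuousOn
          have hpos : 0 < pB x0 := lt_of_le_of_ne (pB_nonneg _) fun h' => hx0.2 (hR _ h'.symm)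
          exact ⟨pB x0 / 2, by linarith, fun x hx => by have := hmin hx; simp at this; linarith⟩
      refine ⟨min d 1, ?_⟩
      filter_upwards [Iio_mem_nhds (show a0 < a0 + 1 by linarith)] with a ha
      refine ⟨lt_min hd0 one_pos, min_le_right _ _, fun x hx hb => ?_⟩
      by_contra hc
      have := hd x ⟨⟨by rw [hx]; exact le_of_lt ha, hb.trans (min_le_right _ _)⟩, hc⟩
      exact absurd (hb.trans (min_le_left _ _)) (not_le.2 this))
  exact ⟨g, g.continuous, fun a => (hg a).1, fun a => (hg a).2.1, fun x hx => (hg _).2.2 x rfl hx⟩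

structure Good (β : Y × ℝ → Y × ℝ) : Prop where
  emb : IsOpenEmbedding β
  fix : ∀ x, pB x = 0 → β x = x
  closed : ∀ c, IsClosed (β '' {x | pB x ≤ c})
  growth : ∀ c A, ∃ K, ∀ x, pB x ≤ c → pA (β x) ≤ A → pB (β x) ≤ K

variable [NormedSpace ℝ Y]

theorem Good.step [ProperSpace Y] {β : Y × ℝ → Y × ℝ} (hβ : Good β) (c c' k : ℝ) (hc : 0 < c)
    (hcc : c < c') :
    ∃ e : (Y × ℝ) ≃ₜ (Y × ℝ), Good (e ∘ β) ∧ (∀ x, pB x ≤ c → e (β x) = β x) ∧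
      ∀ y, pB y ≤ k → ∃ x, pB x ≤ c' ∧ e (β x) = y := by
  obtain ⟨δ, δc, δ0, δ1, hδ⟩ := exists_minor (β '' {x | pB x < c'})
    (hβ.emb.isOpenMap _ (isOpen_lt pB_cont continuous_const))
    (fun x hx => ⟨x, by simp only [Set.mem_ofPred_eq, hx]; linarith, hβ.fix x hx⟩)
  obtain ⟨f', f'c, f'0, -, hf'⟩ := exists_minor (β ⁻¹' {x | pB x < δ (pA x) / 2})
    ((isOpen_lt pB_cont ((δc.comp pA_cont).div_const 2)).preimage hβ.emb.continuous)
    (fun x hx => by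
      simp only [Set.mem_preimage, hβ.fix x hx, Set.mem_ofPred_eq, hx]
      have := δ0 (pA x); linarith)
  -- squeeze
  have dS : PLdata (fun _ => c) (fun _ => c') (fun a => min (f' a) (c / 2)) (fun _ => c') :=
    ⟨by fun_prop, by fun_prop, by fun_prop, by fun_prop, fun _ => hc, fun _ => hcc,
      fun a => lt_min (f'0 a) (by linarith), fun a => (min_le_right _ _).trans_lt (by linarith)⟩
  obtain ⟨S, SA, SB, Sid⟩ := exists_VH (Y := Y) dS
  have Sid' : ∀ x, x ∉ {x : Y × ℝ | pB x ≤ c'} → S x = x := by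
    intro x hx
    simp only [Set.mem_ofPred_eq, not_le] at hx
    apply Sid
    have := (dS.eval (pA x) (pB x) (pB_nonneg x)).2.2 hx.le
    have h0 : 0 < pB x := by linarith
    have h2 : plk (fun _ => c) (fun _ => c') (fun a => min (f' a) (c / 2)) (fun _ => c')
      (pA x) (pB x) * pB x = 1 * pB x := by rw [this]; ring
    exact mul_right_cancel₀ h0.ne' h2
  have Sm : ∀ x, pB x ≤ c' → pB (S x) ≤ c' := by
    intro x hx
    by_contra hcon
    have := Sid' (S x) hcon
    rw [S.injective this] at hcon; exact hcon hx
  have Sm' : ∀ x, pB x ≤ c' → pB (S.symm x) ≤ c' := by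
    intro x hx
    by_contra hcon
    have := Sid' (S.symm x) hcon
    rw [S.apply_symm_apply] at this
    rw [← this] at hcon; exact hcon hx
  let φ := hβ.emb.toOpenPartialHomeomorph β
  obtain ⟨σ, σ1, σ2⟩ := ext_lemma φ S {x | pB x ≤ c'} (by simp [φ]) Sid' (by
    simpa [φ] using hβ.closed c')
  have σβ : ∀ x, σ (β x) = β (S x) := fun x => by simpa [φ] using σ1 x (by simp [φ])
  have σid : ∀ y, y ∉ β '' {x | pB x ≤ c'} → σ y = y := fun y hy => σ2 y (by simpa [φ] using hy)
  have σZ : ∀ y ∈ β '' {x | pB x ≤ c'}, σ y ∈ β '' {x | pB x ≤ c'} := by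
    rintro _ ⟨x, hx, rfl⟩; exact ⟨S x, Sm x hx, (σβ x).symm⟩
  have σZ' : ∀ y ∈ β '' {x | pB x ≤ c'}, σ.symm y ∈ β '' {x | pB x ≤ c'} := by
    rintro _ ⟨x, hx, rfl⟩
    refine ⟨S.symm x, Sm' x hx, ?_⟩
    rw [Homeomorph.eq_symm_apply, σβ]; simp
  -- expansion
  obtain ⟨κ, hκ⟩ := exists_continuous_forall_mem_convex_of_local_const
    (t := fun a : ℝ => {K : ℝ | 1 ≤ K ∧ k ≤ K ∧ ∀ x : Y × ℝ, pB x ≤ c' → pA (β x) = a →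
      pB (β x) ≤ K})
    (by
      have : ∀ a : ℝ, {K : ℝ | 1 ≤ K ∧ k ≤ K ∧ ∀ x : Y × ℝ, pB x ≤ c' → pA (β x) = a →
          pB (β x) ≤ K} = Set.Ici 1 ∩ (Set.Ici k ∩ ⋂ x : Y × ℝ, ⋂ _ : pB x ≤ c',
            ⋂ _ : pA (β x) = a, Set.Ici (pB (β x))) := by
        intro a; ext K; simp
      intro a
      rw [this]
      exact (convex_Ici _).inter ((convex_Ici _).inter (convex_iInter fun _ => convex_iInter
        fun _ => convex_iInter fun _ => convex_Ici _)))
    (by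
      intro a0
      obtain ⟨K, hK⟩ := hβ.growth c' (a0 + 1)
      refine ⟨max 1 (max k K), ?_⟩
      filter_upwards [Iio_mem_nhds (show a0 < a0 + 1 by linarith)] with a ha
      refine ⟨le_max_left _ _, (le_max_left _ _).trans (le_max_right _ _), fun x hx hxa => ?_⟩
      exact (hK x hx (by rw [hxa]; exact le_of_lt ha)).trans
        ((le_max_right _ _).trans (le_max_right _ _)))
  have dE : PLdata (fun a => δ a / 2) δ (fun a => δ a / 2) κ :=
    ⟨by fun_prop, δc, by fun_prop, κ.continuous, fun a => by have := δ0 a; linarith,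
      fun a => by have := δ0 a; linarith, fun a => by have := δ0 a; linarith,
      fun a => by have := δ0 a; have := δ1 a; have := (hκ a).1; linarith⟩
  obtain ⟨E, EA, EB, Eid⟩ := exists_VH (Y := Y) dE
  have Eid' : ∀ x, pB x ≤ δ (pA x) / 2 → E x = x := by
    intro x hx
    apply Eid
    rw [dE.factor_low _ _ hx]
    have := δ0 (pA x)
    exact div_self (by linarith)
  have EA' : ∀ y, pA (E.symm y) = pA y := fun y => by
    have := EA (E.symm y); rw [E.apply_symm_apply] at this; exact this.symm
  have EB' : ∀ y, pB y ≤ κ (pA y) → pB (E.symm y) ≤ δ (pA y) := by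
    intro y hy
    by_contra hcon
    push Not at hcon
    have h1 := EB (E.symm y)
    rw [E.apply_symm_apply, EA', (dE.eval (pA y) (pB (E.symm y)) (pB_nonneg _)).2.2 hcon.le] at h1
    linarith
  refine ⟨σ.trans (E.trans σ.symm), ?_, ?_, ?_⟩
  rotate_left
  · intro x hx
    simp only [Homeomorph.trans_apply]
    rw [σβ, Eid', ← σβ, σ.symm_apply_apply]
    refine le_of_lt (hf' (S x) ?_)
    rw [SB, SA, (dS.eval (pA x) (pB x) (pB_nonneg x)).1 hx]
    calc _ ≤ min (f' (pA x)) (c / 2) / c * c := by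
          gcongr
          exact div_nonneg (dS.p0' (pA x)).le hc.le
      _ ≤ _ := by rw [div_mul_cancel₀ _ hc.ne']; exact min_le_left _ _
  · intro y hy
    have h1 : pB (σ y) ≤ κ (pA (σ y)) := by
      by_cases hyZ : y ∈ β '' {x | pB x ≤ c'}
      · obtain ⟨x, hx, hxy⟩ := σZ y hyZ
        rw [← hxy]
        exact (hκ _).2.2 x hx rfl
      · rw [σid y hyZ]; exact hy.trans (hκ _).2.1
    have h2 := hδ (E.symm (σ y)) (by rw [EA']; exact EB' _ h1)
    have h3 : E.symm (σ y) ∈ β '' {x | pB x ≤ c'} :=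
      Set.image_mono (fun x (hx : pB x < c') => hx.le) h2
    obtain ⟨x, hx, hxy⟩ := σZ' _ h3
    refine ⟨x, hx, ?_⟩
    simp [hxy]
  · refine ⟨(σ.trans (E.trans σ.symm)).isOpenEmbedding.comp hβ.emb, ?_, ?_, ?_⟩
    · intro x hx
      have hfix := hβ.fix x hx
      simp only [Function.comp, Homeomorph.trans_apply]
      have : β (S x) = S x := hβ.fix _ (by rw [SB, hx]; simp)
      rw [σβ, Eid', ← σβ, σ.symm_apply_apply, hfix]
      rw [this, SB, hx, mul_zero]
      have := δ0 (pA (S x)); linarith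
    · intro c1
      rw [Set.image_comp]
      exact (σ.trans (E.trans σ.symm)).isClosedMap _ (hβ.closed c1)
    · intro c1 A
      obtain ⟨K1, hK1⟩ := hβ.growth c1 A
      obtain ⟨K2, hK2⟩ := hβ.growth c' A
      have hb := ((pAB_compact (Y := Y) A (max K1 K2)).image E.continuous).image pB_cont
      obtain ⟨K3, hK3⟩ := hb.bddAbove
      refine ⟨max K2 K3, fun x hx hA => ?_⟩
      simp only [Function.comp, Homeomorph.trans_apply] at hA ⊢
      by_cases hw : E (σ (β x)) ∈ β '' {x | pB x ≤ c'}
      · obtain ⟨x', hx', he⟩ := σZ' _ hw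
        rw [← he] at hA ⊢
        exact (hK2 x' hx' hA).trans (le_max_left _ _)
      · have e1 : σ.symm (E (σ (β x))) = E (σ (β x)) := by
          rw [Homeomorph.symm_apply_eq]; exact (σid _ hw).symm
        rw [e1] at hA ⊢
        refine le_trans (hK3 ⟨_, ⟨σ (β x), ⟨by rwa [EA] at hA, ?_⟩, rfl⟩, rfl⟩) (le_max_right _ _)
        rw [EA] at hA
        by_cases hv : β x ∈ β '' {x | pB x ≤ c'}
        · obtain ⟨x', hx', he⟩ := σZ _ hv
          rw [← he] at hA ⊢
          exact (hK2 x' hx' hA).trans (le_max_right _ _)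
        · rw [σid _ hv] at hA ⊢
          exact (hK1 x hx hA).trans (le_max_left _ _)

theorem Good.telescope [ProperSpace Y] {β : Y × ℝ → Y × ℝ} (hβ : Good β) :
    ∃ g : (Y × ℝ) ≃ₜ (Y × ℝ), ∀ x, pB x ≤ 1 → g x = β x := by
  have step : ∀ (k : ℕ) (b : {β : Y × ℝ → Y × ℝ // Good β}),
      ∃ b' : {β : Y × ℝ → Y × ℝ // Good β}, (∀ x, pB x ≤ k + 1 → b'.1 x = b.1 x) ∧
        ∀ y, pB y ≤ k → ∃ x, pB x ≤ k + 2 ∧ b'.1 x = y := by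
    intro k b
    obtain ⟨e, h1, h2, h3⟩ := b.2.step (k + 1) (k + 2) k (by positivity) (by linarith)
    exact ⟨⟨_, h1⟩, h2, h3⟩
  choose F hF1 hF2 using step
  let s : ℕ → {β : Y × ℝ → Y × ℝ // Good β} := fun k => Nat.rec ⟨β, hβ⟩ (fun k b => F k b) k
  have hs : ∀ k, s (k + 1) = F k (s k) := fun k => rfl
  have hst : ∀ (k : ℕ) x, pB x ≤ k + 1 → ∀ j, k ≤ j → (s j).1 x = (s k).1 x := by
    intro k x hx j hj
    induction j, hj using Nat.le_induction with
    | base => rfl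
    | succ j hj ih =>
      rw [hs, hF1 j (s j) x (hx.trans (by gcongr)), ih]
  let g : Y × ℝ → Y × ℝ := fun x => (s ⌈pB x⌉₊).1 x
  have hg : ∀ (k : ℕ) x, pB x ≤ k + 1 → g x = (s k).1 x := by
    intro k x hx
    have hx' : pB x ≤ ⌈pB x⌉₊ := Nat.le_ceil _
    rcases le_total k ⌈pB x⌉₊ with h | h
    · exact hst k x hx _ h
    · exact (hst _ x (by linarith) _ h).symm
  have gc : Continuous g := by
    rw [continuous_iff_continuousAt]
    intro x
    obtain ⟨k, hk⟩ := exists_nat_gt (pB x)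
    refine ((s k).2.emb.continuous.continuousAt (x := x)).congr ?_
    filter_upwards [(isOpen_lt pB_cont continuous_const).mem_nhds hk] with y hy
    exact (hg k y (le_of_lt (lt_trans hy (by linarith)))).symm
  have gi : Function.Injective g := by
    intro x y hxy
    obtain ⟨k, hk⟩ := exists_nat_gt (max (pB x) (pB y))
    have h1 := (max_lt_iff.1 hk)
    rw [hg k x (by linarith), hg k y (by linarith)] at hxy
    exact (s k).2.emb.injective hxy
  have gs : Function.Surjective g := by
    intro y
    obtain ⟨k, hk⟩ := exists_nat_gt (pB y)
    obtain ⟨x, hx, hxy⟩ := hF2 k (s k) y hk.le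
    refine ⟨x, ?_⟩
    rw [hg (k + 1) x (by push_cast; linarith), hs, hxy]
  have go : IsOpenMap g := by
    rw [isOpenMap_iff_nhds_le]
    intro x
    obtain ⟨k, hk⟩ := exists_nat_gt (pB x)
    have h1 := (s k).2.emb.isOpenMap.nhds_le x
    rw [hg k x (by linarith)]
    refine h1.trans (le_of_eq ?_)
    apply Filter.map_congr
    filter_upwards [(isOpen_lt pB_cont continuous_const).mem_nhds hk] with y hy
    exact (hg k y (le_of_lt (lt_trans hy (by linarith)))).symm
  exact ⟨(Equiv.ofBijective g ⟨gi, gs⟩).toHomeomorphOfContinuousOpen gc go,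
    fun x hx => hg 0 x (by simpa using hx)⟩

theorem S4 [ProperSpace Y] (α : OpenPartialHomeomorph (Y × ℝ) (Y × ℝ))
    (hR : ∀ z : ℝ, 0 ≤ z → (0, z) ∈ α.source ∧ α (0, z) = (0, z)) :
    ∃ g : (Y × ℝ) ≃ₜ (Y × ℝ), ∃ U : Set (Y × ℝ), IsOpen U ∧ (∀ z : ℝ, 0 ≤ z → (0, z) ∈ U) ∧
      U ⊆ α.source ∧ ∀ x ∈ U, g x = α x := by
  have hR' : ∀ x, pB x = 0 → x ∈ α.source ∧ α x = x := by
    rintro ⟨y, z⟩ hx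
    obtain ⟨rfl, h2⟩ := (pB_eq_zero _).1 hx
    exact hR z h2
  have hO : IsOpen (α.source ∩ (fun x => dist (α x) x) ⁻¹' Set.Iio 1) :=
    ContinuousOn.isOpen_inter_preimage (continuous_dist.comp_continuousOn (α.continuousOn.prodMk continuousOn_id)) α.open_source isOpen_Iio
  obtain ⟨f, fc, f0, f1, hf⟩ := exists_minor _ hO (fun x hx => ⟨(hR' x hx).1, by
    simp [(hR' x hx).2]⟩)
  let k0 : ℝ → ℝ → ℝ := fun a b => (f a - f a ^ 2 / (4 * max b (f a / 2))) / max b (f a / 2)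
  let k1 : ℝ → ℝ → ℝ := fun a b => f a ^ 2 / (4 * (f a - max b (f a / 2)) * max b (f a / 2))
  have hm : ∀ a b, 0 < max b (f a / 2) := fun a b => lt_max_of_lt_right (by have := f0 a; linarith)
  have k0c : Continuous (fun q : ℝ × ℝ => k0 q.1 q.2) := by
    simp only [k0]
    refine Continuous.div (Continuous.sub (by fun_prop) (Continuous.div (by fun_prop) (by fun_prop)
      ?_)) (by fun_prop) ?_
    · intro q; have := hm q.1 q.2; positivity
    · intro q; exact (hm q.1 q.2).ne'
  have k0low : ∀ a b, b ≤ f a / 2 → k0 a b = 1 := by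
    intro a b hb
    have := f0 a
    simp only [k0]; rw [max_eq_right hb]; field_simp; norm_num
  have k1low : ∀ a b, b ≤ f a / 2 → k1 a b = 1 := by
    intro a b hb
    have := f0 a
    simp only [k1]; rw [max_eq_right hb]
    have : f a - f a / 2 = f a / 2 := by ring
    rw [this]; field_simp; norm_num
  have k0hi : ∀ a b, f a / 2 ≤ b → k0 a b * b = f a - f a ^ 2 / (4 * b) := by
    intro a b hb
    have h0 := f0 a
    have : 0 < b := by linarith
    simp only [k0]; rw [max_eq_left hb]; field_simp
  have k1hi : ∀ a b, f a / 2 ≤ b → b < f a → k1 a b * b = f a ^ 2 / (4 * (f a - b)) := by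
    intro a b hb hb'
    have h0 := f0 a
    have : 0 < b := by linarith
    have : f a - b ≠ 0 := by linarith
    simp only [k1]; rw [max_eq_left hb]; field_simp
  have k0pos : ∀ a b, 0 < k0 a b := by
    intro a b
    have h0 := f0 a; have h1 := hm a b
    have h2 := le_max_right b (f a / 2)
    refine div_pos ?_ h1
    rw [sub_pos, div_lt_iff₀ (by positivity)]; nlinarith
  have k0lt : ∀ a b, 0 ≤ b → k0 a b * b < f a := by
    intro a b hb
    have h0 := f0 a
    rcases le_total b (f a / 2) with h | h
    · rw [k0low a b h]; linarith
    · have : 0 < b := by linarith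
      rw [k0hi a b h]
      have : 0 < f a ^ 2 / (4 * b) := by positivity
      linarith
  have k1pos : ∀ a b, b < f a → 0 < k1 a b := by
    intro a b hb
    have h0 := f0 a; have h1 := hm a b
    have h2 : max b (f a / 2) < f a := max_lt hb (by linarith)
    have h3 : 0 < f a - max b (f a / 2) := by linarith
    simp only [k1]; positivity
  have inv01 : ∀ a b, 0 ≤ b → k1 a (k0 a b * b) * k0 a b = 1 := by
    intro a b hb
    have h0 := f0 a
    rcases le_total b (f a / 2) with h | h
    · rw [k0low a b h, one_mul, k1low a b h, one_mul]
    · have hb' : 0 < b := by linarith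
      have h1 : k1 a (k0 a b * b) * (k0 a b * b) = b := by
        rw [k1hi a _ ?_ (k0lt a b hb), k0hi a b h]
        · have : f a - (f a - f a ^ 2 / (4 * b)) = f a ^ 2 / (4 * b) := by ring
          rw [this]; field_simp
        · rw [k0hi a b h, le_sub_comm, div_le_iff₀ (by positivity)]; nlinarith
      have := congrArg (· / b) h1
      simp only [← mul_assoc] at this
      rwa [mul_div_cancel_right₀ _ hb'.ne', div_self hb'.ne'] at this
  have inv10 : ∀ a b, 0 ≤ b → b < f a → k0 a (k1 a b * b) * k1 a b = 1 := by
    intro a b hb hbf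
    have h0 := f0 a
    rcases le_total b (f a / 2) with h | h
    · rw [k1low a b h, one_mul, k0low a b h, one_mul]
    · have hb' : 0 < b := by linarith
      have h3 : 0 < f a - b := by linarith
      have h1 : k0 a (k1 a b * b) * (k1 a b * b) = b := by
        rw [k0hi a _ ?_, k1hi a b h hbf]
        · field_simp; ring
        · rw [k1hi a b h hbf, le_div_iff₀ (by positivity)]; nlinarith
      have := congrArg (· / b) h1
      simp only [← mul_assoc] at this
      rwa [mul_div_cancel_right₀ _ hb'.ne', div_self hb'.ne'] at this
  have hT : IsOpen {x : Y × ℝ | pB x < f (pA x)} := isOpen_lt pB_cont (fc.comp pA_cont)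
  let H : OpenPartialHomeomorph (Y × ℝ) (Y × ℝ) :=
    { toFun := vmap k0
      invFun := vmap k1
      source := Set.univ
      target := {x | pB x < f (pA x)}
      map_source' := by
        intro x _
        obtain ⟨h1, h2⟩ := vmap_AB k0 x (k0pos _ _).le
        simp only [Set.mem_ofPred_eq, h1, h2]
        exact k0lt _ _ (pB_nonneg _)
      map_target' := fun _ _ => Set.mem_univ _
      left_inv' := fun x _ => vmap_inv _ _ _ (k0pos _ _).le (inv01 _ _ (pB_nonneg _))
      right_inv' := fun x hx => vmap_inv _ _ _ (k1pos _ _ hx).le (inv10 _ _ (pB_nonneg _) hx)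
      open_source := isOpen_univ
      open_target := hT
      continuousOn_toFun := (vmap_cont k0 k0c).continuousOn
      continuousOn_invFun := by
        have hA := (pA_cont (Y := Y)).continuousOn (s := {x : Y × ℝ | pB x < f (pA x)})
        have hB := (pB_cont (Y := Y)).continuousOn (s := {x : Y × ℝ | pB x < f (pA x)})
        have hfA := (fc.comp (pA_cont (Y := Y))).continuousOn (s := {x : Y × ℝ | pB x < f (pA x)})
        simp only [Function.comp_def] at hfA
        have hk : ContinuousOn (fun x : Y × ℝ => k1 (pA x) (pB x)) {x | pB x < f (pA x)} := by
          simp only [k1]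
          refine ContinuousOn.div (by fun_prop) (by fun_prop) ?_
          intro x hx
          have h0 := f0 (pA x); have h1 := hm (pA x) (pB x)
          have h2 : max (pB x) (f (pA x) / 2) < f (pA x) := max_lt hx (by linarith)
          have h3 : 0 < f (pA x) - max (pB x) (f (pA x) / 2) := by linarith
          positivity
        unfold vmap
        exact (hk.smul continuousOn_fst).prodMk ((hA.pow 2).sub ((hk.mul hB).pow 2)) }
  have Hin : ∀ x, pB (H x) < f (pA (H x)) := fun x => H.map_source (Set.mem_univ x)
  have hsrc : (H.trans α).source = Set.univ := by
    rw [OpenPartialHomeomorph.trans_source]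
    ext x; simp only [Set.mem_inter_iff, Set.mem_preimage, Set.mem_univ, iff_true]
    exact ⟨Set.mem_univ _, (hf _ (Hin x).le).1⟩
  have Hlow : ∀ x, pB x ≤ f (pA x) / 2 → H x = x := fun x hx => vmap_id k0 x (k0low _ _ hx)
  have Hd : ∀ x, dist (α (H x)) (H x) < 1 := fun x => (hf _ (Hin x).le).2
  have good : Good (H.trans α) := by
    refine ⟨(H.trans α).isOpenEmbedding hsrc, ?_, ?_, ?_⟩
    · intro x hx
      have : H x = x := Hlow x (by rw [hx]; have := f0 (pA x); linarith)
      simp [this, (hR' x hx).2]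
    · intro c
      have hS : IsClosed {y : Y × ℝ | pB y ≤ k0 (pA y) (max c 0) * max c 0} :=
        isClosed_le pB_cont ((k0c.comp (pA_cont.prodMk continuous_const)).mul continuous_const)
      -- image of H
      have mono : ∀ a b b', 0 ≤ b → b ≤ b' → k0 a b * b ≤ k0 a b' * b' := by
        intro a b b' h0 h1
        have hfa := f0 a
        rcases le_total b (f a / 2) with h | h <;> rcases le_total b' (f a / 2) with h' | h'
        · rw [k0low _ _ h, k0low _ _ h']; linarith
        · have : 0 < b' := by linarith
          rw [k0low _ _ h, k0hi _ _ h', one_mul]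
          refine h.trans ?_
          rw [le_sub_comm, div_le_iff₀ (by positivity)]; nlinarith
        · have : b = b' := by linarith
          rw [this]
        · have : 0 < b := by linarith
          rw [k0hi _ _ h, k0hi _ _ h']; gcongr
      have hHB : ∀ x, pA (H x) = pA x ∧ pB (H x) = k0 (pA x) (pB x) * pB x :=
        fun x => vmap_AB k0 x (k0pos _ _).le
      rw [← isSeqClosed_iff_isClosed]
      intro u y hu huy
      choose x hx hxu using hu
      have hbd : ∀ n, dist (H (x n)) (u n) < 1 := fun n => by
        rw [← hxu n, dist_comm]; exact Hd (x n)
      have hub : Bornology.IsBounded (Set.range u) := Metric.isBounded_range_of_tendsto u huy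
      have hHb : Bornology.IsBounded (Set.range (fun n => H (x n))) := by
        obtain ⟨r, hr⟩ := hub.subset_closedBall (0 : Y × ℝ)
        refine (Metric.isBounded_iff_subset_closedBall (0 : Y × ℝ)).2 ⟨r + 1, ?_⟩
        rintro _ ⟨n, rfl⟩
        have h1 := hr ⟨n, rfl⟩
        rw [Metric.mem_closedBall] at h1 ⊢
        have := dist_triangle (H (x n)) (u n) 0
        have := hbd n
        linarith
      obtain ⟨w, -, ψ, hψ, hw⟩ := tendsto_subseq_of_bounded hHb (fun n => ⟨n, rfl⟩)
      by_cases hc : c < 0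
      · exact absurd (hx 0) (not_le.2 (hc.trans_le (pB_nonneg _)))
      rw [max_eq_left (not_lt.1 hc)] at hS
      have hwS : w ∈ {y : Y × ℝ | pB y ≤ k0 (pA y) c * c} := by
        refine hS.mem_of_tendsto hw (Eventually.of_forall fun n => ?_)
        simp only [Set.mem_ofPred_eq, Function.comp]
        rw [(hHB _).1, (hHB _).2]
        exact mono _ _ _ (pB_nonneg _) (hx _)
      have hwf : pB w < f (pA w) := lt_of_le_of_lt hwS (k0lt _ _ (not_lt.1 hc))
      refine ⟨H.symm w, ?_, ?_⟩
      · simp only [Set.mem_ofPred_eq]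
        by_contra hcon
        push Not at hcon
        have e1 : H (H.symm w) = w := H.right_inv hwf
        obtain ⟨e2, e3⟩ := hHB (H.symm w)
        rw [e1] at e2 e3
        have h5 : k0 (pA w) (pB (H.symm w)) * pB (H.symm w) ≤ k0 (pA w) c * c := by
          rw [e2, ← e3, ← e2]; exact hwS
        have h6 := mono (pA w) c _ (not_lt.1 hc) hcon.le
        have h7 := le_antisymm h5 h6
        have i1 := inv01 (pA w) (pB (H.symm w)) (pB_nonneg _)
        have i2 := inv01 (pA w) c (not_lt.1 hc)
        rw [h7] at i1
        have h8 : k0 (pA w) (pB (H.symm w)) = k0 (pA w) c := by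
          have hne := left_ne_zero_of_mul_eq_one i2
          exact mul_left_cancel₀ hne (i1.trans i2.symm)
        rw [h8] at h7
        have := mul_left_cancel₀ (k0pos _ _).ne' h7
        linarith
      · have e1 : H (H.symm w) = w := H.right_inv hwf
        simp only [OpenPartialHomeomorph.coe_trans, Function.comp, e1]
        have h1 : Tendsto (fun n => α (H (x (ψ n)))) atTop (𝓝 (α w)) :=
          (α.continuousAt (hf w hwf.le).1).tendsto.comp hw
        have h2 : Tendsto (fun n => α (H (x (ψ n)))) atTop (𝓝 y) := by
          have := huy.comp hψ.tendsto_atTop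
          refine this.congr fun n => ?_
          simp only [Function.comp]; rw [← hxu]; rfl
        exact tendsto_nhds_unique h1 h2
    · intro c A
      refine ⟨√(A ^ 2 + 2), fun x _ hA => ?_⟩
      simp only [OpenPartialHomeomorph.coe_trans, Function.comp] at hA ⊢
      apply Real.le_sqrt_of_sq_le
      have h1 := Hd x
      have h2 : pB (H x) ≤ 1 := (Hin x).le.trans (f1 _)
      have h3 := pAB_snd (H x)
      have h4 := pAB_snd (α (H x))
      have h5 : dist (α (H x)).2 (H x).2 ≤ dist (α (H x)) (H x) := by
        rw [Prod.dist_eq]; exact le_max_right _ _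
      rw [Real.dist_eq] at h5
      have h6 := abs_le.1 (h5.trans h1.le)
      have h7 := pB_nonneg (H x)
      have h8 := pA_nonneg (α (H x))
      nlinarith [sq_nonneg (pA (H x))]
  obtain ⟨g, hg⟩ := good.telescope
  refine ⟨g, {x | pB x < f (pA x) / 2}, isOpen_lt pB_cont ((fc.comp pA_cont).div_const 2), ?_, ?_, ?_⟩
  · intro z hz
    have : pB ((0 : Y), z) = 0 := (pB_eq_zero _).2 ⟨rfl, hz⟩
    simp only [Set.mem_ofPred_eq, this]
    have := f0 (pA ((0 : Y), z)); linarith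
  · intro x hx
    have hx' : pB x < f (pA x) / 2 := hx
    have := f0 (pA x)
    exact (hf x (by linarith)).1
  · intro x hx
    have hx' : pB x < f (pA x) / 2 := hx
    have := f0 (pA x); have := f1 (pA x)
    rw [hg x (by linarith)]
    simp [Hlow x hx'.le]
end S4

open Filter Topology

section GP
variable {Y : Type*} [NormedAddCommGroup Y] [NormedSpace ℝ Y] [FiniteDimensional ℝ Y]

theorem gp_lemma (hd : 3 ≤ Module.finrank ℝ Y) (P : ℝ → Y) (q1 q2 : ℝ → ℝ)
    (hP : ContDiff ℝ 1 P) (h1 : ContDiff ℝ 1 q1) (h2 : ContDiff ℝ 1 q2) (ε : ℝ) (hε : 0 < ε) :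
    ∃ A1 A2 : Y, ‖A1‖ < ε ∧ ‖A2‖ < ε ∧ ∀ s t, (q1 s ≠ q1 t ∨ q2 s ≠ q2 t) →
      P s + q1 s • A1 + q2 s • A2 ≠ P t + q1 t • A1 + q2 t • A2 := by
  let N : ℝ × ℝ × Y → ℝ := fun w => (q1 w.1 - q1 w.2.1) ^ 2 + (q2 w.1 - q2 w.2.1) ^ 2
  let F : ℝ × ℝ × Y → Y × Y := fun w =>
    (-(((q1 w.1 - q1 w.2.1) / N w) • (P w.1 - P w.2.1)) - (q2 w.1 - q2 w.2.1) • w.2.2,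
     -(((q2 w.1 - q2 w.2.1) / N w) • (P w.1 - P w.2.1)) + (q1 w.1 - q1 w.2.1) • w.2.2)
  let D : Set (ℝ × ℝ × Y) := {w | N w ≠ 0}
  have hN : ContDiff ℝ 1 N := by simp only [N]; fun_prop
  have hF : ∀ w ∈ D, ContDiffAt ℝ 1 F w := by
    intro w hw
    have hNw : N w ≠ 0 := hw
    have c1 : ContDiffAt ℝ 1 (fun w : ℝ × ℝ × Y => (q1 w.1 - q1 w.2.1) / N w) w :=
      ContDiffAt.div (by fun_prop) hN.contDiffAt hNw
    have c2 : ContDiffAt ℝ 1 (fun w : ℝ × ℝ × Y => (q2 w.1 - q2 w.2.1) / N w) w :=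
      ContDiffAt.div (by fun_prop) hN.contDiffAt hNw
    simp only [F]
    refine ContDiffAt.prodMk ?_ ?_
    · exact ((c1.smul (by fun_prop)).neg).sub (by fun_prop)
    · exact ((c2.smul (by fun_prop)).neg).add (by fun_prop)
  have hdim : dimH (F '' D) < Module.finrank ℝ (Y × Y) := by
    calc dimH (F '' D) ≤ dimH D := by
          apply dimH_image_le_of_locally_lipschitzOn
          intro w hw
          obtain ⟨K, t, ht, hl⟩ := (hF w hw).exists_lipschitzOnWith
          exact ⟨K, t, mem_nhdsWithin_of_mem_nhds ht, hl⟩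
      _ ≤ dimH (Set.univ : Set (ℝ × ℝ × Y)) := dimH_mono (Set.subset_univ _)
      _ = Module.finrank ℝ (ℝ × ℝ × Y) := Real.dimH_univ_eq_finrank _
      _ < _ := by
          rw [Module.finrank_prod, Module.finrank_prod, Module.finrank_prod, Module.finrank_self]
          norm_cast
          omega
  have hdense := dense_compl_of_dimH_lt_finrank hdim
  obtain ⟨⟨A1, A2⟩, hA, hb⟩ := hdense.exists_mem_open Metric.isOpen_ball
    ⟨(0 : Y × Y), Metric.mem_ball_self hε⟩
  rw [mem_ball_zero_iff, Prod.norm_def, max_lt_iff] at hb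
  refine ⟨A1, A2, hb.1, hb.2, fun s t hst heq => hA ?_⟩
  have hne : N (s, t, (0 : Y)) ≠ 0 := by
    simp only [N]
    rcases hst with h | h
    · have : 0 < (q1 s - q1 t) ^ 2 := by
        have := sub_ne_zero.2 h; positivity
      have := sq_nonneg (q2 s - q2 t); linarith
    · have : 0 < (q2 s - q2 t) ^ 2 := by
        have := sub_ne_zero.2 h; positivity
      have := sq_nonneg (q1 s - q1 t); linarith
  have hN' : (q1 s - q1 t) ^ 2 + (q2 s - q2 t) ^ 2 ≠ 0 := hne
  set d1 := q1 s - q1 t with hd1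
  set d2 := q2 s - q2 t with hd2
  have hPeq : P s - P t = -(d1 • A1 + d2 • A2) := by
    rw [hd1, hd2, sub_smul, sub_smul]
    have h3 : P s - P t = (P s + q1 s • A1 + q2 s • A2) - P t - q1 s • A1 - q2 s • A2 := by abel
    rw [h3, heq]; abel
  refine ⟨(s, t, (d1 ^ 2 + d2 ^ 2)⁻¹ • (d1 • A2 - d2 • A1)), hne, ?_⟩
  simp only [F, N]
  rw [← hd1, ← hd2, hPeq]
  ext1
  · simp only [smul_neg, neg_neg, smul_add, smul_sub, smul_smul]
    match_scalars <;> field_simp <;> ring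
  · simp only [smul_neg, neg_neg, smul_add, smul_sub, smul_smul]
    match_scalars <;> field_simp <;> ring
end GP

section Smooth
variable {E : Type*} [NormedAddCommGroup E] [NormedSpace ℝ E] [CompleteSpace E]

theorem periodic_bound {F : ℝ → E} {η : ℝ} (hp : ∀ s, F (s + 1) = F s)
    (h : ∀ s ∈ Set.Icc (0 : ℝ) 1, ‖F s‖ ≤ η) (s : ℝ) : ‖F s‖ ≤ η := by
  have hper : Function.Periodic F 1 := hp
  obtain ⟨y, hy, he⟩ := hper.exists_mem_Ico₀ one_pos s
  rw [he]; exact h y ⟨hy.1, hy.2.le⟩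

theorem exists_smooth_periodic (p : ℝ → E) (hc : Continuous p) (hp : ∀ s, p (s + 1) = p s)
    (η : ℝ) (hη : 0 < η) :
    ∃ P : ℝ → E, ContDiff ℝ 1 P ∧ (∀ s, P (s + 1) = P s) ∧ ∀ s, ‖P s - p s‖ ≤ η := by
  -- uniform continuity on a compact
  have huc := (isCompact_Icc (a := (0 : ℝ)) (b := 2)).uniformContinuousOn_of_continuous
    hc.continuousOn
  rw [Metric.uniformContinuousOn_iff] at huc
  obtain ⟨δ, hδ, H⟩ := huc η hη
  let h := min (δ / 2) 1
  have h0 : 0 < h := lt_min (by linarith) one_pos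
  have h1 : h ≤ 1 := min_le_right _ _
  have hhδ : h < δ := (min_le_left _ _).trans_lt (by linarith)
  have hii : ∀ a b, IntervalIntegrable p MeasureTheory.volume a b :=
    fun a b => hc.intervalIntegrable a b
  let I : ℝ → E := fun s => ∫ u in (0 : ℝ)..s, p u
  have hI : ∀ s, HasDerivAt I (p s) s := fun s =>
    intervalIntegral.integral_hasDerivAt_right (hii _ _)
      (hc.stronglyMeasurableAtFilter _ _) hc.continuousAt
  have hIP : ∀ s, I (s + h) - I s = ∫ u in s..(s + h), p u := fun s =>
    intervalIntegral.integral_interval_sub_left (hii _ _) (hii _ _)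
  let P : ℝ → E := fun s => h⁻¹ • (I (s + h) - I s)
  have hPd : ∀ s, HasDerivAt P (h⁻¹ • (p (s + h) - p s)) s := fun s =>
    (((hI (s + h)).comp_add_const s h).sub (hI s)).const_smul h⁻¹
  have hPp : ∀ s, P (s + 1) = P s := by
    intro s
    simp only [P]
    rw [hIP, hIP]
    congr 1
    have : ∫ u in s..(s + h), p u = ∫ u in s..(s + h), p (u + 1) := by
      congr 1; ext u; rw [hp]
    rw [this, intervalIntegral.integral_comp_add_right]
    congr 1; ring
  refine ⟨P, ?_, hPp, ?_⟩
  · rw [contDiff_one_iff_deriv]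
    refine ⟨fun s => (hPd s).differentiableAt, ?_⟩
    have : deriv P = fun s => h⁻¹ • (p (s + h) - p s) := funext fun s => (hPd s).deriv
    rw [this]; fun_prop
  · refine periodic_bound (F := fun s => P s - p s) (fun s => by simp only [hPp, hp]) ?_
    intro s hs
    have e1 : P s - p s = h⁻¹ • ∫ u in s..(s + h), (p u - p s) := by
      rw [intervalIntegral.integral_sub (hii _ _) (by simp)]
      simp only [P, hIP, intervalIntegral.integral_const, add_sub_cancel_left, smul_sub, smul_smul]
      rw [inv_mul_cancel₀ h0.ne', one_smul]
    rw [e1, norm_smul]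
    have e2 : ‖∫ u in s..(s + h), (p u - p s)‖ ≤ η * |s + h - s| := by
      apply intervalIntegral.norm_integral_le_of_norm_le_const
      intro u hu
      rw [Set.uIoc_of_le (by linarith)] at hu
      rw [← dist_eq_norm]
      refine (H u ⟨by linarith [hs.1, hu.1], by linarith [hs.2, hu.2]⟩ s
        ⟨hs.1, by linarith [hs.2]⟩ ?_).le
      rw [Real.dist_eq, abs_lt]; constructor <;> linarith [hu.1, hu.2]
    rw [add_sub_cancel_left, abs_of_pos h0] at e2
    rw [norm_inv, Real.norm_of_nonneg h0.le]
    calc _ ≤ h⁻¹ * (η * h) := by gcongr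
      _ = η := by field_simp
end Smooth

open Filter Topology

section Klee
variable {Y : Type*} [NormedAddCommGroup Y] [NormedSpace ℝ Y] [FiniteDimensional ℝ Y]

theorem cs_eq (s t : ℝ) (h1 : Real.cos (2 * Real.pi * s) = Real.cos (2 * Real.pi * t))
    (h2 : Real.sin (2 * Real.pi * s) = Real.sin (2 * Real.pi * t)) : ∃ k : ℤ, s = t + k := by
  have h := Real.Angle.cos_sin_inj h1 h2
  rw [Real.Angle.angle_eq_iff_two_pi_dvd_sub] at h
  obtain ⟨k, hk⟩ := h
  refine ⟨k, ?_⟩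
  have hpi := Real.pi_pos
  have : 2 * Real.pi * (s - t - k) = 0 := by linarith
  rcases mul_eq_zero.1 this with h | h
  · linarith
  · linarith

theorem klee_dens1 (hd : 3 ≤ Module.finrank ℝ Y) (f : ℝ → Y × ℝ) (hc : Continuous f)
    (hp : ∀ s, f (s + 1) = f s) (η : ℝ) (hη : 0 < η) :
    ∃ g : ℝ → Y × ℝ, Continuous g ∧ (∀ s, g (s + 1) = g s) ∧ (∀ s, ‖g s - f s‖ ≤ η) ∧
      ∀ s t, (g s).1 = (g t).1 → ∃ k : ℤ, s = t + k := by
  have : CompleteSpace Y := FiniteDimensional.complete ℝ Y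
  obtain ⟨P, hP, hPp, hPf⟩ := exists_smooth_periodic (fun s => (f s).1) (by fun_prop)
    (fun s => by simp only [hp]) (η / 3) (by linarith)
  obtain ⟨A1, A2, hA1, hA2, hA⟩ := gp_lemma hd P (fun s => Real.cos (2 * Real.pi * s))
    (fun s => Real.sin (2 * Real.pi * s)) hP (by fun_prop) (by fun_prop) (η / 3) (by linarith)
  have hPc := hP.continuous
  refine ⟨fun s => (P s + Real.cos (2 * Real.pi * s) • A1 + Real.sin (2 * Real.pi * s) • A2,
    (f s).2), by fun_prop, ?_, ?_, ?_⟩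
  · intro s
    simp only [hPp, hp, mul_add, mul_one, Real.cos_add_two_pi, Real.sin_add_two_pi]
  · intro s
    rw [Prod.norm_def]
    simp only [Prod.fst_sub, Prod.snd_sub, sub_self, norm_zero]
    refine max_le ?_ hη.le
    have e : P s + Real.cos (2 * Real.pi * s) • A1 + Real.sin (2 * Real.pi * s) • A2 - (f s).1
      = (P s - (f s).1) + Real.cos (2 * Real.pi * s) • A1 + Real.sin (2 * Real.pi * s) • A2 := by
      abel
    rw [e]
    refine (norm_add₃_le).trans ?_
    rw [norm_smul, norm_smul]
    have h1 := hPf s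
    have h2 : ‖Real.cos (2 * Real.pi * s)‖ * ‖A1‖ ≤ 1 * (η / 3) := by
      gcongr
      · rw [Real.norm_eq_abs]; exact Real.abs_cos_le_one _
    have h3 : ‖Real.sin (2 * Real.pi * s)‖ * ‖A2‖ ≤ 1 * (η / 3) := by
      gcongr
      · rw [Real.norm_eq_abs]; exact Real.abs_sin_le_one _
    linarith
  · intro s t hst
    by_contra hcon
    refine hA s t ?_ hst
    by_contra h
    push Not at h
    exact hcon (cs_eq s t h.1 h.2)

variable (Φ : OpenPartialHomeomorph (Y × ℝ) (Y × ℝ)) (ε ν : ℝ)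

theorem klee_dens2 (hd : 3 ≤ Module.finrank ℝ Y) (hν : 1 < ν)
    (hsrc : Φ.source = {w | ‖w.1‖ < ε})
    (heq : ∀ b s, ‖b‖ < ε → Φ (b, s + 1) = ν • Φ (b, s))
    (f : ℝ → Y × ℝ) (hc : Continuous f) (hp : ∀ s, f (s + 1) = f s) (hf : ∀ s, ‖f s‖ < ε)
    (η : ℝ) (hη : 0 < η) :
    ∃ g : ℝ → Y × ℝ, Continuous g ∧ (∀ s, g (s + 1) = g s) ∧ (∀ s, ‖g s - f s‖ ≤ η) ∧
      ∀ s t, (Φ ((g s).1, s + (g s).2)).1 = (Φ ((g t).1, t + (g t).2)).1 → s = t := by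
  have : CompleteSpace Y := FiniteDimensional.complete ℝ Y
  have hν0 : 0 < ν := by linarith
  have hmem : ∀ s, ((f s).1, s + (f s).2) ∈ Φ.source := fun s => by
    rw [hsrc]; exact (norm_fst_le (f s)).trans_lt (hf s)
  -- target equivariance
  have htar : ∀ p, ν • p ∈ Φ.target ↔ p ∈ Φ.target := by
    intro p
    constructor
    · intro h
      have h1 := Φ.map_target h
      have h2 := Φ.right_inv h
      have h1' : ‖(Φ.symm (ν • p)).1‖ < ε := by rw [hsrc] at h1; exact h1
      have h3 := heq (Φ.symm (ν • p)).1 ((Φ.symm (ν • p)).2 - 1) h1'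
      rw [sub_add_cancel, Prod.mk.eta, h2] at h3
      have h4 := smul_right_injective (Y × ℝ) hν0.ne' h3
      rw [h4]
      apply Φ.map_source
      rw [hsrc]; exact h1'
    · intro h
      have h1 := Φ.map_target h
      have h2 := Φ.right_inv h
      have h1' : ‖(Φ.symm p).1‖ < ε := by rw [hsrc] at h1; exact h1
      have h3 := heq (Φ.symm p).1 (Φ.symm p).2 h1'
      rw [Prod.mk.eta, h2] at h3
      rw [← h3]
      apply Φ.map_source
      rw [hsrc]; exact h1'
  have hsym : ∀ p ∈ Φ.target, Φ.symm (ν • p) = Φ.symm p + (0, 1) := by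
    intro p hpt
    have h1 := Φ.map_target hpt
    have h2 := Φ.right_inv hpt
    have h1' : ‖(Φ.symm p).1‖ < ε := by rw [hsrc] at h1; exact h1
    have h3 := heq (Φ.symm p).1 (Φ.symm p).2 h1'
    rw [Prod.mk.eta, h2] at h3
    rw [← h3, Φ.left_inv (by rw [hsrc]; exact h1')]
    ext1 <;> simp
  let γ : ℝ → Y × ℝ := fun s => Φ ((f s).1, s + (f s).2)
  have γc : Continuous γ :=
    Φ.continuousOn.comp_continuous (by fun_prop) hmem
  have γp : ∀ s, γ (s + 1) = ν • γ s := by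
    intro s
    simp only [γ, hp]
    rw [← heq _ _ ((norm_fst_le (f s)).trans_lt (hf s))]
    congr 2; ring
  have νc : Continuous (fun s : ℝ => ν ^ s) := Real.continuous_const_rpow hν0.ne'
  let Γ : ℝ → Y × ℝ := fun s => (ν ^ s)⁻¹ • γ s
  have νpos : ∀ s : ℝ, 0 < ν ^ s := fun s => Real.rpow_pos_of_pos hν0 s
  have ν1 : ∀ s : ℝ, ν ^ (s + 1) = ν ^ s * ν := fun s => by
    rw [Real.rpow_add hν0, Real.rpow_one]
  have Γc : Continuous Γ := (νc.inv₀ fun s => (νpos s).ne').smul γc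
  have Γp : ∀ s, Γ (s + 1) = Γ s := by
    intro s
    simp only [Γ, γp, ν1, smul_smul]
    congr 1
    have := νpos s
    field_simp
  have hK : IsCompact (γ '' Set.Icc 0 1) := isCompact_Icc.image γc
  have hKt : γ '' Set.Icc 0 1 ⊆ Φ.target := by
    rintro _ ⟨s, -, rfl⟩; exact Φ.map_source (hmem s)
  have huc := hK.uniformContinuousAt_of_continuousAt Φ.symm
    (fun a ha => Φ.symm.continuousAt (by simpa using hKt ha)) (Metric.dist_mem_uniformity hη)
  obtain ⟨δ1, hδ1, H1⟩ := Metric.mem_uniformity_dist.1 huc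
  obtain ⟨δ2, hδ2, H2⟩ := hK.exists_thickening_subset_open Φ.open_target hKt
  let δ := min δ1 δ2
  have hδ : 0 < δ := lt_min hδ1 hδ2
  let κ := δ / (6 * ν)
  have hκ : 0 < κ := by positivity
  obtain ⟨P, hP, hPp, hPf⟩ := exists_smooth_periodic (fun s => (Γ s).1) (by fun_prop)
    (fun s => by simp only [Γp]) κ hκ
  have hνd : ContDiff ℝ 1 (fun s : ℝ => ν ^ s) := by
    simp_rw [Real.rpow_def_of_pos hν0]; fun_prop
  obtain ⟨A1, A2, hA1, hA2, hA⟩ := gp_lemma hd (fun s => ν ^ s • P s)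
    (fun s => ν ^ s * Real.cos (2 * Real.pi * s))
    (fun s => ν ^ s * Real.sin (2 * Real.pi * s)) (hνd.smul hP) (hνd.mul (by fun_prop))
    (hνd.mul (by fun_prop)) κ hκ
  have hPc := hP.continuous
  let Γ' : ℝ → Y × ℝ := fun s =>
    (P s + Real.cos (2 * Real.pi * s) • A1 + Real.sin (2 * Real.pi * s) • A2, (Γ s).2)
  have Γ'c : Continuous Γ' := by simp only [Γ']; fun_prop
  have Γ'p : ∀ s, Γ' (s + 1) = Γ' s := by
    intro s
    simp only [Γ', hPp, Γp, mul_add, mul_one, Real.cos_add_two_pi, Real.sin_add_two_pi]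
  have Γ'd : ∀ s, ‖Γ' s - Γ s‖ ≤ 3 * κ := by
    intro s
    rw [Prod.norm_def]
    simp only [Γ', Prod.fst_sub, Prod.snd_sub, sub_self, norm_zero]
    refine max_le ?_ (by positivity)
    have e : P s + Real.cos (2 * Real.pi * s) • A1 + Real.sin (2 * Real.pi * s) • A2 - (Γ s).1
      = (P s - (Γ s).1) + Real.cos (2 * Real.pi * s) • A1 + Real.sin (2 * Real.pi * s) • A2 := by
      abel
    rw [e]
    refine (norm_add₃_le).trans ?_
    rw [norm_smul, norm_smul]
    have h1 := hPf s
    have h2 : ‖Real.cos (2 * Real.pi * s)‖ * ‖A1‖ ≤ 1 * κ := by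
      gcongr
      · rw [Real.norm_eq_abs]; exact Real.abs_cos_le_one _
    have h3 : ‖Real.sin (2 * Real.pi * s)‖ * ‖A2‖ ≤ 1 * κ := by
      gcongr
      · rw [Real.norm_eq_abs]; exact Real.abs_sin_le_one _
    linarith
  let γ' : ℝ → Y × ℝ := fun s => ν ^ s • Γ' s
  have γ'c : Continuous γ' := νc.smul Γ'c
  have γ'p : ∀ s, γ' (s + 1) = ν • γ' s := by
    intro s
    simp only [γ', Γ'p, ν1, smul_smul]
    congr 1; ring
  have γ'd : ∀ s ∈ Set.Icc (0 : ℝ) 1, dist (γ s) (γ' s) < δ := by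
    intro s hs
    have e : γ s = ν ^ s • Γ s := by
      simp only [Γ, smul_smul]; rw [mul_inv_cancel₀ (νpos s).ne', one_smul]
    rw [dist_comm, dist_eq_norm, e]
    simp only [γ']
    rw [← smul_sub, norm_smul, Real.norm_of_nonneg (νpos s).le]
    have h1 : ν ^ s ≤ ν := by
      calc ν ^ s ≤ ν ^ (1 : ℝ) := Real.rpow_le_rpow_of_exponent_le hν.le hs.2
        _ = ν := Real.rpow_one _
    calc _ ≤ ν * (3 * κ) := by
          gcongr
          exact Γ'd s
      _ = δ / 2 := by simp only [κ]; field_simp; norm_num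
      _ < δ := by linarith
  have hT : ∀ s, γ' s ∈ Φ.target := by
    intro s
    have hper : Function.Periodic (fun s => γ' s ∈ Φ.target) 1 := by
      intro s; simp only [γ'p, htar]
    obtain ⟨y, hy, he⟩ := hper.exists_mem_Ico₀ one_pos s
    have : γ' y ∈ Φ.target := by
      apply H2
      rw [Metric.mem_thickening_iff]
      refine ⟨γ y, ⟨y, ⟨hy.1, hy.2.le⟩, rfl⟩, ?_⟩
      rw [dist_comm]
      exact (γ'd y ⟨hy.1, hy.2.le⟩).trans_le (min_le_right _ _)
    rw [he]; exact this
  let g : ℝ → Y × ℝ := fun s => Φ.symm (γ' s) - (0, s)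
  have gp : ∀ s, g (s + 1) = g s := by
    intro s
    simp only [g, γ'p]
    rw [hsym _ (hT s)]
    ext1
    · simp
    · simp
  refine ⟨g, ?_, gp, ?_, ?_⟩
  · exact (Φ.symm.continuousOn.comp_continuous γ'c (by simpa using hT)).sub (by fun_prop)
  · apply periodic_bound (F := fun s => g s - f s) (fun s => by simp only [gp, hp])
    intro s hs
    have h1 := H1 (a := γ s) (b := γ' s) ((γ'd s hs).trans_le (min_le_left _ _)) ⟨s, hs, rfl⟩
    have h2 : Φ.symm (γ s) = ((f s).1, s + (f s).2) := Φ.left_inv (hmem s)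
    simp only at h1
    have e : g s - f s = Φ.symm (γ' s) - Φ.symm (γ s) := by
      rw [h2]; ext1
      · simp [g]
      · simp [g]; ring
    rw [e, ← dist_eq_norm, dist_comm]; exact le_of_lt h1
  · intro s t hst
    have hg : ∀ s, Φ ((g s).1, s + (g s).2) = γ' s := by
      intro s
      have : ((g s).1, s + (g s).2) = Φ.symm (γ' s) := by
        ext1 <;> simp [g]
      rw [this, Φ.right_inv (hT s)]
    rw [hg, hg] at hst
    by_contra hne
    refine hA s t ?_ ?_
    · by_contra h
      push Not at h
      obtain ⟨h1, h2⟩ := h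
      have e : (ν ^ s) ^ 2 = (ν ^ t) ^ 2 := by
        have a1 := Real.cos_sq_add_sin_sq (2 * Real.pi * s)
        have a2 := Real.cos_sq_add_sin_sq (2 * Real.pi * t)
        calc (ν ^ s) ^ 2 = (ν ^ s * Real.cos (2 * Real.pi * s)) ^ 2
              + (ν ^ s * Real.sin (2 * Real.pi * s)) ^ 2 := by
                rw [mul_pow, mul_pow, ← mul_add, a1, mul_one]
          _ = (ν ^ t) ^ 2 := by
                rw [h1, h2, mul_pow, mul_pow, ← mul_add, a2, mul_one]
      have e2 : ν ^ s = ν ^ t := (sq_eq_sq₀ (νpos s).le (νpos t).le).1 e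
      rcases lt_trichotomy s t with h | h | h
      · exact absurd e2 (Real.rpow_lt_rpow_of_exponent_lt hν h).ne
      · exact hne h
      · exact absurd e2 (Real.rpow_lt_rpow_of_exponent_lt hν h).ne'
    · simp only [γ', Γ', Prod.smul_fst, smul_add, smul_smul] at hst
      exact hst

theorem klee_generic (hd : 3 ≤ Module.finrank ℝ Y) (hν : 1 < ν)
    (hsrc : Φ.source = {w | ‖w.1‖ < ε})
    (heq : ∀ b s, ‖b‖ < ε → Φ (b, s + 1) = ν • Φ (b, s)) (r : ℝ) (hr : 0 < r) (hrε : r < ε) :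
    ∃ f : ℝ → Y × ℝ, Continuous f ∧ (∀ s, f (s + 1) = f s) ∧ (∀ s, ‖f s‖ ≤ r) ∧
      (∀ s t, (f s).1 = (f t).1 → ∃ k : ℤ, s = t + k) ∧
      ∀ s t, (Φ ((f s).1, s + (f s).2)).1 = (Φ ((f t).1, t + (f t).2)).1 → s = t := by
  have : CompleteSpace Y := FiniteDimensional.complete ℝ Y
  let FF : Set (BoundedContinuousFunction ℝ (Y × ℝ)) :=
    {f | (∀ s, f (s + 1) = f s) ∧ ∀ s, ‖f s‖ ≤ r}
  have hcl : IsClosed FF := by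
    have e : FF = (⋂ s, {f | f (s + 1) = f s}) ∩ ⋂ s, {f | ‖f s‖ ≤ r} := by
      ext f; simp [FF]
    rw [e]
    refine (isClosed_iInter fun s => isClosed_eq ?_ ?_).inter
      (isClosed_iInter fun s => isClosed_le ?_ ?_)
    · exact continuous_eval_const _
    · exact continuous_eval_const _
    · exact (continuous_eval_const _).norm
    · exact continuous_const
  have : CompleteSpace FF := hcl.completeSpace_coe
  have dens : ∀ Q : (ℝ → Y × ℝ) → Prop,
      (∀ f : ℝ → Y × ℝ, Continuous f → (∀ s, f (s + 1) = f s) → (∀ s, ‖f s‖ < ε) → ∀ η > 0,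
        ∃ g : ℝ → Y × ℝ, Continuous g ∧ (∀ s, g (s + 1) = g s) ∧ (∀ s, ‖g s - f s‖ ≤ η) ∧ Q g) →
      Dense {f : FF | Q f.1} := by
    intro Q hQ f0
    rw [Metric.mem_closure_iff]
    intro η hη
    let θ : ℝ := min (η / (4 * r)) (1 / 2)
    have hθ : 0 < θ := lt_min (by positivity) (by norm_num)
    have hθ1 : θ ≤ 1 / 2 := min_le_right _ _
    have hθr : θ * r ≤ η / 4 := by
      calc θ * r ≤ η / (4 * r) * r := by gcongr; exact min_le_left _ _
        _ = η / 4 := by field_simp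
    have hb : ∀ s, ‖(1 - θ) • f0.1 s‖ ≤ (1 - θ) * r := fun s => by
      rw [norm_smul, Real.norm_of_nonneg (by linarith)]
      have := f0.2.2 s
      gcongr
      linarith
    obtain ⟨g, gc, gp, gd, gQ⟩ := hQ (fun s => (1 - θ) • f0.1 s) (by fun_prop)
      (fun s => by simp only [f0.2.1]) (fun s => (hb s).trans_lt (by nlinarith)) (θ * r)
      (by positivity)
    have gb : ∀ s, ‖g s‖ ≤ r := fun s => by
      have h1 := norm_add_le (g s - (1 - θ) • f0.1 s) ((1 - θ) • f0.1 s)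
      rw [sub_add_cancel] at h1
      have := gd s; have := hb s
      linarith
    let G : BoundedContinuousFunction ℝ (Y × ℝ) := BoundedContinuousFunction.ofNormedAddCommGroup g gc r gb
    refine ⟨⟨G, gp, gb⟩, gQ, ?_⟩
    rw [Subtype.dist_eq, dist_comm]
    refine lt_of_le_of_lt ((BoundedContinuousFunction.dist_le (C := η / 2) (by linarith)).2 ?_)
      (by linarith)
    intro s
    rw [dist_eq_norm]
    have e : G s - f0.1 s = (g s - (1 - θ) • f0.1 s) - θ • f0.1 s := by
      change g s - f0.1 s = _
      rw [sub_smul, one_smul]; abel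
    rw [e]
    refine (norm_sub_le _ _).trans ?_
    have h1 : ‖θ • f0.1 s‖ ≤ θ * r := by
      rw [norm_smul, Real.norm_of_nonneg hθ.le]
      have := f0.2.2 s
      gcongr
    have := gd s
    linarith
  have d1 := dens (fun f => ∀ s t, (f s).1 = (f t).1 → ∃ k : ℤ, s = t + k)
    (fun f hc hp _ η hη => klee_dens1 hd f hc hp η hη)
  have d2 := dens (fun f => ∀ s t, (Φ ((f s).1, s + (f s).2)).1 = (Φ ((f t).1, t + (f t).2)).1
    → s = t) (fun f hc hp hb η hη => klee_dens2 Φ ε ν hd hν hsrc heq f hc hp hb η hη)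
  let K1 : ℕ → Set (ℝ × ℝ) := fun k => {p | p.1 ∈ Set.Icc 0 1 ∧ p.1 + 1 / (k + 1) ≤ p.2 ∧
    p.2 ≤ p.1 + 1 - 1 / (k + 1)}
  let K2 : ℕ → Set (ℝ × ℝ) := fun k => {p | p.1 ∈ Set.Icc 0 1 ∧ p.2 ∈ Set.Icc (-(k : ℝ)) k ∧
    1 / ((k : ℝ) + 1) ≤ |p.2 - p.1|}
  have hK1 : ∀ k, IsCompact (K1 k) := by
    intro k
    have hk : 0 < 1 / ((k : ℝ) + 1) := by positivity
    refine (isCompact_Icc.prod (isCompact_Icc (a := (0 : ℝ)) (b := 2))).of_isClosed_subset ?_ ?_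
      (s := Set.Icc (0 : ℝ) 1 ×ˢ Set.Icc (0 : ℝ) 2)
    · have c1 : IsClosed {p : ℝ × ℝ | p.1 + 1 / ((k : ℝ) + 1) ≤ p.2} :=
        isClosed_le (by fun_prop) (by fun_prop)
      have c2 : IsClosed {p : ℝ × ℝ | p.2 ≤ p.1 + 1 - 1 / ((k : ℝ) + 1)} :=
        isClosed_le (by fun_prop) (by fun_prop)
      exact (isClosed_Icc.preimage continuous_fst).inter (c1.inter c2)
    · rintro ⟨s, t⟩ ⟨h1, h2, h3⟩
      simp only at h1 h2 h3
      exact ⟨h1, by linarith [h1.1], by linarith [h1.2]⟩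
  have hK2 : ∀ k, IsCompact (K2 k) := by
    intro k
    refine (isCompact_Icc.prod isCompact_Icc).of_isClosed_subset ?_ ?_
      (s := Set.Icc (0 : ℝ) 1 ×ˢ Set.Icc (-(k : ℝ)) k)
    · have c1 : IsClosed {p : ℝ × ℝ | 1 / ((k : ℝ) + 1) ≤ |p.2 - p.1|} :=
        isClosed_le (by fun_prop) (by fun_prop)
      exact (isClosed_Icc.preimage continuous_fst).inter
        ((isClosed_Icc.preimage continuous_snd).inter c1)
    · rintro ⟨s, t⟩ ⟨h1, h2, h3⟩
      exact ⟨h1, h2⟩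
  have ev : Continuous (fun p : FF × ℝ => p.1.1 p.2) :=
    continuous_eval.comp ((continuous_subtype_val.comp continuous_fst).prodMk continuous_snd)
  have opn : ∀ (K : Set (ℝ × ℝ)) (F : FF → ℝ → Y), IsCompact K →
      Continuous (fun p : FF × ℝ => F p.1 p.2) →
      IsOpen {f : FF | ∀ p ∈ K, F f p.1 ≠ F f p.2} := by
    intro K F hK hF
    rw [isOpen_iff_eventually]
    intro f hf
    apply hK.eventually_forall_of_forall_eventually
    intro p hp
    have c1 : Continuous (fun z : FF × (ℝ × ℝ) => F z.1 z.2.1) :=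
      hF.comp (continuous_fst.prodMk (continuous_fst.comp continuous_snd))
    have c2 : Continuous (fun z : FF × (ℝ × ℝ) => F z.1 z.2.2) :=
      hF.comp (continuous_fst.prodMk (continuous_snd.comp continuous_snd))
    exact (isOpen_ne_fun c1 c2).mem_nhds (hf p hp)
  let V : ℕ → Set FF := fun k => {f | ∀ p ∈ K1 k, (f.1 p.1).1 ≠ (f.1 p.2).1} ∩
    {f | ∀ p ∈ K2 k, (Φ ((f.1 p.1).1, p.1 + (f.1 p.1).2)).1
      ≠ (Φ ((f.1 p.2).1, p.2 + (f.1 p.2).2)).1}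
  have o1 : ∀ k, IsOpen {f : FF | ∀ p ∈ K1 k, (f.1 p.1).1 ≠ (f.1 p.2).1} := fun k =>
    opn (K1 k) (fun f s => (f.1 s).1) (hK1 k) (continuous_fst.comp ev)
  have o2 : ∀ k, IsOpen {f : FF | ∀ p ∈ K2 k, (Φ ((f.1 p.1).1, p.1 + (f.1 p.1).2)).1
      ≠ (Φ ((f.1 p.2).1, p.2 + (f.1 p.2).2)).1} := fun k =>
    opn (K2 k) (fun f s => (Φ ((f.1 s).1, s + (f.1 s).2)).1) (hK2 k) (by
      refine continuous_fst.comp (Φ.continuousOn.comp_continuous ?_ ?_)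
      · exact (continuous_fst.comp ev).prodMk (continuous_snd.add (continuous_snd.comp ev))
      · intro p
        rw [hsrc]
        exact (norm_fst_le (p.1.1 p.2)).trans_lt ((p.1.2.2 p.2).trans_lt hrε))
  have hV : Dense (⋂ k, V k) := by
    apply dense_iInter_of_isOpen_nat
    · exact fun k => (o1 k).inter (o2 k)
    · intro k
      refine Dense.inter_of_isOpen_left (d1.mono ?_) (d2.mono ?_) (o1 k)
      · rintro f hf ⟨s, t⟩ ⟨-, h2, h3⟩ he
        simp only at h2 h3 he
        obtain ⟨j, hj⟩ := hf s t he
        have hk : 0 < 1 / ((k : ℝ) + 1) := by positivity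
        have a1 : (-1 : ℝ) < j := by linarith
        have a2 : (j : ℝ) < 0 := by linarith
        have a1' : (-1 : ℤ) < j := by exact_mod_cast a1
        have a2' : j < 0 := by exact_mod_cast a2
        omega
      · rintro f hf ⟨s, t⟩ ⟨-, h2, h3⟩ he
        simp only at h3 he
        have := hf s t he
        have hk : 0 < 1 / ((k : ℝ) + 1) := by positivity
        rw [this, sub_self, abs_zero] at h3
        linarith
  have hne : Nonempty FF := ⟨⟨0, fun s => rfl, fun s => by simpa using hr.le⟩⟩
  obtain ⟨f, hf⟩ := hV.nonempty
  rw [Set.mem_iInter] at hf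
  refine ⟨f.1, f.1.continuous, f.2.1, f.2.2, ?_, ?_⟩
  · intro s t hst
    by_contra hcon
    have hper : Function.Periodic f.1 1 := f.2.1
    -- s' = fract s, t' = s' + fract (t - s)
    have e1 : f.1 (Int.fract s) = f.1 s := by
      rw [Int.fract]; simpa using hper.sub_int_mul_eq (x := s) ⌊s⌋
    have e2 : f.1 (Int.fract s + Int.fract (t - s)) = f.1 t := by
      have : Int.fract s + Int.fract (t - s) = t - ((⌊s⌋ + ⌊t - s⌋ : ℤ) : ℝ) * 1 := by
        push_cast [Int.fract]; ring
      rw [this]; exact hper.sub_int_mul_eq _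
    have p1 : 0 < Int.fract (t - s) := by
      rcases (Int.fract_nonneg (t - s)).lt_or_eq with h | h
      · exact h
      · exfalso; apply hcon
        refine ⟨-⌊t - s⌋, ?_⟩
        rw [Int.fract] at h
        push_cast; linarith
    have p2 := Int.fract_lt_one (t - s)
    obtain ⟨k, hk⟩ := exists_nat_one_div_lt (lt_min p1 (sub_pos.2 p2))
    have hk' := lt_min_iff.1 hk
    refine (hf k).1 (Int.fract s, Int.fract s + Int.fract (t - s))
      ⟨⟨Int.fract_nonneg s, (Int.fract_lt_one s).le⟩, ?_, ?_⟩ ?_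
    · simp only; linarith [hk'.1]
    · simp only; linarith [hk'.2]
    · simp only; rw [e1, e2, hst]
  · intro s t hst
    by_contra hne
    have hmem : ∀ s, ‖(f.1 s).1‖ < ε := fun s => (norm_fst_le _).trans_lt ((f.2.2 s).trans_lt hrε)
    have hν0 : 0 < ν := by linarith
    have hstep : ∀ s : ℝ, Φ ((f.1 (s + 1)).1, s + 1 + (f.1 (s + 1)).2)
        = ν • Φ ((f.1 s).1, s + (f.1 s).2) := by
      intro s
      rw [f.2.1, ← heq _ _ (hmem s)]
      congr 2; ring
    have hper : Function.Periodic (fun u : ℝ => (Φ ((f.1 u).1, u + (f.1 u).2)).1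
        = (Φ ((f.1 (u + (t - s))).1, (u + (t - s)) + (f.1 (u + (t - s))).2)).1) 1 := by
      intro u
      simp only
      rw [hstep u, show u + 1 + (t - s) = (u + (t - s)) + 1 by ring, hstep (u + (t - s))]
      simp only [Prod.smul_fst, (smul_right_injective Y hν0.ne').eq_iff]
    obtain ⟨u, hu, he⟩ := hper.exists_mem_Ico₀ one_pos s
    have h1 : (Φ ((f.1 u).1, u + (f.1 u).2)).1
        = (Φ ((f.1 (u + (t - s))).1, (u + (t - s)) + (f.1 (u + (t - s))).2)).1 := by
      rw [← he, show s + (t - s) = t by ring]; exact hst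
    obtain ⟨k1, hk1⟩ := exists_nat_one_div_lt (abs_pos.2 (sub_ne_zero.2 (Ne.symm hne)))
    obtain ⟨k2, hk2⟩ := exists_nat_ge (|t - s| + 1)
    refine (hf (max k1 k2)).2 (u, u + (t - s)) ⟨⟨hu.1, hu.2.le⟩, ?_, ?_⟩ h1
    · have h3 : (k2 : ℝ) ≤ ((max k1 k2 : ℕ) : ℝ) := by exact_mod_cast le_max_right _ _
      have h4 := abs_le.1 (le_refl |t - s|)
      have := hu.1; have := hu.2
      constructor <;> simp only <;> linarith
    · simp only [add_sub_cancel_left]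
      refine le_trans ?_ hk1.le
      have h3 : (k1 : ℝ) ≤ ((max k1 k2 : ℕ) : ℝ) := by exact_mod_cast le_max_left _ _
      gcongr
end Klee

open Filter Topology

/-- A continuous family of 1/2-Lipschitz perturbations of the identity is a homeomorphism. -/
theorem fiber_homeo {P Y : Type*} [TopologicalSpace P] [NormedAddCommGroup Y] [CompleteSpace Y]
    (u : P → Y → Y) (hu : Continuous (fun w : P × Y => u w.1 w.2))
    (hl : ∀ p y y', ‖u p y - u p y'‖ ≤ (1 / 2 : ℝ) * ‖y - y'‖) :
    ∃ H : (P × Y) ≃ₜ (P × Y), ∀ p y, H (p, y) = (p, y + u p y) := by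
  have hinj : ∀ p, Function.Injective (fun y => y + u p y) := by
    intro p y y' h
    simp only at h
    have h1 : y - y' = -(u p y - u p y') := by
      rw [neg_sub, sub_eq_sub_iff_add_eq_add, h, add_comm]
    have h2 := hl p y y'
    have h3 : ‖y - y'‖ = ‖u p y - u p y'‖ := by rw [h1, norm_neg]
    have : ‖y - y'‖ ≤ 0 := by linarith
    exact sub_eq_zero.1 (norm_le_zero_iff.1 this)
  have hsurj : ∀ p, Function.Surjective (fun y => y + u p y) := by
    intro p w
    have hc : ContractingWith (1 / 2 : NNReal) (fun y => w - u p y) := by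
      refine ⟨by norm_num [← NNReal.coe_lt_coe], LipschitzWith.of_dist_le_mul fun y y' => ?_⟩
      rw [dist_eq_norm, dist_eq_norm, sub_sub_sub_cancel_left, norm_sub_rev]
      simpa using hl p y y'
    have : Nonempty Y := ⟨0⟩
    have := hc.fixedPoint_isFixedPt
    refine ⟨hc.fixedPoint, ?_⟩
    have h2 : w - u p hc.fixedPoint = hc.fixedPoint := this
    simp only
    rw [← eq_sub_iff_add_eq, h2]
  let e : (P × Y) ≃ (P × Y) := Equiv.ofBijective (fun w => (w.1, w.2 + u w.1 w.2)) (by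
    constructor
    · rintro ⟨p, y⟩ ⟨p', y'⟩ h
      simp only [Prod.mk.injEq] at h
      obtain ⟨rfl, h⟩ := h
      rw [hinj p h]
    · rintro ⟨p, y⟩
      obtain ⟨z, hz⟩ := hsurj p y
      exact ⟨(p, z), by simpa using hz⟩)
  have he : ∀ p y, e (p, y) = (p, y + u p y) := fun _ _ => rfl
  have hes : ∀ w, (e.symm w).1 = w.1 ∧ (e.symm w).2 + u w.1 (e.symm w).2 = w.2 := by
    intro w
    have h := e.apply_symm_apply w
    have h2 := he (e.symm w).1 (e.symm w).2
    rw [Prod.mk.eta, h] at h2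
    have h3 : (e.symm w).1 = w.1 := (congrArg Prod.fst h2).symm
    refine ⟨h3, ?_⟩
    have h4 := congrArg Prod.snd h2
    simp only [h3] at h4
    exact h4.symm
  refine ⟨⟨e, ?_, ?_⟩, he⟩
  · exact continuous_fst.prodMk (continuous_snd.add hu)
  · rw [continuous_iff_continuousAt]
    intro w0
    have h1 : Continuous fun w => (e.symm w).1 := by
      simp only [fun w => (hes w).1]; exact continuous_fst
    have h2 : ContinuousAt (fun w => (e.symm w).2) w0 := by
      rw [ContinuousAt, tendsto_iff_norm_sub_tendsto_zero]
      set y0 := (e.symm w0).2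
      have hb : ∀ w, ‖(e.symm w).2 - y0‖ ≤ 2 * (‖w.2 - w0.2‖ + ‖u w.1 y0 - u w0.1 y0‖) := by
        intro w
        have a1 := (hes w).2
        have a2 : y0 + u w0.1 y0 = w0.2 := (hes w0).2
        have a3 := hl w.1 (e.symm w).2 y0
        have a4 : (e.symm w).2 - y0 = (w.2 - w0.2) - (u w.1 y0 - u w0.1 y0)
            - (u w.1 (e.symm w).2 - u w.1 y0) := by
          rw [← a1, ← a2]; abel
        have a5 := norm_sub_le ((w.2 - w0.2) - (u w.1 y0 - u w0.1 y0))
          (u w.1 (e.symm w).2 - u w.1 y0)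
        have a6 := norm_sub_le (w.2 - w0.2) (u w.1 y0 - u w0.1 y0)
        rw [← a4] at a5
        linarith
      refine squeeze_zero (fun _ => norm_nonneg _) hb ?_
      have : Continuous fun w : P × Y =>
          2 * (‖w.2 - w0.2‖ + ‖u w.1 y0 - u w0.1 y0‖) := by
        have : Continuous fun w : P × Y => u w.1 y0 :=
          hu.comp (continuous_fst.prodMk continuous_const)
        fun_prop
      have h := this.tendsto w0
      simpa using h
    exact h1.continuousAt.prodMk h2

/-- Images under an equivariant map of closed sets exhausted by scaled compact sets are closed. -/
theorem closed_image {E F : Type*} [TopologicalSpace E] [NormedAddCommGroup F]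
    [NormedSpace ℝ F] (φ : OpenPartialHomeomorph E F) (K : Set E) (hK : IsCompact K)
    (hKs : K ⊆ φ.source) (h0 : ∀ w ∈ K, φ w ≠ 0) (ν : ℝ) (hν : 1 < ν) (T : ℕ → E → E)
    (hT : ∀ k, Continuous (T k))
    (hTφ : ∀ k, ∀ w ∈ K, T k w ∈ φ.source ∧ φ (T k w) = ν ^ k • φ w)
    (S : Set E) (hS : IsClosed S) (hSK : ∀ w ∈ S, ∃ k, ∃ v ∈ K, T k v = w) :
    IsClosed (φ '' S) := by
  have hcomp : ∀ k, IsCompact (φ '' (S ∩ T k '' K)) := by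
    intro k
    refine ((hK.image (hT k)).inter_left hS).image_of_continuousOn (φ.continuousOn.mono ?_)
    rintro _ ⟨-, v, hv, rfl⟩
    exact (hTφ k v hv).1
  have hU : φ '' S = ⋃ k, φ '' (S ∩ T k '' K) := by
    rw [← Set.image_iUnion, ← Set.inter_iUnion]
    congr 1
    refine (Set.inter_eq_left.2 ?_).symm
    intro w hw
    obtain ⟨k, v, hv, rfl⟩ := hSK w hw
    exact Set.mem_iUnion.2 ⟨k, v, hv, rfl⟩
  rw [hU]
  refine LocallyFinite.isClosed_iUnion ?_ (fun k => ?_)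
  swap
  · exact (hcomp k).isClosed
  rcases K.eq_empty_or_nonempty with rfl | hne
  · intro x
    refine ⟨Set.univ, univ_mem, ?_⟩
    simp
  obtain ⟨w0, hw0, hmin⟩ := hK.exists_isMinOn hne (φ.continuousOn.mono hKs).norm
  have hpos : 0 < ‖φ w0‖ := norm_pos_iff.2 (h0 w0 hw0)
  intro x
  obtain ⟨N, hN⟩ := ((tendsto_pow_atTop_atTop_of_one_lt hν).eventually_gt_atTop
    ((‖x‖ + 1) / ‖φ w0‖)).exists_forall_of_atTop
  refine ⟨Metric.ball x 1, Metric.ball_mem_nhds x one_pos, (Set.finite_lt_nat N).subset ?_⟩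
  rintro k ⟨z, ⟨w, ⟨-, v, hv, rfl⟩, rfl⟩, hz⟩
  by_contra hk
  have h1 := hN k (not_lt.1 hk)
  rw [div_lt_iff₀ hpos] at h1
  rw [(hTφ k v hv).2, Metric.mem_ball, dist_eq_norm] at hz
  have h2 : ν ^ k * ‖φ w0‖ ≤ ‖ν ^ k • φ v‖ := by
    rw [norm_smul, Real.norm_of_nonneg (by positivity)]
    exact mul_le_mul_of_nonneg_left (hmin hv) (by positivity)
  have h3 := norm_sub_norm_le (ν ^ k • φ v) x
  linarith

section
variable {Y : Type*} [NormedAddCommGroup Y] [NormedSpace ℝ Y] [FiniteDimensional ℝ Y]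

/-- the homeomorphism straightening the closed tube curve -/
theorem tube_homeo (ε r : ℝ) (hr : 0 < r) (hε : 8 * r ≤ ε) (hr4 : r ≤ 1 / 4)
    (f : ℝ → Y × ℝ) (hf : Continuous f)
    (hper : ∀ s, f (s + 1) = f s) (hb : ∀ s, ‖f s‖ ≤ r)
    (hinj : ∀ s t, (f s).1 = (f t).1 → ∃ k : ℤ, s = t + k) :
    ∃ h : (Y × ℝ) ≃ₜ (Y × ℝ), (∀ b s, ¬ (‖b‖ ≤ ε ∧ 0 ≤ s) → h (b, s) = (b, s)) ∧
      ∀ s, 1 ≤ s → h (0, s) = ((f s).1, s + (f s).2) := by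
  have hε0 : 0 < ε := by linarith
  let c : ℝ → ℝ := fun s => max 0 (min s 1)
  have hc : Continuous c := by fun_prop
  have hc01 : ∀ s, 0 ≤ c s ∧ c s ≤ 1 := fun s =>
    ⟨le_max_left _ _, max_le zero_le_one (min_le_right _ _)⟩
  have hc1 : ∀ s, 1 ≤ s → c s = 1 := by
    intro s hs; simp only [c]; rw [min_eq_right hs, max_eq_right zero_le_one]
  have hc0 : ∀ s, s < 0 → c s = 0 := by
    intro s hs; simp only [c]; exact max_eq_left ((min_le_left _ _).trans hs.le)
  have hcl : ∀ s t, |c s - c t| ≤ |s - t| := by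
    intro s t
    exact (abs_max_sub_max_le_max 0 _ 0 _).trans (max_le (by simp) ((abs_min_sub_min_le_max s 1 t 1).trans
      (max_le le_rfl (by simp))))
  -- h1
  let m : Y → ℝ := fun b => max 0 (1 - ‖b‖ / ε)
  have hm : Continuous m := by fun_prop
  have hm0 : m 0 = 1 := by simp [m]
  have hmε : ∀ b, ε < ‖b‖ → m b = 0 := by
    intro b hb
    simp only [m]
    exact max_eq_left (by rw [sub_nonpos, one_le_div hε0]; exact hb.le)
  have hml : ∀ b b', |m b - m b'| ≤ ‖b - b'‖ / ε := by
    intro b b'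
    refine (abs_max_sub_max_le_max 0 _ 0 _).trans (max_le (by simp; positivity) ?_)
    rw [sub_sub_sub_cancel_left, ← sub_div, abs_div, abs_of_pos hε0, abs_sub_comm]
    gcongr
    exact abs_norm_sub_norm_le b b'
  have hb1 : ∀ s, ‖(f s).1‖ ≤ r := fun s => (norm_fst_le (f s)).trans (hb s)
  have hb2 : ∀ s, |(f s).2| ≤ r := fun s => (norm_snd_le (f s)).trans (hb s)
  obtain ⟨H1, hH1⟩ := fiber_homeo (P := ℝ) (Y := Y) (fun s b => (m b * c s) • (f s).1)
    (by fun_prop) (by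
      intro s b b'
      rw [← sub_smul, ← sub_mul, norm_smul, Real.norm_eq_abs, abs_mul]
      have h1 := hml b b'
      have h2 := hc01 s
      rw [abs_of_nonneg h2.1]
      calc |m b - m b'| * c s * ‖(f s).1‖ ≤ ‖b - b'‖ / ε * 1 * r := by
            gcongr
            · exact h2.2
            · exact hb1 s
        _ = ‖b - b'‖ * (r / ε) := by ring
        _ ≤ ‖b - b'‖ * (1 / 2) := by
            refine mul_le_mul_of_nonneg_left ?_ (norm_nonneg _)
            rw [div_le_iff₀ hε0]; linarith
        _ = _ := by ring)
  -- Tietze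
  let xc : AddCircle (1 : ℝ) → Y :=
    Function.Periodic.lift (f := fun s => (f s).1) (c := (1 : ℝ)) (fun s => by simp [hper s])
  have hxc : Continuous xc := (hf.fst).quotient_lift _
  have hxinj : Function.Injective xc := by
    intro a b hab
    induction a using QuotientAddGroup.induction_on with | H s => ?_
    induction b using QuotientAddGroup.induction_on with | H t => ?_
    obtain ⟨k, hk⟩ := hinj s t hab
    rw [hk]
    have : ((k : ℝ) : AddCircle (1 : ℝ)) = 0 := by
      rw [AddCircle.coe_eq_zero_iff]; exact ⟨k, by simp⟩
    rw [AddCircle.coe_add, this, add_zero]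
  let zc : AddCircle (1 : ℝ) → ℝ :=
    Function.Periodic.lift (f := fun s => (f s).2) (c := (1 : ℝ)) (fun s => by simp [hper s])
  have hzc : Continuous zc := (hf.snd).quotient_lift _
  have : Fact ((0 : ℝ) < 1) := ⟨one_pos⟩
  have hxe : IsClosedEmbedding xc := hxc.isClosedEmbedding hxinj
  obtain ⟨F, hF, hFx⟩ := ContinuousMap.exists_extension_forall_mem_of_isClosedEmbedding
    (⟨zc, hzc⟩ : C(AddCircle (1 : ℝ), ℝ)) (t := Set.Icc (-r) r) (fun a => by
      induction a using QuotientAddGroup.induction_on with | H s => ?_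
      exact abs_le.1 (hb2 s)) ⟨0, by simp [hr.le]⟩ hxe
  have hFx' : ∀ s, F (f s).1 = (f s).2 := fun s => by
    exact congrFun hFx (s : AddCircle (1 : ℝ))
  let χ : Y → ℝ := fun b => max 0 (min 1 (2 - 2 * ‖b‖ / ε))
  have hχ : Continuous χ := by fun_prop
  have hχ01 : ∀ b, 0 ≤ χ b ∧ χ b ≤ 1 := fun s =>
    ⟨le_max_left _ _, max_le zero_le_one (min_le_left _ _)⟩
  have hχ1 : ∀ b, ‖b‖ ≤ r → χ b = 1 := by
    intro b hb
    simp only [χ]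
    rw [min_eq_left, max_eq_right zero_le_one]
    have : 2 * ‖b‖ / ε ≤ 1 := by rw [div_le_one hε0]; linarith [norm_nonneg b]
    linarith
  have hχ0 : ∀ b, ε < ‖b‖ → χ b = 0 := by
    intro b hb
    simp only [χ]
    refine max_eq_left ((min_le_right _ _).trans ?_)
    have : 2 ≤ 2 * ‖b‖ / ε := by rw [le_div_iff₀ hε0]; linarith
    linarith
  obtain ⟨H2, hH2⟩ := fiber_homeo (P := Y) (Y := ℝ) (fun b s => (F b * χ b) * c s)
    (by fun_prop) (by
      intro b s s'
      have h1 : |F b * χ b| ≤ 1 / 2 := by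
        rw [abs_mul, abs_of_nonneg (hχ01 b).1]
        have := abs_le.2 (hF b)
        nlinarith [hχ01 b, abs_nonneg (F b)]
      rw [← mul_sub, norm_mul, Real.norm_eq_abs, Real.norm_eq_abs, Real.norm_eq_abs]
      exact mul_le_mul h1 (hcl s s') (abs_nonneg _) (by norm_num))
  refine ⟨(Homeomorph.prodComm Y ℝ).trans (H1.trans ((Homeomorph.prodComm ℝ Y).trans H2)), ?_, ?_⟩
  · intro b s hbs
    simp only [Homeomorph.trans_apply, Homeomorph.coe_prodComm, Prod.swap_prod_mk, hH1]
    have : m b * c s = 0 := by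
      by_cases h : ‖b‖ ≤ ε
      · rw [hc0 s (by by_contra h2; exact hbs ⟨h, not_lt.1 h2⟩), mul_zero]
      · rw [hmε b (not_le.1 h), zero_mul]
    rw [this, zero_smul, add_zero, hH2]
    have : F b * χ b * c s = 0 := by
      by_cases h : ‖b‖ ≤ ε
      · rw [hc0 s (by by_contra h2; exact hbs ⟨h, not_lt.1 h2⟩), mul_zero]
      · rw [hχ0 b (not_le.1 h), mul_zero, zero_mul]
    rw [this, add_zero]
  · intro s hs
    simp only [Homeomorph.trans_apply, Homeomorph.coe_prodComm, Prod.swap_prod_mk, hH1]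
    rw [hm0, hc1 s hs, one_mul, one_smul, zero_add, hH2, hFx',
      hχ1 _ (hb1 s), hc1 s hs, mul_one, mul_one]

/-- polar coordinates along the positive ray -/
theorem polar_exists (μ : ℝ) (hμ : 1 < μ) : ∃ Ψ : OpenPartialHomeomorph (Y × ℝ) (Y × ℝ),
    Ψ.source = Set.univ ∧ Ψ.target = {w | 0 < w.2} ∧
    ∀ b s, Ψ (b, s) = (μ ^ s • b, μ ^ s) := by
  have hμ0 : 0 < μ := by linarith
  refine ⟨{ toFun := fun w => (μ ^ w.2 • w.1, μ ^ w.2)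
            invFun := fun w => (w.2⁻¹ • w.1, Real.logb μ w.2)
            source := Set.univ
            target := {w | 0 < w.2}
            map_source' := fun w _ => Real.rpow_pos_of_pos hμ0 _
            map_target' := fun w _ => Set.mem_univ _
            left_inv' := ?_
            right_inv' := ?_
            open_source := isOpen_univ
            open_target := isOpen_lt continuous_const continuous_snd
            continuousOn_toFun := ?_
            continuousOn_invFun := ?_ }, rfl, rfl, fun b s => rfl⟩
  · rintro ⟨b, s⟩ -
    have : (μ ^ s) ≠ 0 := (Real.rpow_pos_of_pos hμ0 _).ne'
    simp only [Prod.mk.injEq]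
    exact ⟨by rw [smul_smul, inv_mul_cancel₀ this, one_smul], Real.logb_rpow hμ0 hμ.ne'⟩
  · rintro ⟨y, z⟩ (hz : 0 < z)
    simp only [Real.rpow_logb hμ0 hμ.ne' hz, Prod.mk.injEq, and_true]
    rw [smul_smul, mul_inv_cancel₀ hz.ne', one_smul]
  · have : Continuous fun w : Y × ℝ => μ ^ w.2 :=
      continuous_const.rpow continuous_snd (fun _ => Or.inl hμ0.ne')
    exact ((this.smul continuous_fst).prodMk this).continuousOn
  · refine ContinuousOn.prodMk ?_ ?_
    · exact (continuous_snd.continuousOn.inv₀ (fun w hw => (ne_of_gt hw))).smul continuous_fst.continuousOn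
    · simp only [Real.logb]
      exact (continuous_snd.continuousOn.log (fun w hw => (ne_of_gt hw))).div_const _

/-- shears straightening a curve with injective proper projection -/
theorem kappa_exists (μ ν : ℝ) (hμ : 1 < μ) (hν : 1 < ν) (γ : ℝ → Y × ℝ) (hγ : Continuous γ)
    (hper : ∀ s, γ (s + 1) = ν • γ s) (hinj : ∀ s t, (γ s).1 = (γ t).1 → s = t) :
    ∃ κ : (Y × ℝ) ≃ₜ (Y × ℝ), ∀ s, 1 ≤ s → κ (γ s) = (0, μ ^ s) := by
  have hμ0 : 0 < μ := by linarith
  let p : Set.Ici (1 : ℝ) → Y := fun s => (γ s).1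
  have hp : Continuous p := by fun_prop
  have hne : ∀ s, (γ s).1 ≠ 0 := by
    intro s h
    have := hinj (s + 1) s (by rw [hper]; simp [h])
    linarith
  obtain ⟨s0, hs0, hmin⟩ := (isCompact_Icc (a := (0 : ℝ)) (b := 1)).exists_isMinOn ⟨0, by simp⟩
    (hγ.fst.norm).continuousOn
  have hpos : 0 < ‖(γ s0).1‖ := norm_pos_iff.2 (hne s0)
  have hpk : ∀ (k : ℕ) s, γ (s + k) = ν ^ k • γ s := by
    intro k
    induction k with
    | zero => intro s; simp
    | succ k ih => intro s; rw [Nat.cast_succ, ← add_assoc, hper, ih, smul_smul, pow_succ']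
  have hlow : ∀ s, 0 ≤ s → ν ^ (⌊s⌋₊) * ‖(γ s0).1‖ ≤ ‖(γ s).1‖ := by
    intro s hs
    have h1 := hpk ⌊s⌋₊ (s - ⌊s⌋₊)
    rw [sub_add_cancel] at h1
    rw [h1, Prod.smul_fst, norm_smul, Real.norm_of_nonneg (by positivity)]
    refine mul_le_mul_of_nonneg_left (hmin ⟨?_, ?_⟩) (by positivity)
    · linarith [Nat.floor_le hs]
    · linarith [Nat.lt_floor_add_one s]
  have hprop : IsProperMap p := by
    rw [isProperMap_iff_tendsto_cocompact]
    refine ⟨hp, ?_⟩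
    rw [← Metric.cobounded_eq_cocompact (α := Y), ← tendsto_norm_atTop_iff_cobounded]
    have hcc : Tendsto (fun s : Set.Ici (1 : ℝ) => (s : ℝ)) (cocompact _) atTop := by
      have h1 : Tendsto (fun s : Set.Ici (1 : ℝ) => (s : ℝ)) (cocompact _) (cocompact ℝ) :=
        (isClosed_Ici.isClosedEmbedding_subtypeVal).tendsto_cocompact
      refine (tendsto_norm_cocompact_atTop.comp h1).congr (fun s => ?_)
      exact Real.norm_of_nonneg (zero_le_one.trans s.2)
    refine tendsto_atTop_mono (fun s => hlow s (zero_le_one.trans s.2)) ?_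
    refine Tendsto.atTop_mul_const hpos ?_
    exact (tendsto_pow_atTop_atTop_of_one_lt hν).comp (tendsto_nat_floor_atTop.comp hcc)
  have hce : IsClosedEmbedding p := by
    refine IsClosedEmbedding.of_continuous_injective_isClosedMap hp ?_ hprop.isClosedMap
    intro a b h
    exact Subtype.ext (hinj _ _ h)
  have hrp : Continuous fun s : ℝ => μ ^ s :=
    continuous_const.rpow continuous_id (fun _ => Or.inl hμ0.ne')
  obtain ⟨F, hF⟩ := ContinuousMap.exists_extension' hce
    (⟨fun s => μ ^ (s : ℝ) - (γ s).2, by fun_prop⟩ : C(Set.Ici (1 : ℝ), ℝ))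
  have hF' : ∀ s, 1 ≤ s → F (γ s).1 = μ ^ s - (γ s).2 := fun s hs => congrFun hF ⟨s, hs⟩
  let G : ℝ → Y := fun z => (γ (Real.logb μ (max z μ))).1
  have hG : Continuous G := by
    refine (continuous_fst.comp hγ).comp ?_
    simp only [Real.logb]
    refine (Continuous.log (by fun_prop) (fun z => ?_)).div_const _
    exact (hμ0.trans_le (le_max_right _ _)).ne'
  have hG' : ∀ s, 1 ≤ s → G (μ ^ s) = (γ s).1 := by
    intro s hs
    simp only [G]
    rw [max_eq_left, Real.logb_rpow hμ0 hμ.ne']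
    nth_rewrite 1 [← Real.rpow_one μ]
    exact Real.rpow_le_rpow_of_exponent_le hμ.le hs
  let κ : (Y × ℝ) ≃ₜ (Y × ℝ) :=
    { toFun := fun w => (w.1 - G (w.2 + F w.1), w.2 + F w.1)
      invFun := fun w => (w.1 + G w.2, w.2 - F (w.1 + G w.2))
      left_inv := fun w => by ext <;> simp
      right_inv := fun w => by ext <;> simp
      continuous_toFun := by fun_prop
      continuous_invFun := by fun_prop }
  refine ⟨κ, fun s hs => ?_⟩
  change ((γ s).1 - G ((γ s).2 + F (γ s).1), (γ s).2 + F (γ s).1) = _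
  rw [hF' s hs, add_sub_cancel, hG' s hs, sub_self]

/-- An equivariant chart agrees near the ray with a global homeomorphism. -/
theorem straighten (hd : 3 ≤ Module.finrank ℝ Y) (φ : OpenPartialHomeomorph (Y × ℝ) (Y × ℝ))
    (ε μ ν : ℝ) (hε : 0 < ε) (hμ : 1 < μ) (hν : 1 < ν)
    (hsrc : ∀ y z, 0 < z → ‖y‖ < ε * z → (y, z) ∈ φ.source)
    (heq : ∀ y z, 0 < z → ‖y‖ < ε * z → φ (μ • (y, z)) = ν • φ (y, z)) :
    ∃ G : (Y × ℝ) ≃ₜ (Y × ℝ), ∃ U : Set (Y × ℝ), IsOpen U ∧ (∀ z, μ ≤ z → (0, z) ∈ U) ∧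
      U ⊆ φ.source ∧ ∀ w ∈ U, G w = φ w := by
  have hμ0 : 0 < μ := by linarith
  have hν0 : 0 < ν := by linarith
  obtain ⟨Ψ, hΨs, hΨt, hΨ⟩ := polar_exists (Y := Y) μ hμ
  have hop : IsOpen {w : Y × ℝ | ‖w.1‖ < ε} := isOpen_lt (by fun_prop) (by fun_prop)
  let Φ := (Ψ.trans φ).restrOpen {w : Y × ℝ | ‖w.1‖ < ε} hop
  have hΦ : ∀ b s, Φ (b, s) = φ (μ ^ s • b, μ ^ s) := fun b s => by
    change φ (Ψ (b, s)) = _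
    rw [hΨ]
  have hmul : ∀ (b : Y) (s : ℝ), ‖b‖ < ε → 0 < μ ^ s ∧ ‖μ ^ s • b‖ < ε * μ ^ s := by
    intro b s hb
    have h := Real.rpow_pos_of_pos hμ0 s
    refine ⟨h, ?_⟩
    rw [norm_smul, Real.norm_of_nonneg h.le, mul_comm]
    exact mul_lt_mul_of_pos_right hb h
  have hΦs : Φ.source = {w | ‖w.1‖ < ε} := by
    ext ⟨b, s⟩
    simp only [Φ, OpenPartialHomeomorph.restrOpen_source, OpenPartialHomeomorph.trans_source,
      Set.mem_inter_iff, hΨs, Set.mem_univ, true_and, Set.mem_preimage, hΨ]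
    refine ⟨fun h => h.2, fun h => ⟨?_, h⟩⟩
    exact hsrc _ _ (hmul b s h).1 (hmul b s h).2
  have hΦeq : ∀ b s, ‖b‖ < ε → Φ (b, s + 1) = ν • Φ (b, s) := by
    intro b s hb
    rw [hΦ, hΦ, ← heq _ _ (hmul b s hb).1 (hmul b s hb).2, Real.rpow_add_one hμ0.ne', mul_comm,
      mul_smul, Prod.smul_mk, smul_eq_mul]
  set r := min (1 / 4) (ε / 16) with hr
  have hr0 : 0 < r := by positivity
  have hr1 : r ≤ ε / 16 := min_le_right _ _
  obtain ⟨f, hfc, hfp, hfb, hfi, hfj⟩ := klee_generic Φ ε ν hd hν hΦs hΦeq r hr0 (by linarith)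
  have hf1 : ∀ s, ‖(f s).1‖ < ε := fun s =>
    (norm_fst_le (f s)).trans_lt ((hfb s).trans_lt (by linarith))
  obtain ⟨h, hid, hh⟩ := tube_homeo (ε / 2) r hr0 (by linarith) (min_le_left _ _) f hfc hfp hfb hfi
  -- extension
  have hΦk : ∀ (k : ℕ) b s, ‖b‖ < ε → Φ (b, s + k) = ν ^ k • Φ (b, s) := by
    intro k
    induction k with
    | zero => intro b s hb; simp
    | succ k ih => intro b s hb; rw [Nat.cast_succ, ← add_assoc, hΦeq _ _ hb, ih _ _ hb, smul_smul, pow_succ']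
  have hΦ0 : ∀ b s, ‖b‖ < ε → Φ (b, s) ≠ 0 := by
    intro b s hb h0
    have h1 : Φ (b, s + 1) = Φ (b, s) := by rw [hΦeq _ _ hb, h0, smul_zero]
    have h2 := Φ.injOn (by rw [hΦs]; exact hb) (by rw [hΦs]; exact hb) h1
    simp at h2
  have hcl : IsClosed (Φ '' {w : Y × ℝ | ‖w.1‖ ≤ ε / 2 ∧ 0 ≤ w.2}) := by
    refine closed_image Φ (Metric.closedBall (0 : Y) (ε / 2) ×ˢ Set.Icc (0 : ℝ) 1)
      ((isCompact_closedBall _ _).prod isCompact_Icc) ?_ ?_ ν hν (fun k w => (w.1, w.2 + k))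
      (fun k => by fun_prop) ?_ _ ?_ ?_
    · rintro ⟨b, s⟩ ⟨hb, -⟩
      rw [hΦs]
      simp only [mem_closedBall_zero_iff] at hb
      change ‖b‖ < ε
      linarith
    · rintro ⟨b, s⟩ ⟨hb, -⟩
      simp only [mem_closedBall_zero_iff] at hb
      exact hΦ0 b s (by linarith)
    · rintro k ⟨b, s⟩ ⟨hb, -⟩
      simp only [mem_closedBall_zero_iff] at hb
      have hb' : ‖b‖ < ε := by linarith
      refine ⟨by rw [hΦs]; exact hb', hΦk k b s hb'⟩
    · have c1 : IsClosed {w : Y × ℝ | ‖w.1‖ ≤ ε / 2} := isClosed_le (by fun_prop) continuous_const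
      exact c1.inter (isClosed_le continuous_const continuous_snd)
    · rintro ⟨b, s⟩ ⟨hb, hs⟩
      simp only at hb hs
      refine ⟨⌊s⌋₊, (b, s - ⌊s⌋₊), ⟨by simpa using hb, ?_, ?_⟩, by simp⟩
      · linarith [Nat.floor_le hs]
      · linarith [Nat.lt_floor_add_one s]
  obtain ⟨H, hH, -⟩ := ext_lemma Φ h {w : Y × ℝ | ‖w.1‖ ≤ ε / 2 ∧ 0 ≤ w.2} (by
      rintro ⟨b, s⟩ ⟨hb, -⟩
      rw [hΦs]
      simp only at hb
      change ‖b‖ < ε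
      linarith) (fun w hw => hid w.1 w.2 hw) hcl
  have hγc : Continuous fun s => Φ ((f s).1, s + (f s).2) := by
    refine Φ.continuousOn.comp_continuous (by fun_prop) (fun s => ?_)
    rw [hΦs]; exact hf1 s
  obtain ⟨κ, hκ⟩ := kappa_exists μ ν hμ hν (fun s => Φ ((f s).1, s + (f s).2)) hγc (by
    intro s
    simp only [hfp]
    rw [show s + 1 + (f s).2 = s + (f s).2 + 1 by ring, hΦeq _ _ (hf1 s)]) hfj
  let K := H.trans κ
  have hK : ∀ z, μ ≤ z → K (φ (0, z)) = (0, z) := by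
    intro z hz
    have hz0 : 0 < z := by linarith
    have hs : 1 ≤ Real.logb μ z := by
      rw [Real.le_logb_iff_rpow_le hμ hz0, Real.rpow_one]; exact hz
    have h1 : Φ (0, Real.logb μ z) = φ (0, z) := by
      rw [hΦ, smul_zero, Real.rpow_logb hμ0 hμ.ne' hz0]
    have h2 : H (Φ (0, Real.logb μ z)) = Φ (h (0, Real.logb μ z)) :=
      hH _ (by rw [hΦs]; simpa using hε)
    change κ (H (φ (0, z))) = _
    rw [← h1, h2, hh _ hs, hκ _ hs, Real.rpow_logb hμ0 hμ.ne' hz0]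
  let τ : (Y × ℝ) ≃ₜ (Y × ℝ) := Homeomorph.addRight (0, μ)
  have hτ : ∀ w, τ w = w + (0, μ) := fun _ => rfl
  have hτs : ∀ w, τ.symm w = w - (0, μ) := fun w => by
    rw [Homeomorph.symm_apply_eq, hτ, sub_add_cancel]
  let α := (τ.toOpenPartialHomeomorph.trans φ).trans (K.trans τ.symm).toOpenPartialHomeomorph
  have hα : ∀ w, α w = τ.symm (K (φ (τ w))) := fun w => rfl
  have hαs : ∀ w, w ∈ α.source ↔ τ w ∈ φ.source := by
    intro w
    simp [α]
  obtain ⟨g, U, hU, hRU, hUs, hg⟩ := S4 α (by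
    intro z hz
    rw [hαs, hα, hτ, Prod.mk_add_mk, zero_add, hK _ (by linarith), hτs]
    refine ⟨hsrc _ _ (by linarith) ?_, by simp⟩
    rw [norm_zero]
    exact mul_pos hε (by linarith))
  refine ⟨τ.symm.trans (g.trans (τ.trans K.symm)), τ.symm ⁻¹' U, hU.preimage τ.symm.continuous,
    ?_, ?_, ?_⟩
  · intro z hz
    rw [Set.mem_preimage, hτs]
    simpa using hRU (z - μ) (by linarith)
  · intro w hw
    have := (hαs _).1 (hUs hw)
    rwa [τ.apply_symm_apply] at this
  · intro w hw
    have := hg _ hw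
    simp only [Homeomorph.trans_apply]
    rw [this, hα, τ.apply_symm_apply, τ.apply_symm_apply, K.symm_apply_apply]

end

open Filter Topology

section
variable {W : Type*} [NormedAddCommGroup W] [NormedSpace ℝ W]

/-- horizontal part of a point `((a,t),x)` -/
def hv (w : (W × ℝ) × ℝ) : W × ℝ := (w.1.1, w.2)

theorem hv_cont : Continuous (hv : (W × ℝ) × ℝ → W × ℝ) := by unfold hv; fun_prop

/-- radius of the horizontal part -/
noncomputable def rad (w : (W × ℝ) × ℝ) : ℝ := √(w.2 ^ 2 + ‖w.1.1‖ ^ 2)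

theorem rad_cont : Continuous (rad : (W × ℝ) × ℝ → ℝ) := by unfold rad; fun_prop

theorem rad_nonneg (w : (W × ℝ) × ℝ) : 0 ≤ rad w := Real.sqrt_nonneg _

theorem rad_smul (c : ℝ) (hc : 0 ≤ c) (w : (W × ℝ) × ℝ) : rad (c • w) = c * rad w := by
  unfold rad
  simp only [Prod.smul_snd, Prod.smul_fst, norm_smul, smul_eq_mul, Real.norm_of_nonneg hc]
  rw [← Real.sqrt_sq hc, ← Real.sqrt_mul (sq_nonneg c), Real.sqrt_sq hc]
  congr 1; ring

theorem rad_AB (w : (W × ℝ) × ℝ) : pA (hv w) ^ 2 = (rad w + w.2) / 2 ∧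
    pB (hv w) ^ 2 = (rad w - w.2) / 2 := pAB_aux (hv w)

theorem plk_same (p q : ℝ → ℝ) (a b : ℝ) (hp : 0 < p a) (hpq : p a < q a) : plk p q p q a b = 1 := by
  unfold plk
  rw [div_self (by linarith), one_mul]
  have h : 0 < max b (p a) := lt_max_of_lt_right hp
  rw [div_eq_one_iff_eq h.ne']
  rcases le_total b (q a) with h1 | h1
  · rw [max_eq_right h1, min_eq_left (max_le h1 hpq.le)]; ring
  · rw [max_eq_left (hpq.le.trans h1), min_eq_right h1, max_eq_left h1]; ring

theorem squeeze_t {p q p' q' : ℝ → ℝ} (d : PLdata p q p' q') :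
    ∃ H : ((W × ℝ) × ℝ) ≃ₜ ((W × ℝ) × ℝ), ∀ w, H w =
      ((w.1.1, plk p q p' q' (pA (hv w)) |w.1.2| * w.1.2), w.2) := by
  have key : ∀ {p q p' q' : ℝ → ℝ} (d : PLdata p q p' q') (w : (W × ℝ) × ℝ),
      plk p' q' p q (pA (hv w)) |plk p q p' q' (pA (hv w)) |w.1.2| * w.1.2| *
        (plk p q p' q' (pA (hv w)) |w.1.2| * w.1.2) = w.1.2 := by
    intro p q p' q' d w
    rw [abs_mul, abs_of_pos (d.pos _ _), ← mul_assoc, d.inv _ _ (abs_nonneg _), one_mul]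
  have cont : ∀ {p q p' q' : ℝ → ℝ} (d : PLdata p q p' q'), Continuous fun w : (W × ℝ) × ℝ =>
      (((w.1.1, plk p q p' q' (pA (hv w)) |w.1.2| * w.1.2), w.2) : (W × ℝ) × ℝ) := by
    intro p q p' q' d
    have h1 : Continuous fun w : (W × ℝ) × ℝ => plk p q p' q' (pA (hv w)) |w.1.2| :=
      d.cont.comp ((pA_cont.comp hv_cont).prodMk (by fun_prop))
    fun_prop
  refine ⟨⟨⟨fun w => ((w.1.1, plk p q p' q' (pA (hv w)) |w.1.2| * w.1.2), w.2),
    fun w => ((w.1.1, plk p' q' p q (pA (hv w)) |w.1.2| * w.1.2), w.2), ?_, ?_⟩, cont d, cont d.swap⟩,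
    fun w => rfl⟩
  · intro w
    ext1
    · ext1
      · rfl
      · exact key d w
    · rfl
  · intro w
    ext1
    · ext1
      · rfl
      · exact key d.swap w
    · rfl

theorem squeeze_v {p q : ℝ → ℝ} {p' : ℝ → ℝ → ℝ} (hp' : Continuous fun z : ℝ × ℝ => p' z.1 z.2)
    (d : ∀ t, PLdata p q (p' t) q) :
    ∃ H : ((W × ℝ) × ℝ) ≃ₜ ((W × ℝ) × ℝ), ∀ w, H w =
      (((vmap (plk p q (p' w.1.2) q) (hv w)).1, w.1.2), (vmap (plk p q (p' w.1.2) q) (hv w)).2) := by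
  have hp := (d 0).cp
  have hq := (d 0).cq
  have c1 : Continuous fun w : (W × ℝ) × ℝ => plk p q (p' w.1.2) q (pA (hv w)) (pB (hv w)) := by
    unfold plk
    have e1 : Continuous fun w : (W × ℝ) × ℝ => pA (hv w) := pA_cont.comp hv_cont
    have e2 : Continuous fun w : (W × ℝ) × ℝ => pB (hv w) := pB_cont.comp hv_cont
    have e3 : Continuous fun w : (W × ℝ) × ℝ => p' w.1.2 (pA (hv w)) :=
      hp'.comp ((by fun_prop : Continuous fun w : (W × ℝ) × ℝ => w.1.2).prodMk e1)
    refine Continuous.div (Continuous.add (Continuous.add (by fun_prop) (Continuous.mul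
      (Continuous.div (by fun_prop) (by fun_prop) ?_) (by fun_prop))) (by fun_prop)) (by fun_prop) ?_
    · intro w; have := (d 0).pq (pA (hv w)); linarith
    · intro w; have := (d 0).p0 (pA (hv w)); have := le_max_right (pB (hv w)) (p (pA (hv w))); linarith
  have c2 : Continuous fun w : (W × ℝ) × ℝ => plk (p' w.1.2) q p q (pA (hv w)) (pB (hv w)) := by
    unfold plk
    have e1 : Continuous fun w : (W × ℝ) × ℝ => pA (hv w) := pA_cont.comp hv_cont
    have e2 : Continuous fun w : (W × ℝ) × ℝ => pB (hv w) := pB_cont.comp hv_cont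
    have e3 : Continuous fun w : (W × ℝ) × ℝ => p' w.1.2 (pA (hv w)) :=
      hp'.comp ((by fun_prop : Continuous fun w : (W × ℝ) × ℝ => w.1.2).prodMk e1)
    refine Continuous.div (Continuous.add (Continuous.add (by fun_prop) (Continuous.mul
      (Continuous.div (by fun_prop) (by fun_prop) ?_) (by fun_prop))) (by fun_prop)) (by fun_prop) ?_
    · intro w; have := (d w.1.2).pq' (pA (hv w)); linarith
    · intro w; have := (d w.1.2).p0' (pA (hv w))
      have := le_max_right (pB (hv w)) (p' w.1.2 (pA (hv w))); linarith
  have cont : ∀ K : ((W × ℝ) × ℝ) → ℝ → ℝ → ℝ,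
      Continuous (fun w : (W × ℝ) × ℝ => K w (pA (hv w)) (pB (hv w))) →
      Continuous fun w : (W × ℝ) × ℝ => ((((vmap (K w) (hv w)).1, w.1.2),
        (vmap (K w) (hv w)).2) : (W × ℝ) × ℝ) := by
    intro K hK
    unfold vmap
    have e1 : Continuous fun w : (W × ℝ) × ℝ => pA (hv w) := pA_cont.comp hv_cont
    have e2 : Continuous fun w : (W × ℝ) × ℝ => pB (hv w) := pB_cont.comp hv_cont
    have e4 : Continuous (hv : (W × ℝ) × ℝ → W × ℝ) := hv_cont
    exact ((hK.smul e4.fst).prodMk (by fun_prop)).prodMk ((e1.pow 2).sub ((hK.mul e2).pow 2))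
  refine ⟨⟨⟨fun w => (((vmap (plk p q (p' w.1.2) q) (hv w)).1, w.1.2),
      (vmap (plk p q (p' w.1.2) q) (hv w)).2),
    fun w => (((vmap (plk (p' w.1.2) q p q) (hv w)).1, w.1.2),
      (vmap (plk (p' w.1.2) q p q) (hv w)).2), ?_, ?_⟩, cont _ c1, cont _ c2⟩, fun w => rfl⟩
  · intro w
    have h := vmap_inv (plk p q (p' w.1.2) q) (plk (p' w.1.2) q p q) (hv w) ((d w.1.2).pos _ _).le
      ((d w.1.2).inv _ _ (pB_nonneg _))
    have h1 := congrArg Prod.fst h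
    have h2 := congrArg Prod.snd h
    ext1
    · ext1
      · exact h1
      · rfl
    · exact h2
  · intro w
    have h := vmap_inv (plk (p' w.1.2) q p q) (plk p q (p' w.1.2) q) (hv w)
      ((d w.1.2).swap.pos _ _).le ((d w.1.2).swap.inv _ _ (pB_nonneg _))
    have h1 := congrArg Prod.fst h
    have h2 := congrArg Prod.snd h
    ext1
    · ext1
      · exact h1
      · rfl
    · exact h2

/-- pushing a cap into a neighbourhood of the ray -/
theorem cap_push (ε A0 : ℝ) (hε : 0 < ε) (hA0 : 1 ≤ A0) (U : Set ((W × ℝ) × ℝ)) (hU : IsOpen U)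
    (hR : ∀ z, A0 ^ 2 ≤ z → ((0 : W × ℝ), z) ∈ U) :
    ∃ Q : ((W × ℝ) × ℝ) ≃ₜ ((W × ℝ) × ℝ),
      (∀ w, ¬ (A0 ≤ pA (hv w) ∧ |w.1.2| ≤ 8 * ε * pA (hv w) ^ 2) → Q w = w) ∧
      ∀ w, A0 + 1 ≤ pA (hv w) → |w.1.2| ≤ 4 * ε * pA (hv w) ^ 2 → pB (hv w) ≤ 2 * pA (hv w) →
        Q w ∈ U := by
  -- the thickness function
  let C : Set ((W × ℝ) × ℝ) := Uᶜ ∪ {((0 : W × ℝ), -1)}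
  have hC : IsClosed C := hU.isClosed_compl.union isClosed_singleton
  let η : ℝ → ℝ := fun z => min 1 (Metric.infDist ((0 : W × ℝ), max z (A0 ^ 2)) C)
  have hη : Continuous η := by
    have : Continuous fun z : ℝ => Metric.infDist ((0 : W × ℝ), max z (A0 ^ 2)) C :=
      (Metric.continuous_infDist_pt C).comp (by fun_prop)
    fun_prop
  have hηp : ∀ z, 0 < η z := by
    intro z
    refine lt_min one_pos ((hC.notMem_iff_infDist_pos ⟨_, Or.inr rfl⟩).1 ?_)
    rintro (h | h)
    · exact h (hR _ (le_max_right _ _))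
    · have h1 := congrArg Prod.snd h
      simp only at h1
      have := le_max_right z (A0 ^ 2)
      nlinarith
  have hη1 : ∀ z, η z ≤ 1 := fun z => min_le_left _ _
  have hηU : ∀ z, A0 ^ 2 ≤ z → ∀ w, dist w ((0 : W × ℝ), z) < η z → w ∈ U := by
    intro z hz w hw
    by_contra h
    have h1 : Metric.infDist ((0 : W × ℝ), z) C ≤ dist ((0 : W × ℝ), z) w :=
      Metric.infDist_le_dist_of_mem (Or.inl h)
    have h2 : η z ≤ Metric.infDist ((0 : W × ℝ), z) C := by
      have : η z ≤ Metric.infDist ((0 : W × ℝ), max z (A0 ^ 2)) C := min_le_right _ _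
      rwa [max_eq_left hz] at this
    rw [dist_comm] at h1
    linarith
  let A : ℝ → ℝ := fun a => max a 1
  have hA1 : ∀ a, 1 ≤ A a := fun a => le_max_right _ _
  have hAc : Continuous A := by fun_prop
  let τ : ℝ → ℝ := fun a => η (A a ^ 2) / (8 * A a)
  have hτc : Continuous τ := by
    refine Continuous.div (by fun_prop) (by fun_prop) (fun a => ?_)
    have := hA1 a; positivity
  have hτp : ∀ a, 0 < τ a := fun a => div_pos (hηp _) (by have := hA1 a; positivity)
  have hτ1 : ∀ a, τ a ≤ 1 / 8 := by
    intro a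
    rw [div_le_iff₀ (by have := hA1 a; positivity)]
    have := hη1 (A a ^ 2); have := hA1 a; linarith
  let ω1 : ℝ → ℝ := fun a => max 0 (min 1 (a - A0))
  have hω1 : ∀ a, 0 ≤ ω1 a ∧ ω1 a ≤ 1 := fun a => ⟨le_max_left _ _, max_le zero_le_one (min_le_left _ _)⟩
  have hω10 : ∀ a, a < A0 → ω1 a = 0 := fun a ha =>
    max_eq_left ((min_le_right _ _).trans (by linarith))
  have hω11 : ∀ a, A0 + 1 ≤ a → ω1 a = 1 := fun a ha => by
    simp only [ω1]; rw [min_eq_left (by linarith), max_eq_right zero_le_one]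
  have hω1c : Continuous ω1 := by fun_prop
  let ω2 : ℝ → ℝ → ℝ := fun t a => max 0 (min 1 (2 - |t| / (4 * ε * A a ^ 2)))
  have hω2 : ∀ t a, 0 ≤ ω2 t a ∧ ω2 t a ≤ 1 := fun t a =>
    ⟨le_max_left _ _, max_le zero_le_one (min_le_left _ _)⟩
  have hεA : ∀ a, 0 < 4 * ε * A a ^ 2 := fun a => by have := hA1 a; positivity
  have hω20 : ∀ t a, 8 * ε * A a ^ 2 < |t| → ω2 t a = 0 := fun t a ha => by
    refine max_eq_left ((min_le_right _ _).trans ?_)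
    have : 2 ≤ |t| / (4 * ε * A a ^ 2) := by rw [le_div_iff₀ (hεA a)]; linarith
    linarith
  have hω21 : ∀ t a, |t| ≤ 4 * ε * A a ^ 2 → ω2 t a = 1 := fun t a ha => by
    simp only [ω2]; rw [min_eq_left, max_eq_right zero_le_one]
    have : |t| / (4 * ε * A a ^ 2) ≤ 1 := by rw [div_le_one (hεA a)]; exact ha
    linarith
  have hω2c : Continuous fun z : ℝ × ℝ => ω2 z.1 z.2 := by
    have : Continuous fun z : ℝ × ℝ => |z.1| / (4 * ε * A z.2 ^ 2) :=
      Continuous.div (by fun_prop) (by fun_prop) (fun z => (hεA z.2).ne')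
    fun_prop
  -- t squeeze
  let p1 : ℝ → ℝ := fun a => 4 * ε * A a ^ 2
  let q1 : ℝ → ℝ := fun a => 8 * ε * A a ^ 2
  let p1' : ℝ → ℝ := fun a => p1 a + ω1 a * (min (τ a) (p1 a) - p1 a)
  have conv : ∀ o x y : ℝ, 0 ≤ o → o ≤ 1 → 0 < x → x ≤ y → 0 < y + o * (x - y) ∧ y + o * (x - y) ≤ y := by
    intro o x y h0 h1 h2 h3
    constructor <;> nlinarith
  have hp1' : ∀ a, 0 < p1' a ∧ p1' a ≤ p1 a := fun a =>
    conv _ _ _ (hω1 a).1 (hω1 a).2 (lt_min (hτp a) (hεA a)) (min_le_right _ _)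
  have hpq1 : ∀ a, p1 a < q1 a := fun a => by
    have := hεA a; simp only [p1, q1]; linarith
  have d1 : PLdata p1 q1 p1' q1 := ⟨by fun_prop, by fun_prop, by fun_prop, by fun_prop, hεA,
    hpq1, fun a => (hp1' a).1, fun a => (hp1' a).2.trans_lt (hpq1 a)⟩
  let p2 : ℝ → ℝ := fun a => 2 * A a
  let q2 : ℝ → ℝ := fun a => 3 * A a
  let p2' : ℝ → ℝ → ℝ := fun t a => p2 a + (ω1 a * ω2 t a) * (τ a - p2 a)
  have hp2' : ∀ t a, 0 < p2' t a ∧ p2' t a ≤ p2 a := fun t a =>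
    conv _ _ _ (mul_nonneg (hω1 a).1 (hω2 t a).1)
      (mul_le_one₀ (hω1 a).2 (hω2 t a).1 (hω2 t a).2) (hτp a)
      (by have := hτ1 a; have := hA1 a; simp only [p2]; linarith)
  have hpq2 : ∀ a, p2 a < q2 a := fun a => by
    have := hA1 a; simp only [p2, q2]; linarith
  have hp2c : Continuous fun z : ℝ × ℝ => p2' z.1 z.2 := by
    simp only [p2', p2]; fun_prop
  have d2 : ∀ t, PLdata p2 q2 (p2' t) q2 := fun t => ⟨by fun_prop, by fun_prop,
    hp2c.comp (by fun_prop : Continuous fun a : ℝ => (t, a)), by fun_prop,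
    fun a => by have := hA1 a; simp only [p2]; linarith,
    hpq2, fun a => (hp2' t a).1, fun a => (hp2' t a).2.trans_lt (hpq2 a)⟩
  obtain ⟨H1, hH1⟩ := squeeze_t (W := W) d1
  obtain ⟨H2, hH2⟩ := squeeze_v (W := W) hp2c d2
  refine ⟨H1.trans H2, ?_, ?_⟩
  · intro w hw
    set a := pA (hv w) with ha
    have hcase : a < A0 ∨ 8 * ε * A a ^ 2 < |w.1.2| := by
      by_cases h : a < A0
      · exact Or.inl h
      · right
        by_contra h2
        push Not at h h2
        have : A a = a := max_eq_left (hA0.trans h)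
        rw [this] at h2
        exact hw ⟨h, h2⟩
    have e1 : H1 w = w := by
      have : plk p1 q1 p1' q1 a |w.1.2| * w.1.2 = w.1.2 := by
        rcases hcase with h | h
        · have e : p1' a = p1 a := by simp only [p1', hω10 a h]; ring
          have : plk p1 q1 p1' q1 a |w.1.2| = plk p1 q1 p1 q1 a |w.1.2| := by unfold plk; rw [e]
          rw [this, plk_same p1 q1 a _ (hεA a) (hpq1 a), one_mul]
        · have h3 := (d1.eval a |w.1.2| (abs_nonneg _)).2.2 h.le
          have h4 : |w.1.2| ≠ 0 := (lt_trans (by have := hεA a; linarith) h).ne'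
          have h5 : plk p1 q1 p1' q1 a |w.1.2| = 1 := by
            have : plk p1 q1 p1' q1 a |w.1.2| * |w.1.2| = 1 * |w.1.2| := by rw [h3]; ring
            exact mul_right_cancel₀ h4 this
          rw [h5, one_mul]
      rw [hH1, ← ha, this]
    have e2 : H2 w = w := by
      have e : p2' w.1.2 a = p2 a := by
        simp only [p2']
        rcases hcase with h | h
        · rw [hω10 a h]; ring
        · rw [hω20 _ a h]; ring
      have h1 : plk p2 q2 (p2' w.1.2) q2 (pA (hv w)) (pB (hv w)) = 1 := by
        rw [← ha]
        have : plk p2 q2 (p2' w.1.2) q2 a (pB (hv w)) = plk p2 q2 p2 q2 a (pB (hv w)) := by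
          unfold plk; rw [e]
        rw [this, plk_same _ _ _ _ ((d2 0).p0 a) (hpq2 a)]
      rw [hH2, vmap_id _ _ h1]
      rfl
    rw [Homeomorph.trans_apply, e1, e2]
  · intro w h1 h2 h3
    set a := pA (hv w) with ha
    have hAa : A a = a := max_eq_left (by linarith)
    have ha1 : 1 ≤ a := by linarith
    set t1 := plk p1 q1 p1' q1 a |w.1.2| * w.1.2 with ht1
    have hw1 : hv (H1 w) = hv w := by rw [hH1]; rfl
    have hw2 : (H1 w).1.2 = t1 := by rw [hH1]
    have hp1a : p1' a ≤ τ a := by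
      simp only [p1', hω11 a h1]
      linarith [min_le_left (τ a) (p1 a)]
    have ht : |t1| ≤ τ a := by
      rw [ht1, abs_mul, abs_of_pos (d1.pos _ _)]
      have h4 : |w.1.2| ≤ p1 a := by simp only [p1, hAa]; exact h2
      rw [(d1.eval a _ (abs_nonneg _)).1 h4]
      calc p1' a / p1 a * |w.1.2| ≤ p1' a / p1 a * p1 a := by
            have := hp1' a; have := hεA a
            exact mul_le_mul_of_nonneg_left h4 (div_nonneg (by linarith) this.le)
        _ = p1' a := div_mul_cancel₀ _ (hεA a).ne'
        _ ≤ τ a := hp1a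
    have hτp1 : |t1| ≤ 4 * ε * A a ^ 2 := by
      rw [ht1, abs_mul, abs_of_pos (d1.pos _ _)]
      have h4 : |w.1.2| ≤ p1 a := by simp only [p1, hAa]; exact h2
      rw [(d1.eval a _ (abs_nonneg _)).1 h4]
      calc p1' a / p1 a * |w.1.2| ≤ 1 * |w.1.2| := by
            refine mul_le_mul_of_nonneg_right ?_ (abs_nonneg _)
            rw [div_le_one (hεA a)]; exact (hp1' a).2
        _ ≤ _ := by rw [one_mul]; exact h4
    have hp2a : p2' t1 a = τ a := by
      simp only [p2', hω11 a h1, hω21 t1 a hτp1]; ring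
    set K := plk p2 q2 (p2' t1) q2 with hK
    have hb : K a (pB (hv w)) * pB (hv w) ≤ τ a := by
      have h4 : pB (hv w) ≤ p2 a := by simp only [p2, hAa]; exact h3
      rw [hK, ((d2 t1).eval a _ (pB_nonneg _)).1 h4, hp2a]
      have h5 : 0 < p2 a := (d2 0).p0 a
      calc τ a / p2 a * pB (hv w) ≤ τ a / p2 a * p2 a := by
            have := hτp a
            exact mul_le_mul_of_nonneg_left h4 (by positivity)
        _ = τ a := div_mul_cancel₀ _ h5.ne'
    have hK0 : 0 < K a (pB (hv w)) := (d2 t1).pos _ _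
    set b := K a (pB (hv w)) * pB (hv w) with hbd
    have hb0 : 0 ≤ b := mul_nonneg hK0.le (pB_nonneg _)
    apply hηU (a ^ 2) (by nlinarith)
    have hQ : (H1.trans H2) w = ((K a (pB (hv w)) • w.1.1, t1), a ^ 2 - b ^ 2) := by
      rw [Homeomorph.trans_apply, hH2, hw1, hw2]
      rfl
    rw [hQ]
    have hτη : τ a * (8 * a) = η (a ^ 2) := by
      simp only [τ, hAa]
      exact div_mul_cancel₀ _ (by positivity)
    have hτa := hτp a
    have hτ1a := hτ1 a
    have hn : ‖K a (pB (hv w)) • w.1.1‖ = 2 * a * b := by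
      rw [norm_smul, Real.norm_of_nonneg hK0.le, hbd]
      have := pAB_norm (hv w)
      change 2 * pA (hv w) * pB (hv w) = ‖w.1.1‖ at this
      rw [← this, ← ha]; ring
    rw [Prod.dist_eq, max_lt_iff]
    constructor
    · change dist (K a (pB (hv w)) • w.1.1, t1) (0 : W × ℝ) < _
      rw [dist_zero_right, Prod.norm_def, max_lt_iff]
      constructor
      · simp only [hn]; rw [← hτη]; nlinarith
      · simp only [Real.norm_eq_abs]; rw [← hτη]; nlinarith
    · simp only [Real.dist_eq, sub_sub_cancel_left, abs_neg]
      rw [abs_of_nonneg (sq_nonneg b), ← hτη]; nlinarith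

/-- An equivariant chart agrees with a global homeomorphism on a large cap. -/
theorem widen [FiniteDimensional ℝ W] (hd : 2 ≤ Module.finrank ℝ W)
    (φ : OpenPartialHomeomorph ((W × ℝ) × ℝ) ((W × ℝ) × ℝ))
    (ε μ ν : ℝ) (hε : 0 < ε) (hμ : 1 < μ) (hν : 1 < ν)
    (hsrc : ∀ w, 0 < rad w → |w.1.2| < ε * rad w → w ∈ φ.source)
    (heq : ∀ w, 0 < rad w → |w.1.2| < ε * rad w → φ (μ • w) = ν • φ w) :
    ∃ G : ((W × ℝ) × ℝ) ≃ₜ ((W × ℝ) × ℝ), ∃ R : ℝ, 1 ≤ R ∧ ∀ w, R ≤ rad w → - rad w / 2 ≤ w.2 →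
      |w.1.2| ≤ ε / 16 * rad w → G w = φ w := by
  have hle : ∀ w : (W × ℝ) × ℝ, w.2 ≤ rad w := fun w =>
    (le_abs_self _).trans (Real.abs_le_sqrt (by nlinarith [sq_nonneg ‖w.1.1‖]))
  have hd' : 3 ≤ Module.finrank ℝ (W × ℝ) := by
    rw [Module.finrank_prod, Module.finrank_self]; omega
  obtain ⟨G0, U, hU, hRU, hUs, hG0⟩ := straighten hd' φ ε μ ν hε hμ hν (by
      rintro ⟨a, t⟩ z hz h
      have h2 := hle ((a, t), z)
      refine hsrc _ (hz.trans_le h2) (((norm_snd_le (a, t)).trans_lt h).trans_le ?_)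
      exact mul_le_mul_of_nonneg_left h2 hε.le) (by
      rintro ⟨a, t⟩ z hz h
      have h2 := hle ((a, t), z)
      refine heq _ (hz.trans_le h2) (((norm_snd_le (a, t)).trans_lt h).trans_le ?_)
      exact mul_le_mul_of_nonneg_left h2 hε.le)
  obtain ⟨Q, hQid, hQ⟩ := cap_push (ε / 16) μ (by positivity) hμ.le U hU
    (fun z hz => hRU z (by nlinarith))
  have hμ0 : 0 < μ := by linarith
  have hArad : ∀ w : (W × ℝ) × ℝ, pA (hv w) ^ 2 ≤ rad w := fun w => by
    rw [(rad_AB w).1]; linarith [hle w]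
  let S : Set ((W × ℝ) × ℝ) := {w | 1 ≤ pA (hv w) ∧ |w.1.2| ≤ 8 * (ε / 16) * pA (hv w) ^ 2}
  have hSrad : ∀ w ∈ S, 1 ≤ rad w ∧ |w.1.2| ≤ ε / 2 * rad w := by
    rintro w ⟨h1, h2⟩
    have h3 := hArad w
    refine ⟨by nlinarith, h2.trans ?_⟩
    rw [show 8 * (ε / 16) = ε / 2 by ring]
    exact mul_le_mul_of_nonneg_left h3 (by positivity)
  have hpowsrc : ∀ (k : ℕ) w, 0 < rad w → |w.1.2| < ε * rad w →
      (0 < rad (μ ^ k • w) ∧ |(μ ^ k • w).1.2| < ε * rad (μ ^ k • w)) ∧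
      φ (μ ^ k • w) = ν ^ k • φ w := by
    intro k w h1 h2
    have hk : 0 < μ ^ k := by positivity
    have hx : ∀ k : ℕ, 0 < rad (μ ^ k • w) ∧ |(μ ^ k • w).1.2| < ε * rad (μ ^ k • w) := by
      intro k
      have hk : 0 < μ ^ k := by positivity
      rw [rad_smul _ hk.le]
      refine ⟨by positivity, ?_⟩
      simp only [Prod.smul_fst, Prod.smul_snd, smul_eq_mul, abs_mul, abs_of_pos hk]
      nlinarith
    refine ⟨hx k, ?_⟩
    induction k with
    | zero => simp
    | succ k ih =>
      rw [pow_succ', mul_smul, heq _ (hx k).1 (hx k).2, ih (by positivity), smul_smul, pow_succ']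
  have hne : ∀ w, 0 < rad w → |w.1.2| < ε * rad w → φ w ≠ 0 := by
    intro w h1 h2 h0
    have h3 : φ (μ • w) = φ w := by rw [heq w h1 h2, h0, smul_zero]
    have h4 := (hpowsrc 1 w h1 h2).1
    rw [pow_one] at h4
    have h5 := φ.injOn (hsrc _ h4.1 h4.2) (hsrc _ h1 h2) h3
    have h6 : rad (μ • w) = rad w := by rw [h5]
    rw [rad_smul _ hμ0.le] at h6
    nlinarith
  let K : Set ((W × ℝ) × ℝ) := {w | (1 ≤ rad w ∧ rad w ≤ μ) ∧ |w.1.2| ≤ ε / 2 * rad w}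
  have hKc : IsCompact K := by
    refine (isCompact_closedBall (0 : (W × ℝ) × ℝ) (μ + ε / 2 * μ)).of_isClosed_subset ?_ ?_
    · have r := rad_cont (W := W)
      have c1 : IsClosed {w : (W × ℝ) × ℝ | 1 ≤ rad w} := isClosed_le (by fun_prop) (by fun_prop)
      have c2 : IsClosed {w : (W × ℝ) × ℝ | rad w ≤ μ} := isClosed_le (by fun_prop) (by fun_prop)
      have c3 : IsClosed {w : (W × ℝ) × ℝ | |w.1.2| ≤ ε / 2 * rad w} :=
        isClosed_le (by fun_prop) (by fun_prop)
      exact (c1.inter c2).inter c3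
    · rintro w ⟨⟨h1, h2⟩, h3⟩
      rw [mem_closedBall_zero_iff, Prod.norm_def, Prod.norm_def]
      have e1 : ‖w.1.1‖ ≤ rad w := Real.le_sqrt_of_sq_le (by nlinarith [sq_nonneg w.2])
      have e2 : |w.2| ≤ rad w := Real.abs_le_sqrt (by nlinarith [sq_nonneg ‖w.1.1‖])
      have e3 : ε / 2 * rad w ≤ ε / 2 * μ := by gcongr
      have e4 : 0 ≤ ε / 2 * μ := by positivity
      refine max_le (max_le (by linarith) ?_) ?_
      · rw [Real.norm_eq_abs]; linarith
      · rw [Real.norm_eq_abs]; linarith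
  have hKin : ∀ w ∈ K, 0 < rad w ∧ |w.1.2| < ε * rad w := by
    rintro w ⟨⟨h1, h2⟩, h3⟩
    exact ⟨by linarith, by nlinarith⟩
  have hcl : IsClosed (φ '' S) := by
    refine closed_image φ K hKc (fun w hw => hsrc w (hKin w hw).1 (hKin w hw).2)
      (fun w hw => hne w (hKin w hw).1 (hKin w hw).2) ν hν (fun k w => μ ^ k • w)
      (fun k => by fun_prop) (fun k w hw => ?_) S ?_ ?_
    · have := hpowsrc k w (hKin w hw).1 (hKin w hw).2
      exact ⟨hsrc _ this.1.1 this.1.2, this.2⟩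
    · have r : Continuous fun w : (W × ℝ) × ℝ => pA (hv w) := pA_cont.comp hv_cont
      have c1 : IsClosed {w : (W × ℝ) × ℝ | 1 ≤ pA (hv w)} := isClosed_le (by fun_prop) (by fun_prop)
      have c3 : IsClosed {w : (W × ℝ) × ℝ | |w.1.2| ≤ 8 * (ε / 16) * pA (hv w) ^ 2} :=
        isClosed_le (by fun_prop) (by fun_prop)
      exact c1.inter c3
    · intro w hw
      obtain ⟨h1, h2⟩ := hSrad w hw
      obtain ⟨k, hk1, hk2⟩ := exists_nat_pow_near h1 hμ
      have hk : 0 < μ ^ k := by positivity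
      refine ⟨k, (μ ^ k)⁻¹ • w, ?_, by rw [smul_smul, mul_inv_cancel₀ hk.ne', one_smul]⟩
      have hi : 0 < (μ ^ k)⁻¹ := by positivity
      refine ⟨⟨?_, ?_⟩, ?_⟩
      · rw [rad_smul _ hi.le, inv_mul_eq_div, le_div_iff₀ hk]; linarith
      · rw [rad_smul _ hi.le, inv_mul_eq_div, div_le_iff₀ hk]
        rw [pow_succ'] at hk2; exact hk2.le
      · rw [rad_smul _ hi.le]
        simp only [Prod.smul_fst, Prod.smul_snd, smul_eq_mul, abs_mul, abs_of_pos hi]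
        nlinarith
  obtain ⟨H, hH, -⟩ := ext_lemma φ Q S (fun w hw => by
      obtain ⟨h1, h2⟩ := hSrad w hw
      exact hsrc w (by linarith) (by nlinarith)) (fun w hw => hQid w (fun h => hw ⟨hμ.le.trans h.1, h.2⟩))
      hcl
  refine ⟨Q.trans (G0.trans H.symm), 4 * (μ + 1) ^ 2, by nlinarith, ?_⟩
  intro w h1 h2 h3
  have hr : 0 < rad w := by nlinarith
  have hA := (rad_AB w).1
  have hB := (rad_AB w).2
  have hA0 := pA_nonneg (hv w)
  have hB0 := pB_nonneg (hv w)
  have hQU := hQ w (by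
    refine (sq_le_sq₀ (by linarith) hA0).1 ?_
    rw [hA]; linarith) (by
    refine h3.trans ?_
    rw [hA]; nlinarith) (by
    refine (sq_le_sq₀ hB0 (by linarith)).1 ?_
    rw [mul_pow, hA, hB]; linarith)
  have hws : w ∈ φ.source := hsrc w hr (by nlinarith)
  simp only [Homeomorph.trans_apply]
  rw [Homeomorph.symm_apply_eq, hH w hws, hG0 _ hQU]

end

open Filter Topology

/-- A self-homeomorphism of `ℝ` with prescribed values `a k` at `k : ℕ`. -/
theorem exists_profile (a : ℕ → ℝ) (ha : ∀ k, a k + 1 ≤ a (k+1)) :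
    ∃ L : ℝ ≃ₜ ℝ, StrictMono L ∧ ∀ k : ℕ, L k = a k := by
  let d : ℕ → ℝ := fun k => a (k+1) - a k - 1
  have hd : ∀ k, 0 ≤ d k := fun k => by have := ha k; simp only [d]; linarith
  let cl : ℝ → ℝ := fun v => max 0 (min v 1)
  have clc : Continuous cl := by fun_prop
  have clm : Monotone cl := fun x y h => max_le_max le_rfl (min_le_min h le_rfl)
  let F : ℕ → ℝ → ℝ := fun N s => s + a 0 + ∑ k ∈ Finset.range N, d k * cl (s - k)
  let L : ℝ → ℝ := fun s => F ⌈s⌉₊ s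
  have hF : ∀ (N : ℕ) (s : ℝ), s ≤ N → L s = F N s := by
    intro N s hs
    have h1 : ⌈s⌉₊ ≤ N := Nat.ceil_le.2 hs
    simp only [L, F]
    congr 1
    apply Finset.sum_subset (Finset.range_mono h1)
    intro k _ hk
    have : ⌈s⌉₊ ≤ k := by simpa using hk
    have : s ≤ k := Nat.ceil_le.1 this
    have : cl (s - k) = 0 := by
      simp only [cl]; apply max_eq_left; exact (min_le_left _ _).trans (by linarith)
    rw [this, mul_zero]
  have hcont : Continuous L := by
    rw [continuous_iff_continuousAt]
    intro s
    obtain ⟨N, hN⟩ := exists_nat_gt s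
    have h1 : L =ᶠ[𝓝 s] F N := by
      filter_upwards [Iio_mem_nhds hN] with x hx
      exact hF N x (le_of_lt hx)
    have h2 : Continuous (F N) := by
      simp only [F]; fun_prop
    exact h2.continuousAt.congr h1.symm
  have hmono : StrictMono L := by
    intro x y hxy
    obtain ⟨N, hN⟩ := exists_nat_gt y
    rw [hF N x (by linarith), hF N y hN.le]
    have : ∑ k ∈ Finset.range N, d k * cl (x - k) ≤ ∑ k ∈ Finset.range N, d k * cl (y - k) :=
      Finset.sum_le_sum fun k _ => mul_le_mul_of_nonneg_left (clm (by linarith)) (hd k)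
    simp only [F]; linarith
  have hge : ∀ s, s + a 0 ≤ L s := by
    intro s
    have : 0 ≤ ∑ k ∈ Finset.range ⌈s⌉₊, d k * cl (s - k) :=
      Finset.sum_nonneg fun k _ => mul_nonneg (hd k) (le_max_left _ _)
    simp only [L, F]; linarith
  have hle : ∀ s, s ≤ 0 → L s = s + a 0 := by
    intro s hs
    rw [hF 0 s (by simpa using hs)]; simp [F]
  have hsurj : Function.Surjective L := by
    refine hcont.surjective ?_ ?_
    · exact tendsto_atTop_mono hge (tendsto_atTop_add_const_right _ _ tendsto_id)
    · refine Tendsto.congr' ?_ (tendsto_atBot_add_const_right _ (a 0) tendsto_id)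
      filter_upwards [eventually_le_atBot 0] with s hs
      exact (hle s hs).symm
  have hval : ∀ k : ℕ, F k k = a k := by
    intro k
    have h1 : ∀ j ∈ Finset.range k, d j * cl ((k:ℝ) - j) = a (j+1) - a j - 1 := by
      intro j hj
      have : (j:ℝ) + 1 ≤ k := by exact_mod_cast Finset.mem_range.1 hj
      have : cl ((k:ℝ) - j) = 1 := by
        simp only [cl]; rw [min_eq_right (by linarith)]; norm_num
      rw [this, mul_one]
    simp only [F]
    rw [Finset.sum_congr rfl h1, Finset.sum_sub_distrib, Finset.sum_range_sub]
    simp; ring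
  refine ⟨(hmono.orderIsoOfSurjective L hsurj).toHomeomorph, hmono, fun k => ?_⟩
  exact (hF k k le_rfl).trans (hval k)

/-- global logarithm -/
theorem exists_log_lift {E : Type*} [NormedAddCommGroup E] [NormedSpace ℝ E] (F : E → ℂ)
    (hF : Continuous F) (h0 : ∀ x, F x ≠ 0) :
    ∃ l : E → ℂ, Continuous l ∧ ∀ x, Complex.exp (l x) = F x := by
  have hs : IsSimplyConnected (Set.univ : Set E) := by
    rw [IsSimplyConnected]
    have : ContractibleSpace (Set.univ : Set E) := 
      (convex_univ : Convex ℝ (Set.univ : Set E)).contractibleSpace Set.univ_nonempty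
    infer_instance
  obtain ⟨l, hl, he⟩ := Complex.exists_continuousOn_eqOn_exp_comp (g := F) hs isOpen_univ
    hF.continuousOn (by rintro ⟨x, -, hx⟩; exact h0 x hx)
  exact ⟨l, continuousOn_univ.1 hl, fun x => he (Set.mem_univ x)⟩

section Book
variable {W : Type*} [NormedAddCommGroup W] [NormedSpace ℝ W]

/-- bounds of the radial displacement of `θ` in the coordinate given by `L` -/
def RadOK (L : ℝ ≃ₜ ℝ) (θ : W × ℂ → W × ℂ) : Prop :=
  ∀ w, L 2 ≤ ‖w.2‖ → L 0 ≤ ‖(θ w).2‖ ∧ |L.symm ‖(θ w).2‖ - L.symm ‖w.2‖| ≤ 2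

/-- `θ` is the identity near the core -/
def CoreId (R B : ℝ) (θ : W × ℂ → W × ℂ) : Prop :=
  ∀ w, R ≤ ‖w.1‖ → B * ‖w.2‖ ≤ ‖w.1‖ → θ w = w

theorem exists_radial [FiniteDimensional ℝ W] (θ : (W × ℂ) ≃ₜ (W × ℂ)) (R B : ℝ) (hB : 1 ≤ B)
    (hid : CoreId R B θ) :
    ∃ L : ℝ ≃ₜ ℝ, StrictMono L ∧ R ≤ L 0 ∧ 0 < L 0 ∧ RadOK L θ ∧ RadOK L θ.symm := by
  have hid' : CoreId R B θ.symm := fun w h1 h2 => by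
    rw [Homeomorph.symm_apply_eq]; exact (hid w h1 h2).symm
  have hm : ∀ r : ℝ, ∃ m : ℝ, ∀ w : W × ℂ, ‖w.1‖ ≤ B * r → ‖w.2‖ ≤ r →
      ‖(θ w).2‖ ≤ m ∧ ‖(θ.symm w).2‖ ≤ m := by
    intro r
    have : ProperSpace W := FiniteDimensional.proper ℝ W
    have hK : IsCompact (Metric.closedBall (0:W) (B * r) ×ˢ Metric.closedBall (0:ℂ) r) :=
      (isCompact_closedBall _ _).prod (isCompact_closedBall _ _)
    obtain ⟨m1, h1⟩ := hK.exists_bound_of_continuousOn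
      (f := fun w : W × ℂ => (θ w).2) (by fun_prop)
    obtain ⟨m2, h2⟩ := hK.exists_bound_of_continuousOn
      (f := fun w : W × ℂ => (θ.symm w).2) (by fun_prop)
    refine ⟨max m1 m2, fun w ha hb => ⟨?_, ?_⟩⟩
    · exact (h1 w ⟨by simpa using ha, by simpa using hb⟩).trans (le_max_left _ _)
    · exact (h2 w ⟨by simpa using ha, by simpa using hb⟩).trans (le_max_right _ _)
  choose m hm using hm
  let a : ℕ → ℝ := fun k => Nat.rec (max R 1) (fun _ r => max (r + 1) (m r)) k
  have ha0 : a 0 = max R 1 := rfl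
  have has : ∀ k, a (k+1) = max (a k + 1) (m (a k)) := fun k => rfl
  have ha1 : ∀ k, a k + 1 ≤ a (k+1) := fun k => by rw [has]; exact le_max_left _ _
  clear_value a
  obtain ⟨L, hL, hLk⟩ := exists_profile a ha1
  have hL0 : L 0 = max R 1 := by have := hLk 0; simpa [ha0] using this
  have hR0 : ∀ k, max R 1 ≤ a k := by
    intro k; induction k with
    | zero => exact ha0.ge
    | succ k ih => have := ha1 k; linarith
  -- basic step
  have step : ∀ ψ : W × ℂ → W × ℂ, CoreId R B ψ →
      (∀ r w, ‖w.1‖ ≤ B * r → ‖w.2‖ ≤ r → ‖(ψ w).2‖ ≤ m r) →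
      ∀ (k : ℕ) w, ‖w.2‖ ≤ a k → ‖(ψ w).2‖ ≤ a (k+1) := by
    intro ψ hψ hψm k w hw
    by_cases h : ‖w.1‖ ≤ B * a k
    · exact (hψm _ w h hw).trans (by rw [has]; exact le_max_right _ _)
    · push Not at h
      have h3 := hR0 k
      have h1 : (1:ℝ) ≤ a k := (le_max_right _ _).trans h3
      have h2 : R ≤ a k := (le_max_left _ _).trans h3
      rw [hψ w (by nlinarith) (by nlinarith)]
      have := ha1 k; linarith
  have fin : ∀ ψ ψ' : W × ℂ → W × ℂ, (∀ w, ψ' (ψ w) = w) →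
      (∀ (k : ℕ) w, ‖w.2‖ ≤ a k → ‖(ψ w).2‖ ≤ a (k+1)) →
      (∀ (k : ℕ) w, ‖w.2‖ ≤ a k → ‖(ψ' w).2‖ ≤ a (k+1)) → RadOK L ψ := by
    intro ψ ψ' hinv h1 h2 w hw
    have hmS : StrictMono L.symm := by
      intro x y hxy
      rw [← hL.lt_iff_lt]; simpa using hxy
    have key : ∀ (χ : W × ℂ → W × ℂ), (∀ (k : ℕ) w, ‖w.2‖ ≤ a k → ‖(χ w).2‖ ≤ a (k+1)) →
        ∀ v, L 0 ≤ ‖v.2‖ → L.symm ‖(χ v).2‖ ≤ L.symm ‖v.2‖ + 2 := by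
      intro χ hχ v hv
      have h0 : 0 ≤ L.symm ‖v.2‖ := by
        rw [← hL.le_iff_le]; simpa using hv
      have h3 := Nat.floor_le h0
      have h4 := Nat.lt_floor_add_one (L.symm ‖v.2‖)
      generalize ⌊L.symm ‖v.2‖⌋₊ = k at h3 h4
      have h5 : ‖v.2‖ ≤ a (k+1) := by
        rw [← hLk, ← L.apply_symm_apply ‖v.2‖, hL.le_iff_le]
        push_cast; linarith
      have h6 := hχ _ _ h5
      have : L.symm ‖(χ v).2‖ ≤ ((k + 1 + 1 : ℕ) : ℝ) := by
        rw [← hL.le_iff_le, hLk]; simpa using h6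
      push_cast at this; linarith
    have g0 : L 0 ≤ ‖(ψ w).2‖ := by
      by_contra hcon
      push Not at hcon
      have h0 : L 0 = a 0 := by simpa using hLk 0
      have := h2 0 (ψ w) (by rw [← h0]; exact hcon.le)
      rw [hinv] at this
      have h3 : L 1 = a 1 := by simpa using hLk 1
      have h4 : L 1 < L 2 := hL (by norm_num)
      simp only [zero_add] at this
      linarith
    refine ⟨g0, ?_⟩
    have k1 := key ψ h1 w ((hL.monotone (by norm_num)).trans hw)
    have k2 := key ψ' h2 (ψ w) g0
    rw [hinv] at k2
    rw [abs_le]; constructor <;> linarith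
  have s1 := step θ hid fun r w h1 h2 => (hm r w h1 h2).1
  have s2 := step θ.symm hid' fun r w h1 h2 => (hm r w h1 h2).2
  refine ⟨L, hL, ?_, ?_, fin _ _ (fun w => by simp) s1 s2, fin _ _ (fun w => by simp) s2 s1⟩
  · rw [hL0]; exact le_max_left _ _
  · rw [hL0]; exact lt_of_lt_of_le one_pos (le_max_right _ _)

end Book

open Filter Topology

theorem int_const {X : Type*} [TopologicalSpace X] {A : Set X} (hA : IsPreconnected A) {f : X → ℝ}
    (hf : ContinuousOn f A) (hIsInt : ∀ x ∈ A, ∃ n : ℤ, f x = n) :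
    ∀ x ∈ A, ∀ y ∈ A, f x = f y := by
  have key : ∀ x ∈ A, ∀ y ∈ A, ¬ f x < f y := by
    intro x hx y hy h
    have ho := (hA.image f hf).ordConnected
    obtain ⟨n, hn⟩ := hIsInt x hx
    obtain ⟨m, hm⟩ := hIsInt y hy
    have h1 : n + 1 ≤ m := by rw [hn, hm] at h; exact_mod_cast h
    have h2 : (n:ℝ) + 1 ≤ m := by exact_mod_cast h1
    obtain ⟨z, hz, hz'⟩ := ho.out ⟨x, hx, rfl⟩ ⟨y, hy, rfl⟩ (show f x + 1/2 ∈ Set.Icc (f x) (f y) by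
      constructor <;> linarith)
    obtain ⟨l, hl⟩ := hIsInt z hz
    rw [hl, hn] at hz'
    have h3 : (2 * l : ℝ) = 2 * n + 1 := by linarith
    have h4 : 2 * l = 2 * n + 1 := by exact_mod_cast h3
    omega
  intro x hx y hy
  exact le_antisymm (not_lt.1 (key y hy x hx)) (not_lt.1 (key x hx y hy))

/-- a continuous function on a preconnected set which avoids `c` stays on one side of it -/
theorem lt_of_avoid {X : Type*} [TopologicalSpace X] {A : Set X} (hA : IsPreconnected A) {f : X → ℝ}
    (hf : ContinuousOn f A) (c : ℝ) (hav : ∀ x ∈ A, f x ≠ c) {x₀ : X} (hx₀ : x₀ ∈ A) (h0 : f x₀ < c)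
    {x : X} (hx : x ∈ A) : f x < c := by
  by_contra hcon
  push Not at hcon
  obtain ⟨z, hz, hz'⟩ := (hA.image f hf).ordConnected.out ⟨x₀, hx₀, rfl⟩ ⟨x, hx, rfl⟩ ⟨h0.le, hcon⟩
  exact hav z hz hz'

theorem gt_of_avoid {X : Type*} [TopologicalSpace X] {A : Set X} (hA : IsPreconnected A) {f : X → ℝ}
    (hf : ContinuousOn f A) (c : ℝ) (hav : ∀ x ∈ A, f x ≠ c) {x₀ : X} (hx₀ : x₀ ∈ A) (h0 : c < f x₀)
    {x : X} (hx : x ∈ A) : c < f x := by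
  by_contra hcon
  push Not at hcon
  obtain ⟨z, hz, hz'⟩ := (hA.image f hf).ordConnected.out ⟨x, hx, rfl⟩ ⟨x₀, hx₀, rfl⟩ ⟨hcon, h0.le⟩
  exact hav z hz hz'

section Lift
variable {W : Type*} [NormedAddCommGroup W] [NormedSpace ℝ W]

/-- covering coordinates of the complement of the core -/
noncomputable def bk (L : ℝ ≃ₜ ℝ) (p : (W × ℝ) × ℝ) : W × ℂ :=
  (L p.1.2 • p.1.1, (L p.1.2 : ℂ) * Complex.exp ((2 * Real.pi * p.2 : ℝ) * Complex.I))

theorem bk_cont (L : ℝ ≃ₜ ℝ) : Continuous (bk L : (W × ℝ) × ℝ → W × ℂ) := by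
  unfold bk; fun_prop

theorem bk_norm (L : ℝ ≃ₜ ℝ) (p : (W × ℝ) × ℝ) (h : 0 ≤ L p.1.2) : ‖(bk L p).2‖ = L p.1.2 := by
  simp only [bk]
  rw [norm_mul, Complex.norm_exp_ofReal_mul_I, mul_one, Complex.norm_real, Real.norm_of_nonneg h]

theorem exp_eq_exp_turn {x y : ℝ} (h : Complex.exp ((2 * Real.pi * x : ℝ) * Complex.I) =
    Complex.exp ((2 * Real.pi * y : ℝ) * Complex.I)) : ∃ n : ℤ, x - y = n := by
  obtain ⟨n, hn⟩ := Complex.exp_eq_exp_iff_exists_int.1 h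
  refine ⟨n, ?_⟩
  have hI : (2 * Real.pi * Complex.I : ℂ) ≠ 0 := Complex.two_pi_I_ne_zero
  have : ((x - y - n : ℝ) : ℂ) * (2 * Real.pi * Complex.I) = 0 := by
    push_cast at hn ⊢; linear_combination hn
  rcases mul_eq_zero.1 this with h | h
  · have : x - y - n = 0 := by exact_mod_cast h
    linarith
  · exact absurd h hI

theorem bk_inj (L : ℝ ≃ₜ ℝ) (p p' : (W × ℝ) × ℝ) (h : 0 < L p.1.2) (h' : 0 < L p'.1.2)
    (he : bk L p = bk L p') : p.1 = p'.1 ∧ ∃ n : ℤ, p.2 - p'.2 = n := by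
  have h1 : L p.1.2 = L p'.1.2 := by
    rw [← bk_norm L p h.le, ← bk_norm L p' h'.le, he]
  have hs : p.1.2 = p'.1.2 := L.injective h1
  have ha : (bk L p).1 = (bk L p').1 := by rw [he]
  have hz : (bk L p).2 = (bk L p').2 := by rw [he]
  simp only [bk] at ha hz
  rw [← h1] at ha hz
  refine ⟨Prod.ext (smul_right_injective W h.ne' ha) hs, ?_⟩
  exact exp_eq_exp_turn (mul_left_cancel₀ (by exact_mod_cast h.ne') hz)

theorem bk_int (L : ℝ ≃ₜ ℝ) (p : (W × ℝ) × ℝ) (k : ℤ) (h : p.2 = k) :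
    (bk L p).2 = (L p.1.2 : ℂ) := by
  have : Complex.exp ((2 * Real.pi * p.2 : ℝ) * Complex.I) = 1 := by
    rw [Complex.exp_eq_one_iff]; exact ⟨k, by rw [h]; push_cast; ring⟩
  simp only [bk, this, mul_one]

theorem bk_half (L : ℝ ≃ₜ ℝ) (p : (W × ℝ) × ℝ) (k : ℤ) (h : p.2 = k + 1/2) :
    (bk L p).2 = -(L p.1.2 : ℂ) := by
  have : Complex.exp ((2 * Real.pi * p.2 : ℝ) * Complex.I) = -1 := by
    rw [← Complex.exp_pi_mul_I, Complex.exp_eq_exp_iff_exists_int]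
    exact ⟨k, by rw [h]; push_cast; ring⟩
  simp only [bk, this]; ring

/-- the part `‖b‖ ≥ B` is connected -/
theorem big_conn [FiniteDimensional ℝ W] (hd : 2 ≤ Module.finrank ℝ W) (B : ℝ) (hB : 0 < B) :
    IsConnected {b : W | B ≤ ‖b‖} := by
  have h1 : IsConnected ({0}ᶜ : Set W) := by
    apply isConnected_compl_singleton_of_one_lt_rank
    rw [← Module.finrank_eq_rank]; exact_mod_cast hd
  have h2 : {b : W | B ≤ ‖b‖} = (fun b : W => max 1 (B / ‖b‖) • b) '' ({0}ᶜ : Set W) := by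
    ext b; constructor
    · intro hb
      have hb0 : b ≠ 0 := by rintro rfl; simp at hb; linarith
      refine ⟨b, hb0, ?_⟩
      have : B / ‖b‖ ≤ 1 := by rw [div_le_one (norm_pos_iff.2 hb0)]; exact hb
      simp only; rw [max_eq_left this, one_smul]
    · rintro ⟨c, hc, rfl⟩
      have hc0 : 0 < ‖c‖ := norm_pos_iff.2 hc
      change B ≤ ‖_‖
      rw [norm_smul, Real.norm_of_nonneg (by positivity)]
      calc B = B / ‖c‖ * ‖c‖ := by field_simp
        _ ≤ _ := by gcongr; exact le_max_right _ _
  rw [h2]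
  refine h1.image _ ?_
  intro c hc
  have hc0 : ‖c‖ ≠ 0 := norm_ne_zero_iff.2 hc
  apply ContinuousAt.continuousWithinAt
  fun_prop (disch := assumption)

/-- `g` lifts `θ` through `bk` for `s ≥ 2` -/
def IsLift (L : ℝ ≃ₜ ℝ) (B : ℝ) (θ : W × ℂ → W × ℂ) (g : (W × ℝ) × ℝ → (W × ℝ) × ℝ) : Prop :=
  Continuous g ∧ ∀ p : (W × ℝ) × ℝ, 2 ≤ p.1.2 → bk L (g p) = θ (bk L p) ∧ 0 ≤ (g p).1.2 ∧
    |(g p).1.2 - p.1.2| ≤ 2 ∧ (B ≤ ‖p.1.1‖ → g p = p)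

theorem exists_lift [FiniteDimensional ℝ W] (hd : 2 ≤ Module.finrank ℝ W) (L : ℝ ≃ₜ ℝ)
    (hL : StrictMono L) (R B : ℝ) (hB : 1 ≤ B) (hR : R ≤ L 0) (hL0 : 0 < L 0)
    (θ : W × ℂ → W × ℂ) (hθ : Continuous θ) (hid : CoreId R B θ) (hrad : RadOK L θ) :
    ∃ g, IsLift L B θ g := by
  let st : (W × ℝ) × ℝ → (W × ℝ) × ℝ := fun p => ((p.1.1, max p.1.2 2), p.2)
  have stc : Continuous st := by fun_prop
  let T : (W × ℝ) × ℝ → W × ℂ := fun p => θ (bk L (st p))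
  have Tc : Continuous T := hθ.comp ((bk_cont L).comp stc)
  have hpos : ∀ s, 0 ≤ s → 0 < L s := fun s hs => hL0.trans_le (hL.monotone hs)
  have hst : ∀ p, 2 ≤ (st p).1.2 := fun p => le_max_right _ _
  have hnorm : ∀ p, ‖(bk L (st p)).2‖ = L (st p).1.2 := fun p =>
    bk_norm L _ (hpos _ (by linarith [hst p])).le
  have hr : ∀ p, L 0 ≤ ‖(T p).2‖ ∧ |L.symm ‖(T p).2‖ - (st p).1.2| ≤ 2 := by
    intro p
    have := hrad (bk L (st p)) (by rw [hnorm]; exact hL.monotone (hst p))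
    rw [hnorm, L.symm_apply_apply] at this
    exact this
  have hne : ∀ p, (T p).2 ≠ 0 := fun p h => by
    have := (hr p).1; rw [h, norm_zero] at this; linarith
  obtain ⟨l, hlc, hl⟩ := exists_log_lift (fun p => (T p).2) (by fun_prop) hne
  have hln : ∀ p, (T p).2 = (‖(T p).2‖ : ℂ) * Complex.exp ((l p).im * Complex.I) := by
    intro p
    have h1 : ‖(T p).2‖ = Real.exp (l p).re := by rw [← hl p, Complex.norm_exp]
    rw [h1, Complex.ofReal_exp, ← Complex.exp_add, Complex.re_add_im, hl p]
  let v : (W × ℝ) × ℝ → ℝ := fun p => (l p).im / (2 * Real.pi)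
  have hv : ∀ p, (T p).2 = (‖(T p).2‖ : ℂ) * Complex.exp ((2 * Real.pi * v p : ℝ) * Complex.I) := by
    intro p
    have : 2 * Real.pi * v p = (l p).im := by simp only [v]; field_simp
    rw [this]; exact hln p
  have vc : Continuous v := by
    have : Continuous fun p => (l p).im := Complex.continuous_im.comp hlc
    fun_prop
  have hT : ∀ p, B ≤ ‖p.1.1‖ → T p = bk L (st p) := by
    intro p hp
    have h2 := hpos (st p).1.2 (by linarith [hst p])
    have h3 : ‖(bk L (st p)).1‖ = L (st p).1.2 * ‖p.1.1‖ := by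
      simp only [bk, norm_smul, Real.norm_of_nonneg h2.le]; rfl
    have h4 : L 0 ≤ L (st p).1.2 := hL.monotone (by linarith [hst p])
    apply hid
    · rw [h3]; nlinarith
    · rw [h3, hnorm, mul_comm]; gcongr
  have hIsInt : ∀ p ∈ {p : (W × ℝ) × ℝ | B ≤ ‖p.1.1‖}, ∃ n : ℤ, v p - p.2 = n := by
    intro p hp
    have h1 := hv p
    have h2 := hpos (st p).1.2 (by linarith [hst p])
    rw [hT p hp, hnorm] at h1
    apply exp_eq_exp_turn
    exact (mul_left_cancel₀ (by exact_mod_cast h2.ne') h1).symm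
  have hcon : IsConnected {p : (W × ℝ) × ℝ | B ≤ ‖p.1.1‖} := by
    have := ((big_conn hd B (by linarith)).prod (isConnected_univ (α := ℝ))).prod
      (isConnected_univ (α := ℝ))
    convert this using 1
    ext p; simp
  obtain ⟨p₀, hp₀⟩ := hcon.nonempty
  obtain ⟨c, hc⟩ := hIsInt p₀ hp₀
  have hcst : ∀ p, B ≤ ‖p.1.1‖ → v p - p.2 = c := fun p hp => by
    rw [← hc]
    exact int_const hcon.isPreconnected (f := fun p => v p - p.2) (by fun_prop) hIsInt p hp p₀ hp₀
  have nc : Continuous fun p => ‖(T p).2‖ := by fun_prop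
  have nn : ∀ p, ‖(T p).2‖ ≠ 0 := fun p => norm_ne_zero_iff.2 (hne p)
  refine ⟨fun p => ((‖(T p).2‖⁻¹ • (T p).1, L.symm ‖(T p).2‖), v p - c), ?_, ?_⟩
  · have h1 : Continuous fun p => ‖(T p).2‖⁻¹ := nc.inv₀ nn
    fun_prop
  · intro p hp
    have hsp : st p = p := by simp only [st, max_eq_left hp]
    refine ⟨?_, ?_, ?_, ?_⟩
    · have : θ (bk L p) = T p := by simp only [T, hsp]
      rw [this]
      simp only [bk, L.apply_symm_apply, smul_smul, mul_inv_cancel₀ (nn p), one_smul]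
      refine Prod.ext rfl ?_
      simp only
      conv_rhs => rw [hv p]
      congr 1
      rw [Complex.exp_eq_exp_iff_exists_int]
      exact ⟨-c, by push_cast; ring⟩
    · have := (hr p).1
      simp only
      rw [← hL.le_iff_le]; simpa using this
    · have := (hr p).2; rwa [hsp] at this
    · intro hb
      have h2 := hpos p.1.2 (by linarith)
      have h3 := hT p hb
      rw [hsp] at h3
      simp only
      rw [h3, bk_norm L p h2.le, L.symm_apply_apply]
      refine Prod.ext (Prod.ext ?_ rfl) ?_
      · simp only [bk, smul_smul, inv_mul_cancel₀ h2.ne', one_smul]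
      · have := hcst p hb; simp only; linarith

/-- the package used for the compression -/
structure LiftPair (B s0 : ℝ) (g g' : (W × ℝ) × ℝ → (W × ℝ) × ℝ) : Prop where
  cont : Continuous g
  cont' : Continuous g'
  inv : ∀ p, s0 ≤ p.1.2 → g' (g p) = p
  inv' : ∀ p, s0 ≤ p.1.2 → g (g' p) = p
  ds : ∀ p, s0 ≤ p.1.2 → |(g p).1.2 - p.1.2| ≤ 2
  ds' : ∀ p, s0 ≤ p.1.2 → |(g' p).1.2 - p.1.2| ≤ 2
  du : ∀ p, s0 ≤ p.1.2 → |(g p).2 - p.2| ≤ 3/2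
  du' : ∀ p, s0 ≤ p.1.2 → |(g' p).2 - p.2| ≤ 3/2
  id : ∀ p, s0 ≤ p.1.2 → B ≤ ‖p.1.1‖ → g p = p
  id' : ∀ p, s0 ≤ p.1.2 → B ≤ ‖p.1.1‖ → g' p = p
  bd : ∀ p, s0 ≤ p.1.2 → ‖p.1.1‖ < B → ‖(g p).1.1‖ < B
  bd' : ∀ p, s0 ≤ p.1.2 → ‖p.1.1‖ < B → ‖(g' p).1.1‖ < B
  half : ∀ p, s0 ≤ p.1.2 → p.2 = 1/2 → 0 < (g p).2 ∧ (g p).2 < 1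
  zero' : ∀ p, s0 ≤ p.1.2 → p.2 = 0 → (g' p).2 ≠ 1/2
  one' : ∀ p, s0 ≤ p.1.2 → p.2 = 1 → (g' p).2 ≠ 1/2

theorem lift_inv (L : ℝ ≃ₜ ℝ)
    (hL : StrictMono L) (B : ℝ) (hL0 : 0 < L 0) (b1 : W) (hb1 : B ≤ ‖b1‖)
    (θ θ' : W × ℂ → W × ℂ) (hinv : ∀ w, θ' (θ w) = w) (g g' : (W × ℝ) × ℝ → (W × ℝ) × ℝ)
    (hg : IsLift L B θ g) (hg' : IsLift L B θ' g') :
    ∀ p : (W × ℝ) × ℝ, 4 ≤ p.1.2 → g' (g p) = p := by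
  have hpos : ∀ s, 0 ≤ s → 0 < L s := fun s hs => hL0.trans_le (hL.monotone hs)
  have key : ∀ p : (W × ℝ) × ℝ, 4 ≤ p.1.2 → (g' (g p)).1 = p.1 ∧ ∃ n : ℤ, (g' (g p)).2 - p.2 = n := by
    intro p hp
    obtain ⟨h1, h2, h3, -⟩ := hg.2 p (by linarith)
    have h4 : 2 ≤ (g p).1.2 := by have := (abs_le.1 h3).1; linarith
    obtain ⟨h5, h6, h7, -⟩ := hg'.2 (g p) h4
    apply bk_inj L _ _ (hpos _ h6) (hpos _ (by linarith))
    rw [h5, h1, hinv]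
  have hc : IsPreconnected {p : (W × ℝ) × ℝ | 4 ≤ p.1.2} := by
    have : IsPreconnected ((Set.univ (α := W) ×ˢ Set.Ici (4:ℝ)) ×ˢ (Set.univ (α := ℝ))) :=
      (isPreconnected_univ.prod isPreconnected_Ici).prod isPreconnected_univ
    convert this using 1
    ext p; simp
  intro p hp
  have hcc : Continuous fun p => (g' (g p)).2 - p.2 := by
    have := hg.1; have := hg'.1; fun_prop
  have := int_const hc (f := fun p => (g' (g p)).2 - p.2) hcc.continuousOn
    (fun p hp => (key p hp).2) p hp ((b1, 4), 0) (by simp)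
  have e1 : g ((b1, 4), 0) = ((b1, 4), 0) := (hg.2 _ (by norm_num)).2.2.2 hb1
  have e2 : g' ((b1, 4), 0) = ((b1, 4), 0) := (hg'.2 _ (by norm_num)).2.2.2 hb1
  simp only [e1, e2, sub_self] at this
  exact Prod.ext (key p hp).1 (by linarith)

end Lift

open Filter Topology

section Pair
variable {W : Type*} [NormedAddCommGroup W] [NormedSpace ℝ W]

/-- far from the core, `θ` does not map the page `u = 1/2` to the page `u = 0` -/
def Avoid (R : ℝ) (θ : W × ℂ → W × ℂ) : Prop :=
  ∀ w, ∀ r r' : ℝ, R ≤ r → R ≤ r' → 0 < r → 0 < r' → w.2 = -(r : ℂ) → (θ w).2 ≠ (r' : ℂ)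

theorem slab_conn (A : Set ℝ) (hA : IsPreconnected A) (s0 : ℝ) :
    IsPreconnected {p : (W × ℝ) × ℝ | s0 ≤ p.1.2 ∧ p.2 ∈ A} := by
  have : IsPreconnected ((Set.univ (α := W) ×ˢ Set.Ici s0) ×ˢ A) :=
    (isPreconnected_univ.prod isPreconnected_Ici).prod hA
  convert this using 1
  ext p; simp

theorem exists_liftPair [FiniteDimensional ℝ W] (hd : 2 ≤ Module.finrank ℝ W) (L : ℝ ≃ₜ ℝ)
    (hL : StrictMono L) (R B : ℝ) (hB : 1 ≤ B) (hR : R ≤ L 0) (hL0 : 0 < L 0)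
    (θ : (W × ℂ) ≃ₜ (W × ℂ)) (hid : CoreId R B θ) (hrad : RadOK L θ) (hrad' : RadOK L θ.symm)
    (hav : Avoid R θ) :
    ∃ g g' : (W × ℝ) × ℝ → (W × ℝ) × ℝ, LiftPair B 6 g g' ∧ IsLift L B θ g ∧
      IsLift L B θ.symm g' := by
  have hid' : CoreId R B θ.symm := fun w h1 h2 => by
    rw [Homeomorph.symm_apply_eq]; exact (hid w h1 h2).symm
  have hpos : ∀ s, 0 ≤ s → 0 < L s := fun s hs => hL0.trans_le (hL.monotone hs)
  have hRL : ∀ s, 0 ≤ s → R ≤ L s := fun s hs => hR.trans (hL.monotone hs)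
  obtain ⟨g, hg⟩ := exists_lift hd L hL R B hB hR hL0 θ θ.continuous hid hrad
  obtain ⟨g', hg'⟩ := exists_lift hd L hL R B hB hR hL0 θ.symm θ.symm.continuous hid' hrad'
  obtain ⟨b1, hb1⟩ := (big_conn hd B (by linarith)).nonempty
  have inv := lift_inv L hL B hL0 b1 hb1 θ θ.symm (by simp) g g' hg hg'
  have inv' := lift_inv L hL B hL0 b1 hb1 θ.symm θ (by simp) g' g hg' hg
  have gc : Continuous fun p => (g p).2 := by have := hg.1; fun_prop
  have gc' : Continuous fun p => (g' p).2 := by have := hg'.1; fun_prop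
  have base : ∀ s u : ℝ, 2 ≤ s → g ((b1, s), u) = ((b1, s), u) := fun s u hs =>
    (hg.2 ((b1,s),u) hs).2.2.2 hb1
  have base' : ∀ s u : ℝ, 2 ≤ s → g' ((b1, s), u) = ((b1, s), u) := fun s u hs =>
    (hg'.2 ((b1,s),u) hs).2.2.2 hb1
  -- half pages avoid integer pages
  have a1 : ∀ p : (W × ℝ) × ℝ, 2 ≤ p.1.2 → ∀ k j : ℤ, p.2 = k + 1/2 → (g p).2 ≠ j := by
    intro p hp k j hk hj
    obtain ⟨h1, h2, -, -⟩ := hg.2 p hp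
    have h3 := bk_half L p k hk
    have h4 := bk_int L (g p) j hj
    rw [h1] at h4
    exact hav _ _ _ (hRL _ (by linarith)) (hRL _ h2) (hpos _ (by linarith)) (hpos _ h2) h3 h4
  have a2 : ∀ p : (W × ℝ) × ℝ, 2 ≤ p.1.2 → ∀ k j : ℤ, p.2 = j → (g' p).2 ≠ k + 1/2 := by
    intro p hp k j hk hj
    obtain ⟨h1, h2, -, -⟩ := hg'.2 p hp
    have h3 := bk_int L p j hk
    have h4 := bk_half L (g' p) k hj
    refine hav _ _ _ (hRL _ h2) (hRL _ (show (0:ℝ) ≤ p.1.2 by linarith)) (hpos _ h2)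
      (hpos _ (by linarith)) h4 ?_
    rw [h1, θ.apply_symm_apply]; exact h3
  have half : ∀ (k : ℤ) (p : (W × ℝ) × ℝ), 2 ≤ p.1.2 → p.2 = k + 1/2 → k < (g p).2 ∧ (g p).2 < k + 1 := by
    intro k p hp hk
    have hc := slab_conn (W := W) {(k:ℝ) + 1/2} isPreconnected_singleton 2
    have hx0 : ((b1, 2), (k:ℝ)+1/2) ∈ {p : (W × ℝ) × ℝ | 2 ≤ p.1.2 ∧ p.2 ∈ ({(k:ℝ) + 1/2} : Set ℝ)} :=
      ⟨le_rfl, rfl⟩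
    constructor
    · exact gt_of_avoid hc gc.continuousOn (k:ℝ) (fun x hx => a1 x hx.1 k k hx.2) hx0
        (by rw [base _ _ le_rfl]; simp) ⟨hp, hk⟩
    · exact lt_of_avoid hc gc.continuousOn ((k:ℝ)+1) (fun x hx => by
          have := a1 x hx.1 k (k+1) hx.2; push_cast at this; exact this) hx0
        (by rw [base _ _ le_rfl]; simp; norm_num) ⟨hp, hk⟩
  have dsp' : ∀ p : (W × ℝ) × ℝ, 4 ≤ p.1.2 → 2 ≤ (g' p).1.2 := fun p hp => by
    have := (abs_le.1 (hg'.2 p (by linarith)).2.2.1).1; linarith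
  have up : ∀ (k : ℤ) (p : (W × ℝ) × ℝ), 4 ≤ p.1.2 → p.2 ≤ k → (g' p).2 < k + 1/2 := by
    intro k p hp hk
    have hc := slab_conn (W := W) (Set.Iic (k:ℝ)) isPreconnected_Iic 4
    refine lt_of_avoid hc gc'.continuousOn ((k:ℝ)+1/2) (fun x hx hx2 => ?_)
      (x₀ := ((b1, 4), (k:ℝ))) ⟨le_rfl, le_refl (k:ℝ)⟩ (by rw [base' _ _ (by norm_num)]; simp) ⟨hp, hk⟩
    have := (half k (g' x) (dsp' x hx.1) hx2).1
    rw [inv' x hx.1] at this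
    have h2 : x.2 ≤ k := hx.2
    linarith
  have dn : ∀ (k : ℤ) (p : (W × ℝ) × ℝ), 4 ≤ p.1.2 → k ≤ p.2 → k - 1/2 < (g' p).2 := by
    intro k p hp hk
    have hc := slab_conn (W := W) (Set.Ici (k:ℝ)) isPreconnected_Ici 4
    refine gt_of_avoid hc gc'.continuousOn ((k:ℝ)-1/2) (fun x hx hx2 => ?_)
      (x₀ := ((b1, 4), (k:ℝ))) ⟨le_rfl, le_refl (k:ℝ)⟩ (by rw [base' _ _ (by norm_num)]; simp) ⟨hp, hk⟩
    have := (half (k-1) (g' x) (dsp' x hx.1) (by rw [hx2]; push_cast; ring)).2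
    rw [inv' x hx.1] at this
    push_cast at this
    have h2 : k ≤ x.2 := hx.2
    linarith
  have du' : ∀ p : (W × ℝ) × ℝ, 4 ≤ p.1.2 → |(g' p).2 - p.2| ≤ 3/2 := by
    intro p hp
    have h1 := Int.floor_le p.2
    have h2 := Int.lt_floor_add_one p.2
    have h3 := dn _ p hp h1
    have h4 := up (⌊p.2⌋ + 1) p hp (by push_cast; linarith)
    push_cast at h4
    rw [abs_le]; constructor <;> linarith
  have ds : ∀ p : (W × ℝ) × ℝ, 6 ≤ p.1.2 → 4 ≤ (g p).1.2 := fun p hp => by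
    have := (abs_le.1 (hg.2 p (by linarith)).2.2.1).1; linarith
  have ds' : ∀ p : (W × ℝ) × ℝ, 6 ≤ p.1.2 → 4 ≤ (g' p).1.2 := fun p hp => by
    have := (abs_le.1 (hg'.2 p (by linarith)).2.2.1).1; linarith
  refine ⟨g, g', ?_, hg, hg'⟩
  refine ⟨hg.1, hg'.1, fun p hp => inv p (by linarith), fun p hp => inv' p (by linarith),
    fun p hp => (hg.2 p (by linarith)).2.2.1, fun p hp => (hg'.2 p (by linarith)).2.2.1,
    ?_, fun p hp => du' p (by linarith),
    fun p hp => (hg.2 p (by linarith)).2.2.2, fun p hp => (hg'.2 p (by linarith)).2.2.2,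
    ?_, ?_, ?_, ?_, ?_⟩
  · intro p hp
    have := du' (g p) (ds p hp)
    rw [inv p (by linarith), abs_sub_comm] at this
    exact this
  · intro p hp hb
    by_contra hcon
    push Not at hcon
    have := (hg'.2 (g p) (by linarith [ds p hp])).2.2.2 hcon
    rw [inv p (by linarith)] at this
    rw [← this] at hcon; linarith
  · intro p hp hb
    by_contra hcon
    push Not at hcon
    have := (hg.2 (g' p) (by linarith [ds' p hp])).2.2.2 hcon
    rw [inv' p (by linarith)] at this
    rw [← this] at hcon; linarith
  · intro p hp hu
    have := half 0 p (by linarith) (by rw [hu]; norm_num)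
    simpa using this
  · intro p hp hu
    have := a2 p (by linarith) 0 0 (by rw [hu]; norm_num)
    simpa using this
  · intro p hp hu
    have := a2 p (by linarith) 0 1 (by rw [hu]; norm_num)
    simpa using this

end Pair

open Filter Topology

noncomputable def rho (u : ℝ) : ℝ := 1 + max 0 (max (-u) (u - 1))
noncomputable def gam (v : ℝ) : ℝ := max v 0 / (1 + max v 0)
noncomputable def jj (d u : ℝ) : ℝ := max d (min u (1-d)) + d/2 * (gam (u - (1-d)) - gam (d - u))
noncomputable def kk (d x : ℝ) : ℝ := 2 * max x 0 / (d - 2 * max x 0)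
noncomputable def ji (d v : ℝ) : ℝ := max d (min v (1-d)) + kk d (v - (1-d)) - kk d (d - v)

theorem rho_cont : Continuous rho := by unfold rho; fun_prop
theorem rho_ge (u : ℝ) : 1 ≤ rho u := by unfold rho; linarith [le_max_left 0 (max (-u) (u-1))]
theorem rho_one {u : ℝ} (h : 0 ≤ u) (h' : u ≤ 1) : rho u = 1 := by
  unfold rho; rw [max_eq_left, add_zero]; exact max_le (by linarith) (by linarith)
theorem rho_lip (u v : ℝ) : |rho u - rho v| ≤ |u - v| := by
  unfold rho
  have h1 := abs_max_sub_max_le_max 0 (max (-u) (u-1)) 0 (max (-v) (v-1))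
  have h2 := abs_max_sub_max_le_max (-u) (u-1) (-v) (v-1)
  have h3 : |-u - -v| = |u - v| := by rw [← abs_neg]; ring_nf
  have h4 : |u - 1 - (v - 1)| = |u - v| := by ring_nf
  rw [h3, h4, max_self] at h2
  rw [sub_self, abs_zero, max_eq_right (abs_nonneg (max (-u) (u-1) - max (-v) (v-1)))] at h1
  have : 1 + max 0 (max (-u) (u-1)) - (1 + max 0 (max (-v) (v-1))) =
    max 0 (max (-u) (u-1)) - max 0 (max (-v) (v-1)) := by ring
  rw [this]; exact h1.trans h2
theorem rho_big (u : ℝ) : |u| ≤ rho u := by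
  unfold rho
  rw [abs_le]
  have h1 := le_max_right 0 (max (-u) (u-1))
  have h2 := le_max_left (-u) (u-1)
  have h3 := le_max_right (-u) (u-1)
  constructor <;> linarith

theorem gam_cont : Continuous gam := by
  unfold gam
  refine Continuous.div (by fun_prop) (by fun_prop) fun v => ?_
  have := le_max_right v 0; positivity
theorem gam_nonpos {v : ℝ} (h : v ≤ 0) : gam v = 0 := by simp [gam, max_eq_right h]
theorem gam_pos {v : ℝ} (h : 0 ≤ v) : gam v = v / (1 + v) := by simp [gam, max_eq_left h]
theorem gam_nonneg (v : ℝ) : 0 ≤ gam v := by unfold gam; have := le_max_right v 0; positivity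
theorem gam_lt (v : ℝ) : gam v < 1 := by
  unfold gam; have := le_max_right v 0; rw [div_lt_one (by linarith)]; linarith
theorem kk_nonpos {d x : ℝ} (h : x ≤ 0) : kk d x = 0 := by simp [kk, max_eq_right h]
theorem kk_pos {d x : ℝ} (h : 0 ≤ x) : kk d x = 2 * x / (d - 2 * x) := by simp [kk, max_eq_left h]

theorem jj_cont : Continuous fun p : ℝ × ℝ => jj p.1 p.2 := by
  unfold jj
  have := gam_cont
  fun_prop

theorem jj_mid {d u : ℝ} (h1 : d ≤ u) (h2 : u ≤ 1 - d) : jj d u = u := by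
  unfold jj
  rw [gam_nonpos (by linarith), gam_nonpos (by linarith), min_eq_left h2, max_eq_right h1]; ring
theorem jj_hi {d u : ℝ} (hd4 : d ≤ 1/4) (h1 : 1 - d ≤ u) :
    jj d u = 1 - d + d/2 * ((u-(1-d)) / (1 + (u-(1-d)))) := by
  unfold jj
  rw [gam_pos (by linarith), gam_nonpos (by linarith), min_eq_right h1, max_eq_right (by linarith)]
  ring
theorem jj_lo {d u : ℝ} (hd4 : d ≤ 1/4) (h1 : u ≤ d) :
    jj d u = d - d/2 * ((d - u) / (1 + (d-u))) := by
  unfold jj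
  rw [gam_pos (v := d - u) (by linarith), gam_nonpos (by linarith), max_eq_left
    ((min_le_left _ _).trans h1)]
  ring
theorem ji_mid {d u : ℝ} (h1 : d ≤ u) (h2 : u ≤ 1 - d) : ji d u = u := by
  unfold ji
  rw [kk_nonpos (by linarith), kk_nonpos (by linarith), min_eq_left h2, max_eq_right h1]; ring
theorem ji_hi {d u : ℝ} (hd4 : d ≤ 1/4) (h1 : 1 - d ≤ u) :
    ji d u = 1 - d + 2 * (u-(1-d)) / (d - 2 * (u-(1-d))) := by
  unfold ji
  rw [kk_pos (by linarith), kk_nonpos (by linarith), min_eq_right h1, max_eq_right (by linarith)]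
  ring
theorem ji_lo {d u : ℝ} (hd4 : d ≤ 1/4) (h1 : u ≤ d) :
    ji d u = d - 2 * (d - u) / (d - 2 * (d-u)) := by
  unfold ji
  rw [kk_pos (x := d - u) (by linarith), kk_nonpos (by linarith), max_eq_left
    ((min_le_left _ _).trans h1)]
  ring

theorem jj_strip {d : ℝ} (hd : 0 < d) (hd4 : d ≤ 1/4) (u : ℝ) :
    d/2 < jj d u ∧ jj d u < 1 - d/2 := by
  unfold jj
  have h1 := gam_nonneg (u-(1-d))
  have h2 := gam_nonneg (d-u)
  have h3 := gam_lt (u-(1-d))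
  have h4 := gam_lt (d-u)
  have h5 : d ≤ max d (min u (1-d)) := le_max_left _ _
  have h6 : max d (min u (1-d)) ≤ 1 - d := max_le (by linarith) (min_le_right _ _)
  constructor <;> nlinarith

theorem ji_jj {d : ℝ} (hd : 0 < d) (hd4 : d ≤ 1/4) (u : ℝ) : ji d (jj d u) = u := by
  rcases le_total u d with h | h
  · have h1 : 0 < 1 + (d-u) := by linarith
    rw [jj_lo hd4 h, ji_lo hd4 (by
      have : 0 ≤ (d-u)/(1+(d-u)) := by apply div_nonneg <;> linarith
      nlinarith)]
    have h2 : d - 2 * (d - (d - d/2*((d-u)/(1+(d-u))))) = d / (1 + (d-u)) := by field_simp; ring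
    rw [h2]; field_simp; ring
  · rcases le_total u (1-d) with h' | h'
    · rw [jj_mid h h', ji_mid h h']
    · have h1 : 0 < 1 + (u-(1-d)) := by linarith
      rw [jj_hi hd4 h', ji_hi hd4 (by
        have : 0 ≤ (u-(1-d))/(1+(u-(1-d))) := by apply div_nonneg <;> linarith
        nlinarith)]
      have h2 : d - 2 * ((1 - d + d/2*((u-(1-d))/(1+(u-(1-d))))) - (1 - d)) = d / (1 + (u-(1-d))) := by
        field_simp; ring
      rw [h2]; field_simp; ring

theorem jj_ji {d : ℝ} (hd : 0 < d) (hd4 : d ≤ 1/4) {v : ℝ} (h1 : d/2 < v) (h2 : v < 1 - d/2) :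
    jj d (ji d v) = v := by
  rcases le_total v d with h | h
  · have h3 : 0 < d - 2*(d-v) := by linarith
    have h4 : 0 ≤ 2 * (d - v) / (d - 2*(d-v)) := by apply div_nonneg <;> linarith
    rw [ji_lo hd4 h, jj_lo hd4 (by linarith)]
    have h5 : d - (d - 2 * (d - v) / (d - 2*(d-v))) = 2 * (d - v) / (d - 2*(d-v)) := by ring
    have h6 : 1 + 2 * (d - v) / (d - 2*(d-v)) = d / (d - 2*(d-v)) := by field_simp; ring
    rw [h5, h6]; field_simp; ring
  · rcases le_total v (1-d) with h' | h'
    · rw [ji_mid h h', jj_mid h h']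
    · have h3 : 0 < d - 2*(v-(1-d)) := by linarith
      have h4 : 0 ≤ 2 * (v-(1-d)) / (d - 2*(v-(1-d))) := by apply div_nonneg <;> linarith
      rw [ji_hi hd4 h', jj_hi hd4 (by linarith)]
      have h5 : 1 - d + 2 * (v-(1-d)) / (d - 2*(v-(1-d))) - (1-d) = 2 * (v-(1-d)) / (d - 2*(v-(1-d))) := by
        ring
      have h6 : 1 + 2 * (v-(1-d)) / (d - 2*(v-(1-d))) = d / (d - 2*(v-(1-d))) := by field_simp; ring
      rw [h5, h6]; field_simp; ring

theorem jj_top (d : ℝ) : Tendsto (fun p : ℝ × ℝ => jj p.1 p.2) (𝓝 d ×ˢ atTop) (𝓝 (1 - d/2)) ∨ ¬ (0 < d ∧ d ≤ 1/4) := by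
  by_cases hd : 0 < d ∧ d ≤ 1/4
  swap
  · exact Or.inr hd
  left
  have g1 : Tendsto (fun p : ℝ × ℝ => gam (p.2 - (1 - p.1))) (𝓝 d ×ˢ atTop) (𝓝 1) := by
    have h0 : Tendsto gam atTop (𝓝 1) := by
      have h1 : Tendsto (fun v : ℝ => 1 - (1 + v)⁻¹) atTop (𝓝 (1 - 0)) := by
        refine tendsto_const_nhds.sub (tendsto_inv_atTop_zero.comp ?_)
        exact tendsto_atTop_add_const_left _ _ tendsto_id
      rw [sub_zero] at h1
      refine h1.congr' ?_
      filter_upwards [eventually_ge_atTop 0] with v hv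
      rw [gam_pos hv]; field_simp; ring
    refine h0.comp ?_
    have : Tendsto (fun p : ℝ × ℝ => -(1 - p.1) + p.2) (𝓝 d ×ˢ atTop) atTop := by
      refine Tendsto.add_atTop (C := -(1-d)) ?_ tendsto_snd
      exact ((tendsto_const_nhds.sub tendsto_fst)).neg
    refine this.congr fun p => by ring
  have g2 : ∀ᶠ p : ℝ × ℝ in 𝓝 d ×ˢ atTop, 1 - p.1 + p.1/2 * gam (p.2 - (1 - p.1)) = jj p.1 p.2 := by
    have e1 : ∀ᶠ p : ℝ × ℝ in 𝓝 d ×ˢ atTop, p.1 < 1/2 ∧ 0 < p.1 :=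
      tendsto_fst.eventually ((gt_mem_nhds (by linarith : d < 1/2)).and (lt_mem_nhds hd.1))
    have e2 : ∀ᶠ p : ℝ × ℝ in 𝓝 d ×ˢ atTop, 1 ≤ p.2 := tendsto_snd.eventually (eventually_ge_atTop 1)
    filter_upwards [e1, e2] with p h1 h2
    unfold jj
    rw [gam_nonpos (v := p.1 - p.2) (by linarith), min_eq_right (by linarith), max_eq_right (by linarith)]
    ring
  have g3 : Tendsto (fun p : ℝ × ℝ => p.1) (𝓝 d ×ˢ (atTop : Filter ℝ)) (𝓝 d) := tendsto_fst
  have g4 := (tendsto_const_nhds (x := (1:ℝ))).sub g3 |>.add ((g3.div_const 2).mul g1)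
  refine (g4.congr' g2).mono_right ?_
  rw [show 1 - d + d/2*1 = 1 - d/2 by ring]

theorem gam_refl (d u : ℝ) (hd : d ≤ 1/4) : jj d (1 - u) = 1 - jj d u := by
  unfold jj
  have h1 : 1 - u - (1-d) = d - u := by ring
  have h2 : d - (1 - u) = u - (1 - d) := by ring
  rw [h1, h2]
  have h3 : max d (min (1-u) (1-d)) = 1 - max d (min u (1-d)) := by
    rcases le_total u d with h | h
    · rw [min_eq_right (by linarith), min_eq_left (by linarith), max_eq_left h, max_eq_right (by linarith)]
    · rcases le_total u (1-d) with h' | h'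
      · rw [min_eq_left (by linarith), min_eq_left h', max_eq_right h, max_eq_right (by linarith)]
      · rw [min_eq_left (by linarith), min_eq_right h', max_eq_left (by linarith), max_eq_right (by linarith)]; ring
  rw [h3]; ring

theorem jj_bot (d : ℝ) (hd : 0 < d) (hd4 : d ≤ 1/8) :
    Tendsto (fun p : ℝ × ℝ => jj p.1 p.2) (𝓝 d ×ˢ atBot) (𝓝 (d/2)) := by
  have h1 := (jj_top d).resolve_right (by push Not; exact ⟨hd, by linarith⟩)
  have h2 : Tendsto (fun p : ℝ × ℝ => (p.1, 1 - p.2)) (𝓝 d ×ˢ atBot) (𝓝 d ×ˢ atTop) := by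
    refine tendsto_fst.prodMk ?_
    exact tendsto_atTop_add_const_left _ _ (tendsto_neg_atBot_atTop.comp tendsto_snd)
  have h3 := (tendsto_const_nhds (x := (1:ℝ))).sub (h1.comp h2)
  rw [show 1 - (1 - d/2) = d/2 by ring] at h3
  refine h3.congr' ?_
  have e1 : ∀ᶠ p : ℝ × ℝ in 𝓝 d ×ˢ atBot, p.1 < 1/4 :=
    tendsto_fst.eventually (gt_mem_nhds (by linarith : d < 1/4))
  filter_upwards [e1] with p hp
  simp only [Function.comp]
  rw [gam_refl _ _ hp.le]; ring

open Filter Topology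

theorem kk_cont {X : Type*} [TopologicalSpace X] {A : Set X} (d x : X → ℝ) (hd : ContinuousOn d A)
    (hx : ContinuousOn x A) (h0 : ∀ a ∈ A, 0 < d a) (h : ∀ a ∈ A, x a < d a / 2) :
    ContinuousOn (fun a => kk (d a) (x a)) A := by
  unfold kk
  have h2 : ContinuousOn (fun a => max (x a) 0) A := hx.sup continuousOn_const
  refine ContinuousOn.div (by fun_prop) (by fun_prop) fun a ha => ?_
  have h1 := h a ha
  have h3 := h0 a ha
  have : max (x a) 0 < d a / 2 := max_lt h1 (by linarith)
  linarith

theorem ji_contOn {X : Type*} [TopologicalSpace X] {A : Set X} (d v : X → ℝ) (hd : ContinuousOn d A)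
    (hx : ContinuousOn v A) (h0 : ∀ a ∈ A, 0 < d a) (h : ∀ a ∈ A, d a / 2 < v a ∧ v a < 1 - d a / 2) :
    ContinuousOn (fun a => ji (d a) (v a)) A := by
  unfold ji
  have h1 := kk_cont d (fun a => v a - (1 - d a)) hd (by fun_prop) h0 (fun a ha => by
    have := (h a ha).2; linarith)
  have h2 := kk_cont d (fun a => d a - v a) hd (by fun_prop) h0 (fun a ha => by
    have := (h a ha).1; linarith)
  have h3 : ContinuousOn (fun a => max (d a) (min (v a) (1 - d a))) A :=
    hd.sup (hx.inf (by fun_prop))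
  exact (h3.add h1).sub h2

section Comp
variable {Q : Type*} [NormedAddCommGroup Q] [NormedSpace ℝ Q]

noncomputable def Jm (δ : Q → ℝ) (p : Q × ℝ) : Q × ℝ :=
  ((rho p.2)⁻¹ • p.1, jj (δ ((rho p.2)⁻¹ • p.1)) p.2)
noncomputable def Ji (δ : Q → ℝ) (p : Q × ℝ) : Q × ℝ :=
  (rho (ji (δ p.1) p.2) • p.1, ji (δ p.1) p.2)
def strip (δ : Q → ℝ) : Set (Q × ℝ) := {p | δ p.1 / 2 < p.2 ∧ p.2 < 1 - δ p.1 / 2}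

open Classical in
noncomputable def compr (δ : Q → ℝ) (G : Q × ℝ → Q × ℝ) (p : Q × ℝ) : Q × ℝ :=
  if p ∈ strip δ then Jm δ (G (Ji δ p)) else p


theorem Jm_cont {δ : Q → ℝ} (hδ : Continuous δ) (hδ0 : ∀ q, 0 < δ q)
    (hδ1 : ∀ q, δ q ≤ 1/8) : Continuous (Jm δ) := by
  unfold Jm
  have h1 : Continuous fun p : Q × ℝ => (rho p.2)⁻¹ :=
    (rho_cont.comp continuous_snd).inv₀ fun p => by
      have := rho_ge p.2; simp only [Function.comp]; positivity
  have h2 : Continuous fun p : Q × ℝ => (rho p.2)⁻¹ • p.1 := h1.smul continuous_fst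
  exact h2.prodMk (jj_cont.comp ((hδ.comp h2).prodMk continuous_snd))

theorem Jm_mem {δ : Q → ℝ} (hδ : Continuous δ) (hδ0 : ∀ q, 0 < δ q)
    (hδ1 : ∀ q, δ q ≤ 1/8) (p : Q × ℝ) : Jm δ p ∈ strip δ :=
  jj_strip (hδ0 _) ((hδ1 _).trans (by norm_num)) _

theorem Ji_Jm {δ : Q → ℝ} (hδ : Continuous δ) (hδ0 : ∀ q, 0 < δ q)
    (hδ1 : ∀ q, δ q ≤ 1/8) (p : Q × ℝ) : Ji δ (Jm δ p) = p := by
  have h : ji (δ (Jm δ p).1) (Jm δ p).2 = p.2 :=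
    ji_jj (hδ0 _) ((hδ1 _).trans (by norm_num)) _
  have h1 := rho_ge p.2
  unfold Ji
  rw [h]
  refine Prod.ext ?_ rfl
  simp only [Jm, smul_smul]
  rw [mul_inv_cancel₀ (by positivity), one_smul]

theorem Jm_Ji {δ : Q → ℝ} (hδ : Continuous δ) (hδ0 : ∀ q, 0 < δ q)
    (hδ1 : ∀ q, δ q ≤ 1/8) (p : Q × ℝ) (hp : p ∈ strip δ) : Jm δ (Ji δ p) = p := by
  have h1 := rho_ge (ji (δ p.1) p.2)
  have h2 : (Jm δ (Ji δ p)).1 = p.1 := by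
    simp only [Jm, Ji, smul_smul]
    rw [inv_mul_cancel₀ (by positivity), one_smul]
  refine Prod.ext h2 ?_
  have : (Jm δ (Ji δ p)).2 = jj (δ (Jm δ (Ji δ p)).1) (ji (δ p.1) p.2) := rfl
  rw [this, h2]
  exact jj_ji (hδ0 _) ((hδ1 _).trans (by norm_num)) hp.1 hp.2

theorem Ji_contOn {δ : Q → ℝ} (hδ : Continuous δ) (hδ0 : ∀ q, 0 < δ q)
    (hδ1 : ∀ q, δ q ≤ 1/8) : ContinuousOn (Ji δ) (strip δ) := by
  unfold Ji
  have h1 := ji_contOn (A := strip δ) (fun p : Q × ℝ => δ p.1) (fun p => p.2) (by fun_prop)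
    (by fun_prop) (fun a _ => hδ0 _) (fun a ha => ha)
  have h2 := rho_cont
  exact ((h2.comp_continuousOn h1).smul continuousOn_fst).prodMk h1

theorem strip_open {δ : Q → ℝ} (hδ : Continuous δ) (hδ0 : ∀ q, 0 < δ q)
    (hδ1 : ∀ q, δ q ≤ 1/8) : IsOpen (strip δ) :=
  (isOpen_lt (by fun_prop : Continuous fun p : Q × ℝ => δ p.1 / 2) continuous_snd).inter
    (isOpen_lt continuous_snd (by fun_prop : Continuous fun p : Q × ℝ => 1 - δ p.1 / 2))

theorem compr_cont {δ : Q → ℝ} (hδ : Continuous δ) (hδ0 : ∀ q, 0 < δ q)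
    (hδ1 : ∀ q, δ q ≤ 1/8) (D : Set Q) (hD : ∀ q ∈ D, ∀ c : ℝ, 1 ≤ c → c • q ∈ D) (G : Q × ℝ → Q × ℝ)
    (hG : Continuous G) (K : ℝ)
    (hK : ∀ p : Q × ℝ, p.1 ∈ D → ‖(G p).1 - p.1‖ ≤ K ∧ |(G p).2 - p.2| ≤ 3/2) :
    ContinuousOn (compr δ G) {p | p.1 ∈ D} := by
  intro p₀ hp₀
  by_cases hs : p₀ ∈ strip δ
  · apply ContinuousAt.continuousWithinAt
    have h1 := (strip_open hδ hδ0 hδ1).mem_nhds hs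
    have h2 : ContinuousAt (fun p => Jm δ (G (Ji δ p))) p₀ :=
      ((Jm_cont hδ hδ0 hδ1).comp hG).continuousAt.comp
        ((Ji_contOn hδ hδ0 hδ1).continuousAt h1)
    refine h2.congr ?_
    filter_upwards [h1] with p hp
    simp [compr, hp]
  · have hval : compr δ G p₀ = p₀ := by simp [compr, hs]
    have hsplit : {p : Q × ℝ | p.1 ∈ D} = ({p | p.1 ∈ D} ∩ (strip δ)ᶜ) ∪ ({p | p.1 ∈ D} ∩ strip δ) := by
      rw [← Set.inter_union_distrib_left, Set.compl_union_self, Set.inter_univ]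
    rw [hsplit]
    apply ContinuousWithinAt.union
    · refine continuousWithinAt_id.congr (fun p hp => ?_) (by rw [hval]; rfl)
      simp only [compr, if_neg hp.2, id]
    · rw [ContinuousWithinAt, hval]
      set F := 𝓝[{p : Q × ℝ | p.1 ∈ D} ∩ strip δ] p₀ with hF
      have hFm : ∀ᶠ p in F, p.1 ∈ D ∧ p ∈ strip δ := eventually_mem_nhdsWithin
      have t0 : Tendsto id F (𝓝 p₀) := tendsto_id.mono_left nhdsWithin_le_nhds
      have t1 : Tendsto (fun p : Q × ℝ => p.1) F (𝓝 p₀.1) := (continuous_fst.tendsto _).comp t0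
      have t2 : Tendsto (fun p : Q × ℝ => p.2) F (𝓝 p₀.2) := (continuous_snd.tendsto _).comp t0
      have t3 : Tendsto (fun p : Q × ℝ => δ p.1) F (𝓝 (δ p₀.1)) := (hδ.tendsto _).comp t1
      let u : Q × ℝ → ℝ := fun p => ji (δ p.1) p.2
      let u2 : Q × ℝ → ℝ := fun p => (G (Ji δ p)).2
      have hu2 : ∀ᶠ p in F, |u2 p - u p| ≤ 3/2 := by
        filter_upwards [hFm] with p hp
        exact (hK (Ji δ p) (hD _ hp.1 _ (rho_ge _))).2
      -- convergence of the first coordinate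
      have first : Tendsto (fun p => rho (u2 p)) F atTop →
          Tendsto (fun p => (rho (u2 p))⁻¹ • (G (Ji δ p)).1) F (𝓝 p₀.1) := by
        intro hr
        have e1 : Tendsto (fun p : Q × ℝ => (K + 3/2 * ‖p.1‖) / rho (u2 p)) F (𝓝 0) :=
          Tendsto.div_atTop (tendsto_const_nhds.add (tendsto_const_nhds.mul t1.norm)) hr
        have e2 : Tendsto (fun p : Q × ℝ => (rho (u2 p))⁻¹ • (G (Ji δ p)).1 - p.1) F (𝓝 0) := by
          apply squeeze_zero_norm' _ e1
          filter_upwards [hFm, hu2] with p hp hup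
          have h1 := rho_ge (u2 p)
          have h2 := (hK (Ji δ p) (hD _ hp.1 _ (rho_ge _))).1
          have h3 := (rho_lip (u2 p) (u p)).trans hup
          have h4 : (Ji δ p).1 = rho (u p) • p.1 := rfl
          rw [h4] at h2
          have h5 : (rho (u2 p))⁻¹ • (G (Ji δ p)).1 - p.1 =
              (rho (u2 p))⁻¹ • (((G (Ji δ p)).1 - rho (u p) • p.1) - (rho (u2 p) - rho (u p)) • p.1) := by
            rw [sub_smul, sub_sub_sub_cancel_right, smul_sub, smul_smul, inv_mul_cancel₀ (by positivity),
              one_smul]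
          rw [h5, norm_smul, norm_inv, Real.norm_of_nonneg (by positivity), div_eq_inv_mul]
          gcongr
          refine (norm_sub_le _ _).trans ?_
          rw [norm_smul, Real.norm_eq_abs]
          gcongr
        have := e2.add t1
        simpa using this
      have fin : Tendsto (fun p => Jm δ (G (Ji δ p))) F (𝓝 p₀) → Tendsto (compr δ G) F (𝓝 p₀) := by
        intro h
        refine h.congr' ?_
        filter_upwards [hFm] with p hp
        simp [compr, hp.2]
      apply fin
      rcases F.eq_or_neBot with hb | hb
      · rw [hb]; exact tendsto_bot
      have l1 : δ p₀.1 / 2 ≤ p₀.2 := le_of_tendsto_of_tendsto (t3.div_const 2) t2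
        (hFm.mono fun p hp => hp.2.1.le)
      have l2 : p₀.2 ≤ 1 - δ p₀.1 / 2 := le_of_tendsto_of_tendsto t2
        (tendsto_const_nhds.sub (t3.div_const 2)) (hFm.mono fun p hp => hp.2.2.le)
      have hd0 := hδ0 p₀.1
      have hd1 := hδ1 p₀.1
      have hcase : p₀.2 = δ p₀.1 / 2 ∨ p₀.2 = 1 - δ p₀.1 / 2 := by
        by_contra hcon
        push Not at hcon
        exact hs ⟨lt_of_le_of_ne l1 (Ne.symm hcon.1), lt_of_le_of_ne l2 hcon.2⟩
      have absrho : ∀ v : Q × ℝ → ℝ, (∀ p, v p ≤ rho (u2 p)) → Tendsto v F atTop →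
          Tendsto (fun p => rho (u2 p)) F atTop := fun v h1 h2 => tendsto_atTop_mono h1 h2
      rcases hcase with hc | hc
      · have hlim : Tendsto u F atBot := by
          have n1 : Tendsto (fun p : Q × ℝ => 2 * (δ p.1 - p.2)) F (𝓝 (δ p₀.1)) := by
            have := ((t3.sub t2).const_mul 2)
            rwa [hc, show 2 * (δ p₀.1 - δ p₀.1 / 2) = δ p₀.1 by ring] at this
          have n2 : Tendsto (fun p : Q × ℝ => δ p.1 - 2 * (δ p.1 - p.2)) F (𝓝[>] 0) := by
            rw [tendsto_nhdsWithin_iff]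
            constructor
            · have := t3.sub n1
              rwa [sub_self] at this
            · filter_upwards [hFm] with p hp
              have := hp.2.1
              rw [Set.mem_Ioi]
              linarith
          have n3 := n1.pos_mul_atTop hd0 (tendsto_inv_nhdsGT_zero.comp n2)
          have n4 : Tendsto (fun p : Q × ℝ => δ p.1 + -(2 * (δ p.1 - p.2) * (δ p.1 - 2 * (δ p.1 - p.2))⁻¹)) F atBot :=
            t3.add_atBot (tendsto_neg_atTop_atBot.comp n3)
          refine n4.congr' ?_
          have : ∀ᶠ p in F, p.2 < δ p.1 := t2.eventually_lt t3 (by rw [hc]; linarith)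
          filter_upwards [this] with p hp
          simp only [u]
          rw [ji_lo ((hδ1 _).trans (by norm_num)) hp.le, div_eq_mul_inv]; ring
        have hlim2 : Tendsto u2 F atBot := by
          refine tendsto_atBot_mono' F ?_ (tendsto_atBot_add_const_right _ (3/2) hlim)
          filter_upwards [hu2] with p hp
          have := (abs_le.1 hp).2; linarith
        have hr := absrho (fun p => - u2 p) (fun p => (neg_le_abs _).trans (rho_big _))
          (tendsto_neg_atBot_atTop.comp hlim2)
        have hf := first hr
        have h5 := (jj_bot (δ p₀.1) hd0 hd1).comp (((hδ.tendsto _).comp hf).prodMk hlim2)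
        rw [← hc] at h5
        have := hf.prodMk_nhds h5
        exact this
      · have hlim : Tendsto u F atTop := by
          have n1 : Tendsto (fun p : Q × ℝ => 2 * (p.2 - (1 - δ p.1))) F (𝓝 (δ p₀.1)) := by
            have := ((t2.sub ((tendsto_const_nhds (x := (1:ℝ))).sub t3)).const_mul 2)
            rwa [hc, show 2 * (1 - δ p₀.1 / 2 - (1 - δ p₀.1)) = δ p₀.1 by ring] at this
          have n2 : Tendsto (fun p : Q × ℝ => δ p.1 - 2 * (p.2 - (1 - δ p.1))) F (𝓝[>] 0) := by
            rw [tendsto_nhdsWithin_iff]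
            constructor
            · have := t3.sub n1
              rwa [sub_self] at this
            · filter_upwards [hFm] with p hp
              have := hp.2.2
              rw [Set.mem_Ioi]
              linarith
          have n3 := n1.pos_mul_atTop hd0 (tendsto_inv_nhdsGT_zero.comp n2)
          have n4 : Tendsto (fun p : Q × ℝ => (1 - δ p.1) + (2 * (p.2 - (1 - δ p.1)) * (δ p.1 - 2 * (p.2 - (1 - δ p.1)))⁻¹)) F atTop :=
            (tendsto_const_nhds.sub t3).add_atTop n3
          refine n4.congr' ?_
          have : ∀ᶠ p in F, 1 - δ p.1 < p.2 :=
            (tendsto_const_nhds.sub t3).eventually_lt t2 (by rw [hc]; linarith)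
          filter_upwards [this] with p hp
          simp only [u]
          rw [ji_hi ((hδ1 _).trans (by norm_num)) hp.le, div_eq_mul_inv]
        have hlim2 : Tendsto u2 F atTop := by
          refine tendsto_atTop_mono' F ?_ (tendsto_atTop_add_const_right _ (-(3/2)) hlim)
          filter_upwards [hu2] with p hp
          have := (abs_le.1 hp).1; linarith
        have hr := absrho u2 (fun p => (le_abs_self _).trans (rho_big _)) hlim2
        have hf := first hr
        have h5 := ((jj_top (δ p₀.1)).resolve_right (by push Not; exact ⟨hd0, by linarith⟩)).comp
          (((hδ.tendsto _).comp hf).prodMk hlim2)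
        rw [← hc] at h5
        have := hf.prodMk_nhds h5
        exact this

end Comp

open Filter Topology

section CP
variable {W : Type*} [NormedAddCommGroup W] [NormedSpace ℝ W]

/-- a compressed map -/
structure Compressed (B : ℝ) (δ : W × ℝ → ℝ) (c : (W × ℝ) × ℝ → (W × ℝ) × ℝ) : Prop where
  cont : ContinuousOn c {p | 6 ≤ p.1.2}
  id : ∀ p, 6 ≤ p.1.2 → B ≤ ‖p.1.1‖ → c p = p
  bd : ∀ p, 6 ≤ p.1.2 → ‖p.1.1‖ < B → ‖(c p).1.1‖ < B
  s : ∀ p, 6 ≤ p.1.2 → (p.1.2 - 2) / (5/2) ≤ (c p).1.2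
  u : ∀ p, 0 < p.2 → p.2 < 1 → 0 < (c p).2 ∧ (c p).2 < 1
  lo : ∀ p, p.2 ≤ δ p.1 → c p = p
  hi : ∀ p, 1 - δ p.1 ≤ p.2 → c p = p

theorem compressed_of {B K : ℝ} {δ : W × ℝ → ℝ} (hδ : Continuous δ) (hδ0 : ∀ q, 0 < δ q)
    (hδ1 : ∀ q, δ q ≤ 1/8) (hB : 0 < B) (hKB : max (2 * B) 2 ≤ K)
    (g : (W × ℝ) × ℝ → (W × ℝ) × ℝ) (hg : Continuous g)
    (ds : ∀ p, 6 ≤ p.1.2 → |(g p).1.2 - p.1.2| ≤ 2)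
    (du : ∀ p, 6 ≤ p.1.2 → |(g p).2 - p.2| ≤ 3/2)
    (id : ∀ p, 6 ≤ p.1.2 → B ≤ ‖p.1.1‖ → g p = p)
    (bd : ∀ p, 6 ≤ p.1.2 → ‖p.1.1‖ < B → ‖(g p).1.1‖ < B) :
    Compressed B (fun q => δ q / 2) (compr δ g) := by
  have hJs : ∀ p : (W × ℝ) × ℝ, 6 ≤ p.1.2 → p.1.2 * rho (ji (δ p.1) p.2) = (Ji δ p).1.2 := by
    intro p _; simp only [Ji, Prod.smul_snd, smul_eq_mul]; ring
  have hJ6 : ∀ p : (W × ℝ) × ℝ, 6 ≤ p.1.2 → 6 ≤ (Ji δ p).1.2 := by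
    intro p hp; rw [← hJs p hp]; nlinarith [rho_ge (ji (δ p.1) p.2)]
  have hJb : ∀ p : (W × ℝ) × ℝ, ‖(Ji δ p).1.1‖ = rho (ji (δ p.1) p.2) * ‖p.1.1‖ := by
    intro p; simp only [Ji, Prod.smul_fst, norm_smul]
    rw [Real.norm_of_nonneg]; linarith [rho_ge (ji (δ p.1) p.2)]
  have off : ∀ p, p ∉ strip δ → compr δ g p = p := fun p hp => by simp [compr, hp]
  have on : ∀ p, p ∈ strip δ → compr δ g p = Jm δ (g (Ji δ p)) := fun p hp => by simp [compr, hp]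
  refine ⟨?_, ?_, ?_, ?_, ?_, ?_, ?_⟩
  · refine compr_cont hδ hδ0 hδ1 {q : W × ℝ | 6 ≤ q.2} ?_ g hg K ?_
    · intro q hq c hc
      show 6 ≤ c * q.2
      have : 6 ≤ q.2 := hq
      nlinarith
    · intro p hp
      have hp : 6 ≤ p.1.2 := hp
      refine ⟨?_, du p hp⟩
      by_cases hb : B ≤ ‖p.1.1‖
      · rw [id p hp hb, sub_self, norm_zero]
        exact le_trans (by positivity) hKB
      · push Not at hb
        have h1 := bd p hp hb
        rw [Prod.norm_def]
        refine le_trans (max_le_max ?_ ?_) hKB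
        · refine (norm_sub_le _ _).trans ?_
          linarith
        · exact ds p hp
  · intro p hp hb
    by_cases h : p ∈ strip δ
    · rw [on p h, id _ (hJ6 p hp) (by rw [hJb]; nlinarith [rho_ge (ji (δ p.1) p.2), norm_nonneg p.1.1]),
        Jm_Ji hδ hδ0 hδ1 p h]
    · exact off p h
  · intro p hp hb
    by_cases h : p ∈ strip δ
    · by_cases h2 : B ≤ ‖(Ji δ p).1.1‖
      · rw [on p h, id _ (hJ6 p hp) h2, Jm_Ji hδ hδ0 hδ1 p h]; exact hb
      · push Not at h2
        have h3 := bd _ (hJ6 p hp) h2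
        rw [on p h]
        have h4 := rho_ge (g (Ji δ p)).2
        simp only [Jm, Prod.smul_fst, norm_smul]
        rw [norm_inv, Real.norm_of_nonneg (by linarith)]
        refine lt_of_le_of_lt ?_ h3
        have : (rho (g (Ji δ p)).2)⁻¹ ≤ 1 := inv_le_one_of_one_le₀ h4
        nlinarith [norm_nonneg (g (Ji δ p)).1.1]
    · rw [off p h]; exact hb
  · intro p hp
    by_cases h : p ∈ strip δ
    · rw [on p h]
      have h1 := (abs_le.1 (ds _ (hJ6 p hp))).1
      rw [← hJs p hp] at h1
      have h2 := rho_lip (g (Ji δ p)).2 (Ji δ p).2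
      have h3 := du _ (hJ6 p hp)
      have h4 := (abs_le.1 (h2.trans h3)).2
      have h5 : (Ji δ p).2 = ji (δ p.1) p.2 := rfl
      rw [h5] at h4
      have h6 := rho_ge (g (Ji δ p)).2
      have h7 := rho_ge (ji (δ p.1) p.2)
      simp only [Jm, Prod.smul_snd, smul_eq_mul]
      rw [div_le_iff₀ (by norm_num), ← div_eq_inv_mul, div_mul_eq_mul_div, le_div_iff₀ (by linarith)]
      nlinarith
    · rw [off p h, div_le_iff₀ (by norm_num)]; linarith
  · intro p h1 h2
    by_cases h : p ∈ strip δ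
    · rw [on p h]
      have := Jm_mem hδ hδ0 hδ1 (g (Ji δ p))
      have h3 := hδ0 (Jm δ (g (Ji δ p))).1
      exact ⟨by linarith [this.1], by linarith [this.2]⟩
    · rw [off p h]; exact ⟨h1, h2⟩
  · intro p h
    exact off p fun hs => by linarith [hs.1]
  · intro p h
    exact off p fun hs => by linarith [hs.2]

theorem compr_inv {δ : W × ℝ → ℝ} (hδ : Continuous δ) (hδ0 : ∀ q, 0 < δ q)
    (hδ1 : ∀ q, δ q ≤ 1/8) (g g' : (W × ℝ) × ℝ → (W × ℝ) × ℝ)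
    (inv : ∀ p, 6 ≤ p.1.2 → g' (g p) = p) (p : (W × ℝ) × ℝ) (hp : 6 ≤ p.1.2) :
    compr δ g' (compr δ g p) = p := by
  by_cases h : p ∈ strip δ
  · have h1 : compr δ g p = Jm δ (g (Ji δ p)) := by simp [compr, h]
    have h2 := Jm_mem hδ hδ0 hδ1 (g (Ji δ p))
    have h3 : compr δ g' (Jm δ (g (Ji δ p))) = Jm δ (g' (Ji δ (Jm δ (g (Ji δ p))))) := by
      simp [compr, h2]
    have h6 : 6 ≤ (Ji δ p).1.2 := by
      simp only [Ji, Prod.smul_snd, smul_eq_mul]; nlinarith [rho_ge (ji (δ p.1) p.2)]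
    rw [h1, h3, Ji_Jm hδ hδ0 hδ1, inv _ h6, Jm_Ji hδ hδ0 hδ1 p h]
  · have h1 : compr δ g p = p := by simp [compr, h]
    rw [h1, compr, if_neg h]

theorem exists_compr {B : ℝ} (hB : 1 ≤ B) {g g' : (W × ℝ) × ℝ → (W × ℝ) × ℝ}
    (h : LiftPair B 6 g g') :
    ∃ c c' : (W × ℝ) × ℝ → (W × ℝ) × ℝ, ∃ δ : W × ℝ → ℝ, Continuous δ ∧ (∀ q, 0 < δ q) ∧
      Compressed B δ c ∧ Compressed B δ c' ∧
      (∀ p, 6 ≤ p.1.2 → c' (c p) = p) ∧ (∀ p, 6 ≤ p.1.2 → c (c' p) = p) ∧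
      ∀ p, 8 ≤ p.1.2 → p.2 = 1/2 → c =ᶠ[𝓝 p] g := by
  let pt : (W × ℝ) × ℝ := (0, 1/2)
  let V : Set ((W × ℝ) × ℝ) := {p | 6 ≤ p.1.2 ∧ (g' p).2 = 1/2} ∪ {pt}
  have hV : IsClosed V := by
    refine IsClosed.union ?_ isClosed_singleton
    have c1 : Continuous fun p => (g' p).2 := by have := h.cont'; fun_prop
    exact (isClosed_le continuous_const (by fun_prop : Continuous fun p : (W × ℝ) × ℝ => p.1.2)).inter
      (isClosed_eq c1 continuous_const)
  have hVn : V.Nonempty := ⟨pt, Or.inr rfl⟩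
  have z0 : ∀ q : W × ℝ, (q, (0:ℝ)) ∉ V := by
    rintro q (⟨h1, h2⟩ | h1)
    · exact h.zero' _ h1 rfl h2
    · have := congrArg Prod.snd h1
      norm_num [pt] at this
  have z1 : ∀ q : W × ℝ, (q, (1:ℝ)) ∉ V := by
    rintro q (⟨h1, h2⟩ | h1)
    · exact h.one' _ h1 rfl h2
    · have := congrArg Prod.snd h1
      norm_num [pt] at this
  let δ : W × ℝ → ℝ := fun q =>
    min (1/8) (min (Metric.infDist (q, (0:ℝ)) V) (Metric.infDist (q, (1:ℝ)) V) / 2)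
  have hδ : Continuous δ := by
    have i1 : Continuous fun q : W × ℝ => Metric.infDist (q, (0:ℝ)) V :=
      (Metric.continuous_infDist_pt V).comp (by fun_prop)
    have i2 : Continuous fun q : W × ℝ => Metric.infDist (q, (1:ℝ)) V :=
      (Metric.continuous_infDist_pt V).comp (by fun_prop)
    fun_prop
  have hδ0 : ∀ q, 0 < δ q := by
    intro q
    have i1 := (hV.notMem_iff_infDist_pos hVn).1 (z0 q)
    have i2 := (hV.notMem_iff_infDist_pos hVn).1 (z1 q)
    exact lt_min (by norm_num) (half_pos (lt_min i1 i2))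
  have hδ1 : ∀ q, δ q ≤ 1/8 := fun q => min_le_left _ _
  have gap : ∀ p ∈ V, 0 < p.2 → p.2 < 1 → δ p.1 < p.2 ∧ p.2 < 1 - δ p.1 := by
    intro p hp h0 h1
    have d0 : dist (p.1, (0:ℝ)) p = p.2 := by
      rw [Prod.dist_eq, dist_self, Real.dist_eq, zero_sub, abs_neg, abs_of_pos h0, max_eq_right h0.le]
    have d1 : dist (p.1, (1:ℝ)) p = 1 - p.2 := by
      rw [Prod.dist_eq, dist_self, Real.dist_eq, abs_of_pos (by simp only; linarith), max_eq_right (by simp only; linarith)]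
    have i1 : Metric.infDist (p.1, (0:ℝ)) V ≤ p.2 := d0 ▸ Metric.infDist_le_dist_of_mem hp
    have i2 : Metric.infDist (p.1, (1:ℝ)) V ≤ 1 - p.2 := d1 ▸ Metric.infDist_le_dist_of_mem hp
    have e : δ p.1 ≤ min (Metric.infDist (p.1, (0:ℝ)) V) (Metric.infDist (p.1, (1:ℝ)) V) / 2 :=
      min_le_right _ _
    have e1 := min_le_left (Metric.infDist (p.1, (0:ℝ)) V) (Metric.infDist (p.1, (1:ℝ)) V)
    have e2 := min_le_right (Metric.infDist (p.1, (0:ℝ)) V) (Metric.infDist (p.1, (1:ℝ)) V)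
    have := hδ0 p.1
    constructor <;> linarith
  refine ⟨compr δ g, compr δ g', fun q => δ q / 2, by fun_prop, fun q => half_pos (hδ0 q),
    compressed_of hδ hδ0 hδ1 (by linarith) le_rfl g h.cont h.ds h.du h.id h.bd,
    compressed_of hδ hδ0 hδ1 (by linarith) le_rfl g' h.cont' h.ds' h.du' h.id' h.bd',
    compr_inv hδ hδ0 hδ1 g g' h.inv, compr_inv hδ hδ0 hδ1 g' g h.inv', ?_⟩
  intro p hp hu
  let O : Set ((W × ℝ) × ℝ) := {x | δ x.1 < x.2 ∧ x.2 < 1 - δ x.1}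
  have hO : IsOpen O :=
    (isOpen_lt (by fun_prop : Continuous fun p : (W × ℝ) × ℝ => δ p.1) continuous_snd).inter
      (isOpen_lt continuous_snd (by fun_prop : Continuous fun p : (W × ℝ) × ℝ => 1 - δ p.1))
  have hpO : p ∈ O := by
    have := hδ1 p.1
    constructor <;> rw [hu] <;> linarith
  have hgO : g p ∈ O := by
    have h1 := h.half p (by linarith) hu
    refine gap (g p) (Or.inl ⟨?_, ?_⟩) h1.1 h1.2
    · have := (abs_le.1 (h.ds p (by linarith))).1; linarith
    · rw [h.inv p (by linarith)]; exact hu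
  filter_upwards [hO.mem_nhds hpO, h.cont.continuousAt (hO.mem_nhds hgO)] with x hx hgx
  have hgx : g x ∈ O := hgx
  have p1 := hδ0 x.1
  have p2 := hδ0 (g x).1
  have hs : x ∈ strip δ := ⟨by linarith [hx.1], by linarith [hx.2]⟩
  have e1 : Ji δ x = x := by
    unfold Ji
    rw [ji_mid hx.1.le hx.2.le, rho_one (by linarith [hx.1]) (by linarith [hx.2]), one_smul]
  have e2 : Jm δ (g x) = g x := by
    unfold Jm
    rw [rho_one (by linarith [hgx.1]) (by linarith [hgx.2]), inv_one, one_smul,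
      jj_mid hgx.1.le hgx.2.le]
  rw [compr, if_pos hs, e1, e2]

end CP

open Filter Topology

section Ups
variable {W : Type*} [NormedAddCommGroup W] [NormedSpace ℝ W]

noncomputable def cc (L : ℝ ≃ₜ ℝ) (w : W × ℂ) : (W × ℝ) × ℝ :=
  ((‖w.2‖⁻¹ • w.1, L.symm ‖w.2‖), Complex.arg (-w.2) / (2 * Real.pi) + 1/2)

theorem bk_cc (L : ℝ ≃ₜ ℝ) (w : W × ℂ) (h : w.2 ≠ 0) : bk L (cc L w) = w := by
  have hn : ‖w.2‖ ≠ 0 := norm_ne_zero_iff.2 h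
  unfold bk cc
  simp only [L.apply_symm_apply, smul_smul, mul_inv_cancel₀ hn, one_smul]
  refine Prod.ext rfl ?_
  simp only
  have h1 : (2 * Real.pi * (Complex.arg (-w.2) / (2 * Real.pi) + 1/2) : ℝ) = Complex.arg (-w.2) + Real.pi := by
    field_simp
  rw [h1]
  push_cast
  rw [add_mul, Complex.exp_add, Complex.exp_pi_mul_I]
  have := Complex.norm_mul_exp_arg_mul_I (-w.2)
  rw [norm_neg] at this
  linear_combination -this

theorem cc_u (L : ℝ ≃ₜ ℝ) (w : W × ℂ) : 0 < (cc L w).2 ∧ (cc L w).2 ≤ 1 := by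
  have h1 := Complex.neg_pi_lt_arg (-w.2)
  have h2 := Complex.arg_le_pi (-w.2)
  have hp := Real.pi_pos
  have e : (cc L w).2 = (Complex.arg (-w.2) + Real.pi) / (2 * Real.pi) := by
    simp only [cc]; field_simp
  rw [e]
  constructor
  · apply div_pos <;> linarith
  · rw [div_le_one (by positivity)]; linarith

theorem cc_bk (L : ℝ ≃ₜ ℝ) (p : (W × ℝ) × ℝ) (h : 0 < L p.1.2) (h0 : 0 < p.2) (h1 : p.2 < 1) :
    cc L (bk L p) = p := by
  have hn := bk_norm L p h.le
  have hne : (bk L p).2 ≠ 0 := by rw [← norm_ne_zero_iff, hn]; exact h.ne'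
  have he := bk_cc L (bk L p) hne
  obtain ⟨e1, n, e2⟩ := bk_inj L _ _ (by simp only [cc, L.apply_symm_apply, hn]; exact h) h he
  refine Prod.ext e1 ?_
  obtain ⟨u0, u1⟩ := cc_u L (bk L p)
  have a1 : (n:ℝ) < 1 := by linarith
  have a2 : (-1:ℝ) < n := by linarith
  have b1 : n < 1 := by exact_mod_cast a1
  have b2 : -1 < n := by exact_mod_cast a2
  have : n = 0 := by omega
  rw [this] at e2
  push_cast at e2
  linarith

theorem cc_cont (L : ℝ ≃ₜ ℝ) (w : W × ℂ) (h : w.2 ≠ 0) (h2 : -w.2 ∈ Complex.slitPlane) :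
    ContinuousAt (cc L) w := by
  unfold cc
  have hn : ‖w.2‖ ≠ 0 := norm_ne_zero_iff.2 h
  have c1 : ContinuousAt (fun w : W × ℂ => ‖w.2‖⁻¹) w :=
    ContinuousAt.inv₀ (by fun_prop) hn
  have c2 : ContinuousAt (fun w : W × ℂ => L.symm ‖w.2‖) w :=
    (by fun_prop : Continuous (fun w : W × ℂ => L.symm ‖w.2‖)).continuousAt
  have c3 : ContinuousAt (fun w : W × ℂ => Complex.arg (-w.2)) w :=
    ContinuousAt.comp (f := fun w : W × ℂ => -w.2) (Complex.continuousAt_arg h2) (by fun_prop)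
  fun_prop

theorem cc_q_cont (L : ℝ ≃ₜ ℝ) (w : W × ℂ) (h : w.2 ≠ 0) :
    ContinuousAt (fun w => (cc L w).1) w := by
  unfold cc
  have hn : ‖w.2‖ ≠ 0 := norm_ne_zero_iff.2 h
  have c1 : ContinuousAt (fun w : W × ℂ => ‖w.2‖⁻¹) w :=
    ContinuousAt.inv₀ (by fun_prop) hn
  have c2 : ContinuousAt (fun w : W × ℂ => L.symm ‖w.2‖) w :=
    (by fun_prop : Continuous (fun w : W × ℂ => L.symm ‖w.2‖)).continuousAt
  fun_prop

/-- near the page `u = 0` -/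
theorem cc_near_zero (L : ℝ ≃ₜ ℝ) (δ : W × ℝ → ℝ) (hδ : Continuous δ) (hδ0 : ∀ q, 0 < δ q)
    (w : W × ℂ) (r : ℝ) (hr : 0 < r) (hw : w.2 = r) :
    ∀ᶠ x in 𝓝 w, (cc L x).2 ≤ δ (cc L x).1 ∨ 1 - δ (cc L x).1 ≤ (cc L x).2 := by
  have hp := Real.pi_pos
  have hne : w.2 ≠ 0 := by rw [hw]; exact_mod_cast hr.ne'
  have c0 : ContinuousAt (fun x => δ (cc L x).1) w :=
    ContinuousAt.comp (f := fun w => (cc L w).1) hδ.continuousAt (cc_q_cont L w hne)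
  have c1 : ContinuousAt (fun x : W × ℂ => Complex.arg x.2) w :=
    ContinuousAt.comp (f := fun w : W × ℂ => w.2) (Complex.continuousAt_arg (by
      rw [hw]; exact Complex.ofReal_mem_slitPlane.2 hr)) (by fun_prop)
  have c2 : ContinuousAt (fun x : W × ℂ => |Complex.arg x.2| / (2 * Real.pi)) w := c1.abs.div_const _
  have h0 : |Complex.arg w.2| / (2 * Real.pi) < δ (cc L w).1 := by
    rw [hw, Complex.arg_ofReal_of_nonneg hr.le]; simpa using hδ0 _
  have hre : ∀ᶠ x : W × ℂ in 𝓝 w, 0 < x.2.re := by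
    have : ContinuousAt (fun x : W × ℂ => x.2.re) w := by fun_prop
    apply this.eventually (lt_mem_nhds (by show 0 < w.2.re; rw [hw]; simpa using hr))
  filter_upwards [c2.eventually_lt c0 h0, hre] with x hx hx0
  have e : (cc L x).2 = Complex.arg (-x.2) / (2 * Real.pi) + 1/2 := rfl
  rcases lt_trichotomy x.2.im 0 with him | him | him
  · right
    have a1 := Complex.arg_neg_eq_arg_add_pi_of_im_neg him
    have a2 := Complex.arg_neg_iff.2 him
    rw [abs_of_neg a2] at hx
    have : (cc L x).2 = 1 - -Complex.arg x.2 / (2 * Real.pi) := by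
      rw [e, a1]; field_simp; ring
    linarith
  · right
    have a1 : Complex.arg (-x.2) = Real.pi := by
      rw [Complex.arg_eq_pi_iff]; simp [hx0, him]
    have : (cc L x).2 = 1 := by rw [e, a1]; field_simp; norm_num
    have := hδ0 (cc L x).1
    linarith
  · left
    have a1 := Complex.arg_neg_eq_arg_sub_pi_of_im_pos him
    have a2 := Complex.arg_nonneg_iff.2 him.le
    rw [abs_of_nonneg a2] at hx
    have : (cc L x).2 = Complex.arg x.2 / (2 * Real.pi) := by
      rw [e, a1]; field_simp; ring
    linarith

open Classical in
noncomputable def ups (L : ℝ ≃ₜ ℝ) (B : ℝ) (c : (W × ℝ) × ℝ → (W × ℝ) × ℝ) (w : W × ℂ) : W × ℂ :=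
  if B * ‖w.2‖ ≤ ‖w.1‖ then w else bk L (c (cc L w))

theorem ups_core (L : ℝ ≃ₜ ℝ) (B : ℝ) (c : (W × ℝ) × ℝ → (W × ℝ) × ℝ) (w : W × ℂ)
    (h : B * ‖w.2‖ ≤ ‖w.1‖) : ups L B c w = w := by rw [ups, if_pos h]

theorem ups_core_ev (L : ℝ ≃ₜ ℝ) (B : ℝ) (c : (W × ℝ) × ℝ → (W × ℝ) × ℝ) (w : W × ℂ)
    (h : B * ‖w.2‖ < ‖w.1‖) : ups L B c =ᶠ[𝓝 w] id := by
  have : IsOpen {w : W × ℂ | B * ‖w.2‖ < ‖w.1‖} := isOpen_lt (by fun_prop) (by fun_prop)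
  filter_upwards [this.mem_nhds h] with x hx
  exact ups_core L B c x (le_of_lt hx)

variable {L : ℝ ≃ₜ ℝ} {B : ℝ} {δ : W × ℝ → ℝ} {c : (W × ℝ) × ℝ → (W × ℝ) × ℝ}

theorem ups_far (hL : StrictMono L) (hL0 : 0 < L 0) (hc : Compressed B δ c)
    (w : W × ℂ) (h : L 6 ≤ ‖w.2‖) : ups L B c w = bk L (c (cc L w)) := by
  by_cases hb : B * ‖w.2‖ ≤ ‖w.1‖
  · have hpos : 0 < ‖w.2‖ := lt_of_lt_of_le (hL0.trans (hL (by norm_num))) h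
    rw [ups_core L B c w hb, hc.id, bk_cc]
    · exact norm_pos_iff.1 hpos
    · show 6 ≤ L.symm ‖w.2‖
      rw [← hL.le_iff_le]; simpa using h
    · show B ≤ ‖‖w.2‖⁻¹ • w.1‖
      rw [norm_smul, norm_inv, norm_norm, ← div_eq_inv_mul, le_div_iff₀ hpos]; exact hb
  · rw [ups, if_neg hb]

theorem noncore (hB : 1 ≤ B) {s : ℝ} (w : W × ℂ) (h : B * L s < ‖w‖)
    (hb : ‖w.1‖ ≤ B * ‖w.2‖) : L s < ‖w.2‖ := by
  have h1 : ‖w‖ ≤ B * ‖w.2‖ := by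
    rw [Prod.norm_def]; exact max_le hb (by nlinarith [norm_nonneg w.2])
  exact lt_of_mul_lt_mul_left (h.trans_le h1) (by linarith)

theorem ups_far_ev (hL : StrictMono L) (hL0 : 0 < L 0) (hc : Compressed B δ c)
    (w : W × ℂ) (h : L 20 < ‖w.2‖) : ups L B c =ᶠ[𝓝 w] fun w => bk L (c (cc L w)) := by
  have : IsOpen {w : W × ℂ | L 20 < ‖w.2‖} := isOpen_lt (by fun_prop) (by fun_prop)
  filter_upwards [this.mem_nhds h] with x hx
  exact ups_far hL hL0 hc x ((hL (by norm_num)).le.trans (le_of_lt hx))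

theorem ups_zero_ev (hL : StrictMono L) (hL0 : 0 < L 0) (hδ : Continuous δ) (hδ0 : ∀ q, 0 < δ q)
    (hc : Compressed B δ c) (w : W × ℂ) (h : L 20 < ‖w.2‖) (r : ℝ) (hr : 0 < r) (hw : w.2 = r) :
    ups L B c =ᶠ[𝓝 w] id := by
  have hne : w.2 ≠ 0 := by rw [hw]; exact_mod_cast hr.ne'
  have hne' : ∀ᶠ x : W × ℂ in 𝓝 w, x.2 ≠ 0 :=
    (continuous_snd.continuousAt (x := w)).eventually_ne hne
  filter_upwards [ups_far_ev hL hL0 hc w h, cc_near_zero L δ hδ hδ0 w r hr hw, hne'] with x h1 h2 h3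
  rw [h1]
  have : c (cc L x) = cc L x := by
    rcases h2 with h | h
    · exact hc.lo _ h
    · exact hc.hi _ h
  rw [this, bk_cc L x h3]; rfl

theorem ups_cont (hL : StrictMono L) (hL0 : 0 < L 0) (hB : 1 ≤ B) (hδ : Continuous δ)
    (hδ0 : ∀ q, 0 < δ q) (hc : Compressed B δ c) :
    ContinuousOn (ups L B c) {w | B * L 20 < ‖w‖} := by
  intro w hw
  apply ContinuousAt.continuousWithinAt
  rcases lt_or_ge (B * ‖w.2‖) ‖w.1‖ with hb | hb
  · exact continuousAt_id.congr (ups_core_ev L B c w hb).symm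
  · have hs := noncore hB w hw hb
    have hne : w.2 ≠ 0 := by
      rw [← norm_pos_iff]; exact (hL0.trans (hL (by norm_num))).trans hs
    by_cases hsl : -w.2 ∈ Complex.slitPlane
    · refine ContinuousAt.congr ?_ (ups_far_ev hL hL0 hc w hs).symm
      have h6 : 6 < (cc L w).1.2 := by
        show 6 < L.symm ‖w.2‖
        rw [← hL.lt_iff_lt, L.apply_symm_apply]
        exact lt_of_le_of_lt (hL.monotone (by norm_num)) hs
      have : {p : (W × ℝ) × ℝ | 6 ≤ p.1.2} ∈ 𝓝 (cc L w) := by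
        have ho : IsOpen {p : (W × ℝ) × ℝ | 6 < p.1.2} := isOpen_lt (by fun_prop) (by fun_prop)
        filter_upwards [ho.mem_nhds h6] with x hx
        exact le_of_lt hx
      exact (bk_cont L).continuousAt.comp ((hc.cont.continuousAt this).comp (cc_cont L w hne hsl))
    · rw [Complex.mem_slitPlane_iff] at hsl
      push Not at hsl
      have h2 : w.2 = ((w.2.re : ℝ) : ℂ) := by
        apply Complex.ext
        · simp
        · simpa using hsl.2
      have h1 : 0 ≤ w.2.re := by simpa using hsl.1
      have h3 : 0 < w.2.re := lt_of_le_of_ne h1 fun h0 => hne (by rw [h2, ← h0]; simp)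
      exact continuousAt_id.congr (ups_zero_ev hL hL0 hδ hδ0 hc w hs _ h3 h2).symm

theorem ups_inv (hL : StrictMono L) (hL0 : 0 < L 0) (hB : 1 ≤ B) (hδ0 : ∀ q, 0 < δ q)
    (hc : Compressed B δ c) {c' : (W × ℝ) × ℝ → (W × ℝ) × ℝ} (hc' : Compressed B δ c')
    (inv : ∀ p, 6 ≤ p.1.2 → c' (c p) = p) (w : W × ℂ) (hw : B * L 20 < ‖w‖) :
    ups L B c' (ups L B c w) = w := by
  rcases le_or_gt (B * ‖w.2‖) ‖w.1‖ with hb | hb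
  · rw [ups_core L B c w hb, ups_core L B c' w hb]
  have hs := noncore hB w hw hb.le
  have hpos : 0 < ‖w.2‖ := (hL0.trans (hL (by norm_num))).trans hs
  have hne : w.2 ≠ 0 := norm_pos_iff.1 hpos
  have hs6 : L 6 ≤ ‖w.2‖ := (hL (by norm_num)).le.trans hs.le
  have hsC : 20 < (cc L w).1.2 := by
    show 20 < L.symm ‖w.2‖
    rw [← hL.lt_iff_lt, L.apply_symm_apply]; exact hs
  obtain ⟨u0, u1⟩ := cc_u L w
  rw [ups_far hL hL0 hc w hs6]
  rcases u1.lt_or_eq with u1 | u1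
  · have h1 := hc.s (cc L w) (by linarith)
    rw [div_le_iff₀ (by norm_num)] at h1
    have hs' : 6 ≤ (c (cc L w)).1.2 := by linarith
    have hLp : 0 < L (c (cc L w)).1.2 := hL0.trans_le (hL.monotone (by linarith))
    have huu := hc.u (cc L w) u0 u1
    rw [ups_far hL hL0 hc', cc_bk L _ hLp huu.1 huu.2, inv _ (by linarith), bk_cc L w hne]
    rw [bk_norm L _ hLp.le]; exact hL.monotone hs'
  · have h1 : c (cc L w) = cc L w := hc.hi _ (by rw [u1]; linarith [hδ0 (cc L w).1])
    have h2 : c' (cc L w) = cc L w := hc'.hi _ (by rw [u1]; linarith [hδ0 (cc L w).1])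
    rw [h1, bk_cc L w hne, ups_far hL hL0 hc' w hs6, h2, bk_cc L w hne]

theorem ups_tendsto (hL : StrictMono L) (hL0 : 0 < L 0) (hB : 1 ≤ B) (hc : Compressed B δ c) :
    Tendsto (ups L B c) (Bornology.cobounded (W × ℂ)) (Bornology.cobounded (W × ℂ)) := by
  rw [← tendsto_norm_atTop_iff_cobounded, tendsto_atTop]
  intro R'
  let s' : ℝ := max 0 (L.symm R')
  let s1 : ℝ := max 20 (5/2 * s' + 2)
  have e1 : ∀ᶠ w in Bornology.cobounded (W × ℂ), max R' (B * L s1) < ‖w‖ :=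
    tendsto_norm_cobounded_atTop.eventually (eventually_gt_atTop _)
  filter_upwards [e1] with w hw
  rcases le_or_gt (B * ‖w.2‖) ‖w.1‖ with hb | hb
  · rw [ups_core L B c w hb]; exact (le_max_left _ _).trans hw.le
  have hs := noncore hB w ((le_max_right _ _).trans_lt hw) hb.le
  have hsC : s1 < (cc L w).1.2 := by
    show s1 < L.symm ‖w.2‖
    rw [← hL.lt_iff_lt, L.apply_symm_apply]; exact hs
  have g1 : 20 ≤ s1 := le_max_left _ _
  have g2 : 5/2 * s' + 2 ≤ s1 := le_max_right _ _
  have g3 : 0 ≤ s' := le_max_left _ _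
  have g4 : L.symm R' ≤ s' := le_max_right _ _
  rw [ups_far hL hL0 hc w ((hL.monotone (by linarith)).trans hs.le)]
  have h1 := hc.s (cc L w) (by linarith)
  rw [div_le_iff₀ (by norm_num)] at h1
  have hs' : s' ≤ (c (cc L w)).1.2 := by linarith
  have hLp : 0 < L (c (cc L w)).1.2 := hL0.trans_le (hL.monotone (by linarith))
  refine le_trans ?_ (norm_snd_le (bk L (c (cc L w))))
  rw [bk_norm L _ hLp.le, ← L.apply_symm_apply R']
  exact hL.monotone (g4.trans hs')

/-- Main result on the book decomposition. -/
theorem book [FiniteDimensional ℝ W] (hd : 2 ≤ Module.finrank ℝ W) (R B : ℝ) (hB : 1 ≤ B)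
    (θ : (W × ℂ) ≃ₜ (W × ℂ)) (hid : CoreId R B θ) (hav : Avoid R θ) :
    ∃ (Y Y' : W × ℂ → W × ℂ) (R₁ : ℝ), R ≤ R₁ ∧
      ContinuousOn Y {w | R₁ < ‖w‖} ∧ ContinuousOn Y' {w | R₁ < ‖w‖} ∧
      Tendsto Y (Bornology.cobounded (W × ℂ)) (Bornology.cobounded (W × ℂ)) ∧
      Tendsto Y' (Bornology.cobounded (W × ℂ)) (Bornology.cobounded (W × ℂ)) ∧
      (∀ w, R₁ < ‖w‖ → Y' (Y w) = w) ∧ (∀ w, R₁ < ‖w‖ → Y (Y' w) = w) ∧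
      (∀ w : W × ℂ, R₁ < ‖w‖ → ∀ r : ℝ, 0 ≤ r → w.2 = (r : ℂ) → Y =ᶠ[𝓝 w] id) ∧
      (∀ w : W × ℂ, R₁ < ‖w‖ → ∀ r : ℝ, r < 0 → w.2 = (r : ℂ) → Y =ᶠ[𝓝 w] θ) := by
  obtain ⟨L, hL, hR, hL0, hr, hr'⟩ := exists_radial θ R B hB hid
  obtain ⟨g, g', hp, hg, -⟩ := exists_liftPair hd L hL R B hB hR hL0 θ hid hr hr' hav
  obtain ⟨c, c', δ, hδ, hδ0, hc, hc', inv, inv', hhalf⟩ := exists_compr hB hp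
  have h20 : L 0 < L 20 := hL (by norm_num)
  have hRR : R ≤ B * L 20 := by nlinarith
  refine ⟨ups L B c, ups L B c', B * L 20, hRR, ups_cont hL hL0 hB hδ hδ0 hc,
    ups_cont hL hL0 hB hδ hδ0 hc', ups_tendsto hL hL0 hB hc, ups_tendsto hL hL0 hB hc',
    ups_inv hL hL0 hB hδ0 hc hc' inv, ups_inv hL hL0 hB hδ0 hc' hc inv', ?_, ?_⟩
  · intro w hw r hr hwr
    rcases lt_or_ge (B * ‖w.2‖) ‖w.1‖ with hb | hb
    · exact ups_core_ev L B c w hb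
    · have hs := noncore hB w hw hb
      refine ups_zero_ev hL hL0 hδ hδ0 hc w hs r (lt_of_le_of_ne hr ?_) hwr
      rintro rfl
      rw [hwr] at hs
      simp at hs; linarith
  · intro w hw r hr hwr
    rcases lt_or_ge (B * ‖w.2‖) ‖w.1‖ with hb | hb
    · have hn : ‖w‖ = ‖w.1‖ := by
        rw [Prod.norm_def, max_eq_left]; nlinarith [norm_nonneg w.2]
      have ho : IsOpen {w : W × ℂ | B * ‖w.2‖ < ‖w.1‖ ∧ B * L 20 < ‖w.1‖} :=
        (isOpen_lt (by fun_prop : Continuous fun w : W × ℂ => B * ‖w.2‖) (by fun_prop)).inter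
          (isOpen_lt continuous_const (by fun_prop : Continuous fun w : W × ℂ => ‖w.1‖))
      filter_upwards [ups_core_ev L B c w hb, ho.mem_nhds ⟨hb, hn ▸ hw⟩] with x h1 h2
      rw [h1, hid x (hRR.trans h2.2.le) h2.1.le]; rfl
    · have hs := noncore hB w hw hb
      have hne : w.2 ≠ 0 := by
        rw [← norm_pos_iff]; exact (hL0.trans (hL (by norm_num))).trans hs
      have hneg : -w.2 = ((-r : ℝ) : ℂ) := by rw [hwr]; push_cast; rfl
      have hsl : -w.2 ∈ Complex.slitPlane := by
        rw [hneg]; exact Complex.ofReal_mem_slitPlane.2 (by linarith)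
      have hsC : 20 < (cc L w).1.2 := by
        show 20 < L.symm ‖w.2‖
        rw [← hL.lt_iff_lt, L.apply_symm_apply]; exact hs
      have hu : (cc L w).2 = 1/2 := by
        simp only [cc]; rw [hneg, Complex.arg_ofReal_of_nonneg (by linarith)]; simp
      have hcg := (cc_cont L w hne hsl).eventually (hhalf (cc L w) (by linarith) hu)
      have h2 : ∀ᶠ x : W × ℂ in 𝓝 w, x.2 ≠ 0 :=
        (continuous_snd.continuousAt (x := w)).eventually_ne hne
      have h3 : ∀ᶠ x : W × ℂ in 𝓝 w, 2 < (cc L x).1.2 := by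
        have : ContinuousAt (fun x => (cc L x).1.2) w :=
          ContinuousAt.comp (f := fun x => (cc L x).1) (by fun_prop) (cc_q_cont L w hne)
        exact this.eventually (lt_mem_nhds (by linarith))
      filter_upwards [ups_far_ev hL hL0 hc w hs, hcg, h2, h3] with x e1 e2 e3 e4
      rw [e1, e2, (hg.2 _ e4.le).1, bk_cc L x e3]

end Ups

open Filter Topology

section MTT
variable {W : Type*} [NormedAddCommGroup W] [NormedSpace ℝ W]

/-- complex coordinates -/
noncomputable def cplx : ((W × ℝ) × ℝ) ≃ₜ (W × ℂ) where
  toFun w := (w.1.1, ⟨w.2, w.1.2⟩)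
  invFun w := ((w.1, w.2.im), w.2.re)
  left_inv w := rfl
  right_inv w := rfl
  continuous_toFun := by
    have h : Continuous fun w : (W × ℝ) × ℝ => Complex.equivRealProdCLM.symm (w.2, w.1.2) := by
      fun_prop
    exact (continuous_fst.comp continuous_fst).prodMk h
  continuous_invFun := by
    have h1 := Complex.continuous_re
    have h2 := Complex.continuous_im
    fun_prop

theorem cplx_norm (w : (W × ℝ) × ℝ) : ‖w‖ ≤ ‖cplx w‖ := by
  have h1 : ‖w.1.1‖ ≤ ‖cplx w‖ := norm_fst_le (cplx w)
  have h0 : ‖(cplx w).2‖ ≤ ‖cplx w‖ := norm_snd_le (cplx w)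
  have h2 : |w.2| ≤ ‖cplx w‖ := (Complex.abs_re_le_norm (cplx w).2).trans h0
  have h3 : |w.1.2| ≤ ‖cplx w‖ := (Complex.abs_im_le_norm (cplx w).2).trans h0
  rw [Prod.norm_def, Prod.norm_def]
  exact max_le (max_le h1 h3) h2

/-- reflection of the last coordinate -/
noncomputable def rfx : ((W × ℝ) × ℝ) ≃ₜ ((W × ℝ) × ℝ) where
  toFun w := (w.1, -w.2)
  invFun w := (w.1, -w.2)
  left_inv w := by simp
  right_inv w := by simp
  continuous_toFun := by fun_prop
  continuous_invFun := by fun_prop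

theorem rad_rfx (w : (W × ℝ) × ℝ) : rad (rfx w) = rad w := by
  simp [rad, rfx]

theorem norm_le_rad (w : (W × ℝ) × ℝ) (h : w.1.2 = 0) : ‖w‖ ≤ rad w := by
  rw [Prod.norm_def, Prod.norm_def, h, norm_zero]
  unfold rad
  refine max_le (max_le ?_ (Real.sqrt_nonneg _)) ?_
  · exact Real.le_sqrt_of_sq_le (by nlinarith [sq_nonneg w.2])
  · apply Real.le_sqrt_of_sq_le
    rw [Real.norm_eq_abs, sq_abs]; nlinarith [sq_nonneg ‖w.1.1‖]

theorem fst_le_rad (w : (W × ℝ) × ℝ) : ‖w.1.1‖ ≤ rad w :=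
  Real.le_sqrt_of_sq_le (by nlinarith [sq_nonneg w.2])

theorem snd_le_rad (w : (W × ℝ) × ℝ) : |w.2| ≤ rad w :=
  Real.le_sqrt_of_sq_le (by rw [sq_abs]; nlinarith [sq_nonneg ‖w.1.1‖])

theorem homeo_cob {E F : Type*} [NormedAddCommGroup E] [NormedAddCommGroup F] [ProperSpace E]
    [ProperSpace F] (h : E ≃ₜ F) : Tendsto h (Bornology.cobounded E) (Bornology.cobounded F) := by
  rw [Metric.cobounded_eq_cocompact, Metric.cobounded_eq_cocompact]
  exact h.isClosedEmbedding.tendsto_cocompact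

theorem mtt [FiniteDimensional ℝ W] (hd : 2 ≤ Module.finrank ℝ W)
    (φ : OpenPartialHomeomorph ((W × ℝ) × ℝ) ((W × ℝ) × ℝ)) (ε μ ν : ℝ) (hε : 0 < ε)
    (hμ : 1 < μ) (hν : 1 < ν)
    (hsrc : ∀ w : (W × ℝ) × ℝ, 0 < rad w → |w.1.2| < ε * rad w → w ∈ φ.source)
    (heq : ∀ w : (W × ℝ) × ℝ, 0 < rad w → |w.1.2| < ε * rad w → φ (μ • w) = ν • φ w) :
    ∃ (Γ Γ' : (W × ℝ) × ℝ → (W × ℝ) × ℝ) (R : ℝ), 0 < R ∧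
      ContinuousOn Γ {w | R < ‖w‖} ∧
      Tendsto Γ (Bornology.cobounded _) (Bornology.cobounded _) ∧
      Tendsto Γ' (Bornology.cobounded _) (Bornology.cobounded _) ∧
      (∀ w, R < ‖w‖ → Γ' (Γ w) = w) ∧
      (∀ᶠ w in Bornology.cobounded _, Γ (Γ' w) = w) ∧
      (∀ w : (W × ℝ) × ℝ, R < ‖w‖ → w.1.2 = 0 → Γ =ᶠ[𝓝 w] φ) := by
  have : ProperSpace W := FiniteDimensional.proper ℝ W
  obtain ⟨Gp, Rp, hRp, hGp⟩ := widen hd φ ε μ ν hε hμ hν hsrc heq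
  obtain ⟨Gm0, Rm, hRm, hGm0⟩ := widen hd (rfx.toOpenPartialHomeomorph.trans φ) ε μ ν hε hμ hν
    (by
      intro w h1 h2
      simp only [OpenPartialHomeomorph.trans_source, Homeomorph.toOpenPartialHomeomorph_source,
        Set.univ_inter, Set.mem_preimage, Homeomorph.toOpenPartialHomeomorph_apply]
      exact hsrc _ (by rwa [rad_rfx]) (by rwa [rad_rfx]))
    (by
      intro w h1 h2
      have h3 := heq (rfx w) (by rwa [rad_rfx]) (by rwa [rad_rfx])
      have h4 : rfx (μ • w) = μ • rfx w := by simp [rfx, Prod.ext_iff]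
      simp only [OpenPartialHomeomorph.coe_trans, Function.comp,
        Homeomorph.toOpenPartialHomeomorph_apply]
      rw [h4, h3])
  set Gm := rfx.trans Gm0 with hGmdef
  have hGm : ∀ w : (W × ℝ) × ℝ, Rm ≤ rad w → w.2 ≤ rad w / 2 → |w.1.2| ≤ ε / 16 * rad w →
      Gm w = φ w := by
    intro w h1 h2 h3
    have := hGm0 (rfx w) (by rwa [rad_rfx]) (by rw [rad_rfx]; show _ ≤ -w.2; linarith)
      (by rwa [rad_rfx])
    simp only [OpenPartialHomeomorph.coe_trans, Function.comp,
        Homeomorph.toOpenPartialHomeomorph_apply] at this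
    rw [hGmdef, Homeomorph.trans_apply, this]
    congr 1; simp [rfx]
  clear_value Gm
  set R := max Rp Rm with hR
  have hR1 : Rp ≤ R := le_max_left _ _
  have hR2 : Rm ≤ R := le_max_right _ _
  clear_value R
  have hR3 : 1 ≤ R := by linarith
  set B := 2 + 16 / ε with hB
  have hB2 : 2 ≤ B := by have : 0 < 16 / ε := by positivity
                         linarith
  have hB3 : 1 ≤ ε / 16 * B := by rw [hB]; field_simp; linarith
  clear_value B
  obtain ⟨Y, Y', R₁, hRR, hYc, -, hYt, hYt', hYY', hY'Y, hY0, hY1⟩ := book hd R B (by linarith)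
    (cplx.symm.trans (Gm.trans (Gp.symm.trans cplx)))
    (by
      intro w h1 h2
      have hr : ‖w.1‖ ≤ rad (cplx.symm w) := fst_le_rad (cplx.symm w)
      have hz := norm_nonneg w.2
      have hx : |(cplx.symm w).2| ≤ ‖w.2‖ := Complex.abs_re_le_norm w.2
      have ht : |(cplx.symm w).1.2| ≤ ‖w.2‖ := Complex.abs_im_le_norm w.2
      have hx' := abs_le.1 hx
      have ht3 : |(cplx.symm w).1.2| ≤ ε / 16 * rad (cplx.symm w) := by
        calc _ ≤ ‖w.2‖ := ht
          _ ≤ (ε / 16 * B) * ‖w.2‖ := by nlinarith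
          _ = ε / 16 * (B * ‖w.2‖) := by ring
          _ ≤ _ := by gcongr; linarith
      simp only [Homeomorph.trans_apply]
      rw [hGm _ (by linarith) (by nlinarith) ht3, ← hGp _ (by linarith) (by nlinarith) ht3]
      simp)
    (by
      intro w r r' hr hr' h0 h0' hw hc
      simp only [Homeomorph.trans_apply] at hc
      set z := Gp.symm (Gm (cplx.symm w)) with hz
      have hz' : Gp z = Gm (cplx.symm w) := by rw [hz]; simp
      have z1 : z.2 = r' := congrArg Complex.re hc
      have z2 : z.1.2 = 0 := congrArg Complex.im hc
      have w1 : (cplx.symm w).2 = -r := by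
        show w.2.re = _
        rw [hw]; simp
      have w2 : (cplx.symm w).1.2 = 0 := by
        show w.2.im = _
        rw [hw]; simp
      have s1 := snd_le_rad z
      have s2 := snd_le_rad (cplx.symm w)
      rw [z1, abs_of_pos h0'] at s1
      rw [w1, abs_neg, abs_of_pos h0] at s2
      have rz : 0 < rad z := by linarith
      have rw' : 0 < rad (cplx.symm w) := by linarith
      rw [hGp z (by linarith) (by linarith) (by rw [z2, abs_zero]; positivity),
        hGm _ (by linarith) (by linarith) (by rw [w2, abs_zero]; positivity)] at hz'
      have := φ.injOn (hsrc z rz (by rw [z2, abs_zero]; positivity))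
        (hsrc _ rw' (by rw [w2, abs_zero]; positivity)) hz'
      rw [this] at z1
      linarith)
  have hcn : ∀ w : (W × ℝ) × ℝ, R₁ < ‖w‖ → R₁ < ‖cplx w‖ := fun w h => h.trans_le (cplx_norm w)
  have tc := homeo_cob (cplx : ((W × ℝ) × ℝ) ≃ₜ (W × ℂ))
  have tcs := homeo_cob (cplx : ((W × ℝ) × ℝ) ≃ₜ (W × ℂ)).symm
  refine ⟨fun w => Gp (cplx.symm (Y (cplx w))), fun w => cplx.symm (Y' (cplx (Gp.symm w))), R₁,
    by linarith, ?_, ?_, ?_, ?_, ?_, ?_⟩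
  · exact (Gp.continuous.comp cplx.symm.continuous).comp_continuousOn
      (hYc.comp cplx.continuous.continuousOn hcn)
  · exact (homeo_cob Gp).comp (tcs.comp (hYt.comp tc))
  · exact tcs.comp (hYt'.comp (tc.comp (homeo_cob Gp.symm)))
  · intro w hw
    simp [hYY' _ (hcn w hw)]
  · have h1 : ∀ᶠ w in Bornology.cobounded (W × ℂ), R₁ < ‖w‖ :=
      tendsto_norm_cobounded_atTop.eventually_gt_atTop R₁
    filter_upwards [(tc.comp (homeo_cob Gp.symm)).eventually h1] with w hw
    have := hY'Y _ hw
    simp only [Function.comp] at this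
    simp [this]
  · intro w hw ht
    have hrw := norm_le_rad w ht
    have hr0 : 0 < rad w := by linarith
    have hc2 : (cplx w).2 = (w.2 : ℂ) := by
      apply Complex.ext
      · rfl
      · simpa [cplx] using ht
    have ho : ∀ᶠ x in 𝓝 w, R < rad x ∧ |x.1.2| < ε / 16 * rad x := by
      have hrc : Continuous (rad : (W × ℝ) × ℝ → ℝ) := rad_cont
      refine ((isOpen_lt continuous_const hrc).inter
        (isOpen_lt (f := fun x : (W × ℝ) × ℝ => |x.1.2|) (by fun_prop)
          (continuous_const.mul hrc))).mem_nhds ⟨?_, ?_⟩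
      · show R < rad w
        linarith
      · show |w.1.2| < ε / 16 * rad w
        rw [ht, abs_zero]; positivity
    rcases le_or_gt 0 w.2 with hx | hx
    · have e1 := cplx.continuous.continuousAt.eventually (hY0 (cplx w) (hcn w hw) w.2 hx hc2)
      have hx' : ∀ᶠ x in 𝓝 w, - rad x / 2 < x.2 := by
        have hrc : Continuous (rad : (W × ℝ) × ℝ → ℝ) := rad_cont
        refine (isOpen_lt (hrc.neg.div_const 2) continuous_snd).mem_nhds ?_
        show - rad w / 2 < w.2
        linarith
      filter_upwards [e1, ho, hx'] with x h1 h2 h3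
      rw [h1]
      simp only [id, Homeomorph.symm_apply_apply]
      exact hGp x (by linarith) (by linarith) h2.2.le
    · have e1 := cplx.continuous.continuousAt.eventually (hY1 (cplx w) (hcn w hw) w.2 hx hc2)
      have hx' : ∀ᶠ x in 𝓝 w, x.2 < rad x / 2 := by
        have hrc : Continuous (rad : (W × ℝ) × ℝ → ℝ) := rad_cont
        refine (isOpen_lt continuous_snd (hrc.div_const 2)).mem_nhds ?_
        show w.2 < rad w / 2
        linarith
      filter_upwards [e1, ho, hx'] with x h1 h2 h3
      rw [h1]
      simp only [Homeomorph.trans_apply, Homeomorph.symm_apply_apply, Homeomorph.apply_symm_apply]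
      exact hGm x (by linarith) (by linarith) h2.2.le

end MTT

open Filter Topology

section Good
variable {X Y Z : Type*} [TopologicalSpace X] [TopologicalSpace Y] [TopologicalSpace Z]

/-- `f` is continuous and injective near `x` and open at `x`. -/
structure GoodAt (f : X → Y) (x : X) : Prop where
  cont : ∀ᶠ y in 𝓝 x, ContinuousAt f y
  inj : ∃ u ∈ 𝓝 x, Set.InjOn f u
  map : map f (𝓝 x) = 𝓝 (f x)

theorem GoodAt.comp {f : X → Y} {g : Y → Z} {x : X} (hg : GoodAt g (f x)) (hf : GoodAt f x) :
    GoodAt (g ∘ f) x := by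
  refine ⟨?_, ?_, ?_⟩
  · filter_upwards [hf.cont, hf.cont.self_of_nhds.eventually hg.cont] with y h1 h2
    exact h2.comp h1
  · obtain ⟨u, hu, hu'⟩ := hf.inj
    obtain ⟨v, hv, hv'⟩ := hg.inj
    refine ⟨u ∩ f ⁻¹' v, inter_mem hu (hf.cont.self_of_nhds hv), ?_⟩
    exact hv'.comp (hu'.mono Set.inter_subset_left) (fun y hy => hy.2)
  · rw [← Filter.map_map, hf.map, hg.map]; rfl

theorem GoodAt.congr {f g : X → Y} {x : X} (hf : GoodAt f x) (h : g =ᶠ[𝓝 x] f) : GoodAt g x := by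
  refine ⟨?_, ?_, ?_⟩
  · filter_upwards [hf.cont, h.eventuallyEq_nhds] with y h1 h2
    exact h1.congr h2.symm
  · obtain ⟨u, hu, hu'⟩ := hf.inj
    refine ⟨u ∩ {y | g y = f y}, inter_mem hu h, ?_⟩
    intro a ha b hb hab
    refine hu' ha.1 hb.1 ?_
    have h1 : g a = f a := ha.2
    have h2 : g b = f b := hb.2
    rw [← h1, ← h2, hab]
  · rw [Filter.map_congr h, hf.map, h.self_of_nhds]

theorem GoodAt.of_emb {f : X → Y} (hf : IsOpenEmbedding f) (x : X) : GoodAt f x :=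
  ⟨Eventually.of_forall fun _ => hf.continuous.continuousAt,
    ⟨Set.univ, univ_mem, hf.injective.injOn⟩, hf.map_nhds_eq x⟩

theorem GoodAt.of_inv {f : X → Y} {x : X} {y : Y} (g : Y → X) (hy : f x = y)
    (hc : ∀ᶠ z in 𝓝 x, ContinuousAt f z)
    (hg : ContinuousAt g y) (h1 : ∀ᶠ z in 𝓝 x, g (f z) = z) (h2 : ∀ᶠ z in 𝓝 y, f (g z) = z) :
    GoodAt f x := by
  subst hy
  refine ⟨hc, ⟨_, h1, ?_⟩, le_antisymm hc.self_of_nhds ?_⟩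
  · intro a ha b hb hab
    have ha' : g (f a) = a := ha
    have hb' : g (f b) = b := hb
    rw [← ha', ← hb', hab]
  · have e : Filter.map (f ∘ g) (𝓝 (f x)) = 𝓝 (f x) := by
      exact (Filter.map_congr (m₁ := f ∘ g) (m₂ := id) h2).trans Filter.map_id
    have hg' : Tendsto g (𝓝 (f x)) (𝓝 x) := by
      have := hg.tendsto
      rwa [h1.self_of_nhds] at this
    calc 𝓝 (f x) = Filter.map f (Filter.map g (𝓝 (f x))) := by rw [Filter.map_map, e]
      _ ≤ Filter.map f (𝓝 x) := Filter.map_mono hg'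

theorem GoodAt.of_comp {i : X → Y} {f : Y → Z} (hi : IsOpenEmbedding i) {x : X}
    (h : GoodAt (f ∘ i) x) : GoodAt f (i x) := by
  refine ⟨?_, ?_, ?_⟩
  · rw [← hi.map_nhds_eq, eventually_map]
    filter_upwards [h.cont] with y hy
    exact hi.continuousAt_iff.1 hy
  · obtain ⟨u, hu, hu'⟩ := h.inj
    refine ⟨i '' u, hi.image_mem_nhds.2 hu, ?_⟩
    rintro _ ⟨a, ha, rfl⟩ _ ⟨b, hb, rfl⟩ hab
    rw [hu' ha hb hab]
  · rw [← hi.map_nhds_eq, Filter.map_map, h.map]; rfl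

/-- Thin collars. -/
theorem collar [CompactSpace X] [T2Space Y] (f : X × ℝ → Y) (hg : ∀ x, GoodAt f (x, 0))
    (hi : Function.Injective fun x => f (x, 0)) (O : Set Y) (hO : IsOpen O)
    (hfO : ∀ x, f (x, 0) ∈ O) :
    ∃ e : X × Set.Icc (-1 : ℝ) 1 → Y, IsClosedEmbedding e ∧ (∀ p, e p ∈ O) ∧
      (∀ x (s : Set.Icc (-1 : ℝ) 1), (s : ℝ) = 0 → e (x, s) = f (x, 0)) ∧
      ∀ x, f (x, 0) ∈ interior (Set.range e) := by
  have hc : IsCompact ((Set.univ : Set X) ×ˢ ({0} : Set ℝ)) := isCompact_univ.prod isCompact_singleton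
  have hmem : ∀ p ∈ ((Set.univ : Set X) ×ˢ ({0} : Set ℝ)), GoodAt f p := by
    rintro ⟨x, s⟩ ⟨-, hs⟩
    obtain rfl : s = 0 := hs
    exact hg x
  have hmem2 : ∀ p ∈ ((Set.univ : Set X) ×ˢ ({0} : Set ℝ)), f p ∈ O := by
    rintro ⟨x, s⟩ ⟨-, hs⟩
    obtain rfl : s = 0 := hs
    exact hfO x
  obtain ⟨t1, ht1, hinj⟩ := Set.InjOn.exists_mem_nhdsSet (f := f) (s := Set.univ ×ˢ {0}) (by
      rintro ⟨x, s⟩ ⟨-, hs⟩ ⟨y, s'⟩ ⟨-, hs'⟩ h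
      obtain rfl : s = 0 := hs
      obtain rfl : s' = 0 := hs'
      rw [hi h]) hc (fun p hp => (hmem p hp).cont.self_of_nhds) (fun p hp => (hmem p hp).inj)
  have ht2 : ∀ᶠ p in 𝓝ˢ ((Set.univ : Set X) ×ˢ ({0} : Set ℝ)), ContinuousAt f p ∧ f p ∈ O := by
    rw [Filter.Eventually, mem_nhdsSet_iff_forall]
    intro p hp
    exact (hmem p hp).cont.and ((hmem p hp).cont.self_of_nhds (hO.mem_nhds (hmem2 p hp)))
  have ht := inter_mem ht1 ht2
  rw [isCompact_univ.nhdsSet_prod_eq isCompact_singleton, nhdsSet_univ, nhdsSet_singleton,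
    mem_prod_iff] at ht
  obtain ⟨u, hu, v, hv, huv⟩ := ht
  obtain rfl : u = Set.univ := by simpa using hu
  obtain ⟨δ, hδ, hδv⟩ := Metric.mem_nhds_iff.1 hv
  have key : ∀ (x : X) (s : ℝ), |s| < δ → (x, s) ∈ t1 ∧ ContinuousAt f (x, s) ∧ f (x, s) ∈ O := by
    intro x s hs
    have hs' : s ∈ Metric.ball (0 : ℝ) δ := by simpa using hs
    have := huv (Set.mk_mem_prod (Set.mem_univ x) (hδv hs'))
    exact ⟨this.1, this.2⟩
  have hab : ∀ s : Set.Icc (-1 : ℝ) 1, |δ / 2 * (s : ℝ)| < δ := by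
    intro s
    have : |(s : ℝ)| ≤ 1 := abs_le.2 s.2
    rw [abs_mul, abs_of_pos (by positivity)]
    nlinarith
  refine ⟨fun p => f (p.1, δ / 2 * p.2), ?_, ?_, ?_, ?_⟩
  · refine Continuous.isClosedEmbedding ?_ ?_
    · rw [continuous_iff_continuousAt]
      intro p
      have h1 := (key p.1 _ (hab p.2)).2.1
      exact ContinuousAt.comp (f := fun p : X × Set.Icc (-1 : ℝ) 1 => (p.1, δ / 2 * (p.2 : ℝ))) h1
        (by fun_prop)
    · rintro ⟨x, s⟩ ⟨y, s'⟩ h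
      have := hinj (key x _ (hab s)).1 (key y _ (hab s')).1 h
      rw [Prod.mk.injEq] at this
      refine Prod.ext this.1 (Subtype.ext ?_)
      exact mul_left_cancel₀ (by positivity) this.2
  · intro p
    exact (key p.1 _ (hab p.2)).2.2
  · intro x s hs
    simp [hs]
  · intro x
    rw [mem_interior_iff_mem_nhds, ← (hg x).map, mem_map]
    have hU : {p : X × ℝ | |p.2| < δ / 2} ∈ 𝓝 (x, (0 : ℝ)) :=
      (isOpen_lt (f := fun p : X × ℝ => |p.2|) (by fun_prop) continuous_const).mem_nhds (by
        show |(0 : ℝ)| < δ / 2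
        rw [abs_zero]; positivity)
    filter_upwards [hU] with p hp
    have hp' : |p.2| < δ / 2 := hp
    have h3 : |p.2 / (δ / 2)| ≤ 1 := by
      rw [abs_div, abs_of_pos (by positivity : (0 : ℝ) < δ / 2), div_le_one (by positivity)]
      exact hp'.le
    refine ⟨(p.1, ⟨p.2 / (δ / 2), abs_le.1 h3⟩), ?_⟩
    show f (p.1, δ / 2 * (p.2 / (δ / 2))) = f p
    congr 1
    refine Prod.ext rfl ?_
    show δ / 2 * (p.2 / (δ / 2)) = p.2
    field_simp

end Good

section Inv
variable {E : Type*} [NormedAddCommGroup E] [NormedSpace ℝ E]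

/-- inversion -/
noncomputable def nv (z : E) : E := (‖z‖ ^ 2)⁻¹ • z

theorem nv_zero : nv (0 : E) = 0 := by simp [nv]

theorem norm_nv (z : E) : ‖nv z‖ = ‖z‖⁻¹ := by
  unfold nv
  rw [norm_smul, norm_inv, norm_pow, norm_norm]
  rcases eq_or_ne ‖z‖ 0 with h | h
  · simp [h]
  · field_simp

theorem nv_nv (z : E) : nv (nv z) = z := by
  rcases eq_or_ne z 0 with rfl | h
  · simp [nv_zero]
  · have h' : ‖z‖ ≠ 0 := norm_ne_zero_iff.2 h
    have e : nv (nv z) = (‖nv z‖ ^ 2)⁻¹ • nv z := rfl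
    rw [e, norm_nv]
    unfold nv
    rw [smul_smul]
    have : ((‖z‖⁻¹ ^ 2)⁻¹ * (‖z‖ ^ 2)⁻¹) = 1 := by field_simp
    rw [this, one_smul]

theorem nv_ne (z : E) (h : z ≠ 0) : nv z ≠ 0 := by
  rw [← norm_ne_zero_iff, norm_nv]; exact inv_ne_zero (norm_ne_zero_iff.2 h)

theorem nv_smul (c : ℝ) (hc : c ≠ 0) (z : E) : nv (c • z) = c⁻¹ • nv z := by
  unfold nv
  rw [norm_smul, mul_pow, Real.norm_eq_abs, sq_abs, smul_smul, smul_smul]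
  congr 1
  rw [mul_inv]
  field_simp

theorem nv_contAt (z : E) (h : z ≠ 0) : ContinuousAt (nv : E → E) z := by
  have h' : ‖z‖ ^ 2 ≠ 0 := pow_ne_zero _ (norm_ne_zero_iff.2 h)
  have c : ContinuousAt (fun z : E => ‖z‖ ^ 2) z := by fun_prop
  exact (c.inv₀ h').smul continuousAt_id

theorem nv_tendsto_zero : Tendsto (nv : E → E) (Bornology.cobounded E) (𝓝 0) := by
  rw [tendsto_zero_iff_norm_tendsto_zero]
  simp only [norm_nv]
  exact tendsto_inv_atTop_zero.comp tendsto_norm_cobounded_atTop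

theorem nv_tendsto_cob : Tendsto (nv : E → E) (𝓝[≠] 0) (Bornology.cobounded E) := by
  rw [← tendsto_norm_atTop_iff_cobounded]
  simp only [norm_nv]
  exact tendsto_inv_nhdsGT_zero.comp tendsto_norm_nhdsNE_zero

/-- inversion as a partial homeomorphism -/
noncomputable def nvP : OpenPartialHomeomorph E E where
  toFun := nv
  invFun := nv
  source := {0}ᶜ
  target := {0}ᶜ
  map_source' := fun z h => nv_ne z h
  map_target' := fun z h => nv_ne z h
  left_inv' := fun z _ => nv_nv z
  right_inv' := fun z _ => nv_nv z
  open_source := isOpen_compl_singleton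
  open_target := isOpen_compl_singleton
  continuousOn_toFun := fun z h => (nv_contAt z h).continuousWithinAt
  continuousOn_invFun := fun z h => (nv_contAt z h).continuousWithinAt

/-- conjugation by inversion -/
theorem good_conj (Γ Γ' : E → E) (R : ℝ) (hR : 0 < R) (hc : ContinuousOn Γ {w | R < ‖w‖})
    (ht : Tendsto Γ (Bornology.cobounded E) (Bornology.cobounded E))
    (ht' : Tendsto Γ' (Bornology.cobounded E) (Bornology.cobounded E))
    (h1 : ∀ w, R < ‖w‖ → Γ' (Γ w) = w) (h2 : ∀ᶠ w in Bornology.cobounded E, Γ (Γ' w) = w) :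
    ∃ Z : E → E, GoodAt Z 0 ∧ Z 0 = 0 ∧ ∀ z, z ≠ 0 → Z z = nv (Γ (nv z)) := by
  classical
  have cz : ∀ Γ : E → E, Tendsto Γ (Bornology.cobounded E) (Bornology.cobounded E) →
      ContinuousAt (fun z => if z = 0 then 0 else nv (Γ (nv z))) 0 := by
    intro Γ ht
    rw [continuousAt_iff_punctured_nhds]
    have h3 : Tendsto (fun z => nv (Γ (nv z))) (𝓝[≠] 0) (𝓝 0) :=
      nv_tendsto_zero.comp (ht.comp nv_tendsto_cob)
    simp only [if_true]
    refine h3.congr' ?_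
    filter_upwards [self_mem_nhdsWithin] with z hz
    exact (if_neg hz).symm
  have hne : ∀ Γ : E → E, Tendsto Γ (Bornology.cobounded E) (Bornology.cobounded E) →
      ∀ᶠ z in 𝓝[≠] 0, Γ (nv z) ≠ 0 := by
    intro Γ ht
    have : ∀ᶠ w in Bornology.cobounded E, 0 < ‖w‖ :=
      tendsto_norm_cobounded_atTop.eventually_gt_atTop 0
    filter_upwards [(ht.comp nv_tendsto_cob).eventually this] with z hz
    exact norm_pos_iff.1 hz
  have hlarge : ∀ z : E, z ≠ 0 → ‖z‖ < R⁻¹ → R < ‖nv z‖ := by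
    intro z h0 hz
    rw [norm_nv]
    exact (lt_inv_comm₀ (norm_pos_iff.2 h0) hR).1 hz
  have hball : ∀ᶠ z : E in 𝓝 0, ‖z‖ < R⁻¹ := by
    have : Metric.ball (0 : E) R⁻¹ ∈ 𝓝 0 := Metric.ball_mem_nhds 0 (inv_pos.2 hR)
    filter_upwards [this] with z hz
    simpa using hz
  refine ⟨fun z => if z = 0 then 0 else nv (Γ (nv z)), ?_, if_pos rfl, fun z hz => if_neg hz⟩
  have inv : ∀ Γ Γ' : E → E, Tendsto Γ (Bornology.cobounded E) (Bornology.cobounded E) →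
      (∀ᶠ w in Bornology.cobounded E, Γ' (Γ w) = w) →
      ∀ᶠ z in 𝓝 (0 : E), (fun z => if z = 0 then 0 else nv (Γ' (nv z)))
        ((fun z => if z = 0 then 0 else nv (Γ (nv z))) z) = z := by
    intro Γ Γ' ht hh
    have a1 := hne Γ ht
    have a2 := nv_tendsto_cob.eventually hh
    rw [eventually_nhdsWithin_iff] at a1 a2
    filter_upwards [a1, a2] with z b1 b2
    by_cases hz : z = 0
    · simp [hz]
    · have h3 : nv (Γ (nv z)) ≠ 0 := nv_ne _ (b1 hz)
      simp only [if_neg hz, if_neg h3]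
      rw [nv_nv, b2 hz, nv_nv]
  refine GoodAt.of_inv (y := 0) (fun z => if z = 0 then 0 else nv (Γ' (nv z))) (if_pos rfl) ?_
    (cz Γ' ht') (inv Γ Γ' ht ?_) (inv Γ' Γ ht' h2)
  · have a1 := hne Γ ht
    rw [eventually_nhdsWithin_iff] at a1
    filter_upwards [a1, hball] with z b1 b2
    by_cases hz : z = 0
    · rw [hz]; exact cz Γ ht
    · have h3 : ContinuousAt (fun z => nv (Γ (nv z))) z := by
        refine ContinuousAt.comp (g := nv) (nv_contAt _ (b1 hz)) ?_
        refine ContinuousAt.comp (g := Γ) ?_ (nv_contAt z hz)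
        exact hc.continuousAt ((isOpen_lt continuous_const continuous_norm).mem_nhds (hlarge z hz b2))
      refine h3.congr ?_
      filter_upwards [isOpen_compl_singleton.mem_nhds hz] with y hy
      exact (if_neg hy).symm
  · filter_upwards [tendsto_norm_cobounded_atTop.eventually_gt_atTop R] with w hw
    exact h1 w hw

/-- chart of the one-point compactification at infinity -/
theorem good_infty [ProperSpace E] : ∃ j : OnePoint E → E, j OnePoint.infty = 0 ∧
    (∀ v : E, j v = nv v) ∧ GoodAt (Prod.map j (id : ℝ → ℝ)) (OnePoint.infty, 0) := by
  classical
  have hcob : coclosedCompact E = Bornology.cobounded E := by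
    rw [coclosedCompact_eq_cocompact, Metric.cobounded_eq_cocompact]
  let j : OnePoint E → E := fun x => OnePoint.elim x (0 : E) nv
  let k : E → OnePoint E := fun u => if u = 0 then OnePoint.infty else (nv u : E)
  have j1 : ∀ v : E, j v = nv v := fun v => rfl
  have j0 : j OnePoint.infty = 0 := rfl
  have cj0 : ContinuousAt j OnePoint.infty := by
    rw [OnePoint.continuousAt_infty', hcob]
    exact nv_tendsto_zero
  have cj : ∀ᶠ x in 𝓝 (OnePoint.infty : OnePoint E), ContinuousAt j x := by
    have : ({((0 : E) : OnePoint E)}ᶜ : Set (OnePoint E)) ∈ 𝓝 OnePoint.infty :=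
      isOpen_compl_singleton.mem_nhds (OnePoint.infty_ne_coe 0)
    filter_upwards [this] with x hx
    induction x using OnePoint.rec with
    | infty => exact cj0
    | coe v =>
      rw [OnePoint.continuousAt_coe]
      refine nv_contAt v ?_
      rintro rfl
      exact hx rfl
  have ck : ContinuousAt k 0 := by
    rw [continuousAt_iff_punctured_nhds]
    have h3 : Tendsto (fun z => ((nv z : E) : OnePoint E)) (𝓝[≠] 0) (𝓝 OnePoint.infty) := by
      have : Tendsto ((↑) : E → OnePoint E) (Bornology.cobounded E) (𝓝 OnePoint.infty) := by
        rw [← hcob]; exact OnePoint.tendsto_coe_infty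
      exact this.comp nv_tendsto_cob
    have k0 : k 0 = OnePoint.infty := if_pos rfl
    rw [k0]
    refine h3.congr' ?_
    filter_upwards [self_mem_nhdsWithin] with z hz
    exact (if_neg hz).symm
  have kj : ∀ x : OnePoint E, x ≠ ((0 : E) : OnePoint E) → k (j x) = x := by
    intro x hx
    induction x using OnePoint.rec with
    | infty => exact if_pos rfl
    | coe v =>
      have : nv v ≠ 0 := nv_ne v (by rintro rfl; exact hx rfl)
      show (if nv v = 0 then _ else _) = _
      rw [if_neg this, j1, nv_nv]
  have jk : ∀ u, j (k u) = u := by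
    intro u
    by_cases hu : u = 0
    · subst hu
      show j (if (0 : E) = 0 then _ else _) = _
      rw [if_pos rfl]; rfl
    · show j (if u = 0 then _ else _) = _
      rw [if_neg hu, j1, nv_nv]
  refine ⟨j, j0, j1, GoodAt.of_inv (y := (0, 0)) (Prod.map k id) (by simp [j0]) ?_ ?_ ?_ ?_⟩
  · have := (continuousAt_fst (p := ((OnePoint.infty : OnePoint E), (0 : ℝ)))).eventually cj
    filter_upwards [this] with p hp
    exact ContinuousAt.prodMap' (x := p.1) (y := p.2) hp continuousAt_id
  · exact ContinuousAt.prodMap' ck continuousAt_id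
  · have h0 : ({((0 : E) : OnePoint E)}ᶜ : Set (OnePoint E)) ∈ 𝓝 OnePoint.infty :=
      isOpen_compl_singleton.mem_nhds (OnePoint.infty_ne_coe 0)
    have := (continuousAt_fst (p := ((OnePoint.infty : OnePoint E), (0 : ℝ)))).eventually h0
    filter_upwards [this] with p hp
    exact Prod.ext (kj _ hp) rfl
  · exact Eventually.of_forall fun p => Prod.ext (jk _) rfl

end Inv

open Filter Topology

section Dynamics

/-- A homeomorphism with a linear saddle chart `q` and a linear sink chart `p`. -/
structure Dyn {V E M : Type*} [NormedAddCommGroup V] [NormedSpace ℝ V] [NormedAddCommGroup E]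
    [NormedSpace ℝ E] [TopologicalSpace M] (g : M ≃ₜ M) (q : V × ℝ → M) (p : E → M)
    (μ ν : ℝ) : Prop where
  hμ : 1 < μ
  hν : 1 < ν
  hq : IsOpenEmbedding q
  hp : IsOpenEmbedding p
  gq : ∀ v t, g (q (v, t)) = q (μ • v, μ⁻¹ * t)
  gp : ∀ z, g (p z) = p (ν⁻¹ • z)
  hcl : closure (Set.range fun v => q (v, 0)) = (Set.range fun v => q (v, 0)) ∪ {p 0}
  nontriv : ∃ v : V, v ≠ 0

variable {V E M : Type*} [NormedAddCommGroup V] [NormedSpace ℝ V] [NormedAddCommGroup E]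
    [NormedSpace ℝ E] [TopologicalSpace M] [CompactSpace M] [T2Space M] {g : M ≃ₜ M}
    {q : V × ℝ → M} {p : E → M} {μ ν : ℝ}

theorem Dyn.iter_q (D : Dyn g q p μ ν) (k : ℕ) (v : V) (t : ℝ) :
    g^[k] (q (v, t)) = q (μ ^ k • v, (μ ^ k)⁻¹ * t) := by
  induction k with
  | zero => simp
  | succ k ih =>
    rw [Function.iterate_succ_apply', ih, D.gq, smul_smul, ← mul_assoc, pow_succ', mul_inv]

theorem Dyn.iter_p (D : Dyn g q p μ ν) (k : ℕ) (z : E) :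
    g^[k] (p z) = p ((ν⁻¹) ^ k • z) := by
  induction k with
  | zero => simp
  | succ k ih =>
    rw [Function.iterate_succ_apply', ih, D.gp, smul_smul, pow_succ']

theorem Dyn.p_back (D : Dyn g q p μ ν) (m : M) : g m ∈ Set.range p ↔ m ∈ Set.range p := by
  have hν := D.hν
  constructor
  · rintro ⟨z, hz⟩
    refine ⟨ν • z, g.injective ?_⟩
    rw [D.gp, smul_smul, inv_mul_cancel₀ (by positivity), one_smul, hz]
  · rintro ⟨z, rfl⟩
    exact ⟨_, (D.gp z).symm⟩

theorem Dyn.p_back_iter (D : Dyn g q p μ ν) (k : ℕ) (m : M) :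
    g^[k] m ∈ Set.range p ↔ m ∈ Set.range p := by
  induction k with
  | zero => simp
  | succ k ih => rw [Function.iterate_succ_apply', D.p_back, ih]

theorem Dyn.emb0 (D : Dyn g q p μ ν) : IsEmbedding fun v : V => q (v, 0) := by
  have h1 : IsEmbedding fun v : V => (v, (0 : ℝ)) := isEmbedding_prodMkLeft 0
  exact D.hq.isEmbedding.comp h1

theorem Dyn.far (D : Dyn g q p μ ν) (O : Set M) (hO : IsOpen O) (h0 : p 0 ∈ O) :
    ∃ R : ℝ, ∀ v : V, R ≤ ‖v‖ → q (v, 0) ∈ O := by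
  have hK : IsCompact (closure (Set.range fun v => q (v, 0)) \ O) :=
    (isClosed_closure.sdiff hO).isCompact
  have himg : (fun v : V => q (v, 0)) '' ((fun v : V => q (v, 0)) ⁻¹'
      (closure (Set.range fun v => q (v, 0)) \ O)) = closure (Set.range fun v => q (v, 0)) \ O := by
    rw [Set.image_preimage_eq_iff]
    rintro m ⟨hm, hmO⟩
    rw [D.hcl] at hm
    rcases hm with hm | hm
    · exact hm
    · exact absurd (by rw [Set.mem_singleton_iff.1 hm]; exact h0) hmO
  rw [← himg, ← D.emb0.isInducing.isCompact_iff] at hK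
  obtain ⟨R, hR⟩ := hK.isBounded.exists_norm_le
  refine ⟨R + 1, fun v hv => ?_⟩
  by_contra hc
  have := hR v ⟨subset_closure ⟨v, rfl⟩, hc⟩
  linarith

theorem Dyn.conn (D : Dyn g q p μ ν) (v : V) (hv : v ≠ 0) : q (v, 0) ∈ Set.range p := by
  obtain ⟨R, hR⟩ := D.far (Set.range p) D.hp.isOpen_range ⟨0, rfl⟩
  have hv' := norm_pos_iff.2 hv
  have hμ := D.hμ
  obtain ⟨k, hk⟩ := pow_unbounded_of_one_lt (R / ‖v‖) D.hμ
  rw [← D.p_back_iter k, D.iter_q, mul_zero]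
  apply hR
  rw [norm_smul, Real.norm_of_nonneg (by positivity)]
  rw [div_lt_iff₀ hv'] at hk
  exact hk.le

theorem Dyn.p_tendsto (D : Dyn g q p μ ν) (z : E) :
    Tendsto (fun k : ℕ => g^[k] (p z)) atTop (𝓝 (p 0)) := by
  simp only [D.iter_p]
  have hν := D.hν
  have h1 : Tendsto (fun k : ℕ => (ν⁻¹) ^ k) atTop (𝓝 0) :=
    tendsto_pow_atTop_nhds_zero_of_lt_one (by positivity) (inv_lt_one_of_one_lt₀ hν)
  have h2 : Tendsto (fun k : ℕ => (ν⁻¹) ^ k • z) atTop (𝓝 0) := by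
    simpa using h1.smul_const z
  exact (D.hp.continuous.tendsto 0).comp h2

theorem Dyn.q_tendsto (D : Dyn g q p μ ν) (t : ℝ) :
    Tendsto (fun k : ℕ => g^[k] (q (0, t))) atTop (𝓝 (q (0, 0))) := by
  simp only [D.iter_q, smul_zero]
  have hμ := D.hμ
  have h1 : Tendsto (fun k : ℕ => (μ⁻¹) ^ k) atTop (𝓝 0) :=
    tendsto_pow_atTop_nhds_zero_of_lt_one (by positivity) (inv_lt_one_of_one_lt₀ hμ)
  have h2 : Tendsto (fun k : ℕ => ((0 : V), (μ ^ k)⁻¹ * t)) atTop (𝓝 (0, 0)) := by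
    refine Tendsto.prodMk_nhds tendsto_const_nhds ?_
    simpa [inv_pow] using h1.mul_const t
  exact (D.hq.continuous.tendsto _).comp h2

theorem Dyn.p0 (D : Dyn g q p μ ν) : p 0 ∉ Set.range q := by
  rintro ⟨⟨v, t⟩, h⟩
  have hμ := D.hμ
  have h1 : q (μ • v, μ⁻¹ * t) = q (v, t) := by
    rw [← D.gq, h, D.gp, smul_zero]
  have h2 := D.hq.injective h1
  rw [Prod.mk.injEq] at h2
  have hv : v = 0 := by
    have h3 : (μ - 1) • v = 0 := by rw [sub_smul, one_smul, h2.1, sub_self]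
    rcases smul_eq_zero.1 h3 with h4 | h4
    · linarith
    · exact h4
  have ht : t = 0 := by
    have h3 := h2.2
    field_simp at h3
    have h4 : (μ - 1) * t = 0 := by linarith
    rcases mul_eq_zero.1 h4 with h5 | h5
    · linarith
    · exact h5
  subst hv ht
  obtain ⟨v, hv⟩ := D.nontriv
  obtain ⟨z, hz⟩ := D.conn v hv
  have h5 := D.p_tendsto z
  rw [hz, ← h] at h5
  simp only [D.iter_q, mul_zero] at h5
  have h6 : Tendsto (fun k : ℕ => μ ^ k • v) atTop (𝓝 0) := D.emb0.tendsto_nhds_iff.2 h5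
  have h7 := (tendsto_norm_zero.comp h6).eventually (gt_mem_nhds (norm_pos_iff.2 hv))
  obtain ⟨k, hk⟩ := h7.exists
  simp only [Function.comp, norm_smul, norm_pow, Real.norm_of_nonneg (by linarith : 0 ≤ μ)] at hk
  have h8 := one_le_pow₀ hμ.le (n := k)
  nlinarith [norm_nonneg v]

theorem Dyn.tube [ProperSpace V] (D : Dyn g q p μ ν) :
    ∃ c : ℝ, 0 < c ∧ ∀ (v : V) (t : ℝ), v ≠ 0 → ‖v‖ * |t| < c → q (v, t) ∈ Set.range p := by
  have hμ := D.hμ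
  have hK : IsCompact {v : V | 1 ≤ ‖v‖ ∧ ‖v‖ ≤ μ} := by
    refine (isCompact_closedBall (0 : V) μ).of_isClosed_subset ?_ ?_
    · exact (isClosed_le continuous_const continuous_norm).inter
        (isClosed_le continuous_norm continuous_const)
    · intro v hv
      simpa using hv.2
  obtain ⟨u, w, -, hw, hu, h0, huw⟩ := generalized_tube_lemma hK (isCompact_singleton (x := (0 : ℝ)))
    (D.hp.isOpen_range.preimage D.hq.continuous) (by
      rintro ⟨v, t⟩ ⟨hv, ht⟩
      obtain rfl : t = 0 := ht
      refine D.conn v ?_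
      rintro rfl
      have h1 : (1 : ℝ) ≤ ‖(0 : V)‖ := hv.1
      simp at h1
      linarith)
  obtain ⟨c, hc, hcw⟩ := Metric.isOpen_iff.1 hw 0 (h0 rfl)
  refine ⟨c, hc, ?_⟩
  have inv : ∀ (k : ℤ) (v : V) (t : ℝ), q (μ ^ k • v, (μ ^ k)⁻¹ * t) ∈ Set.range p ↔
      q (v, t) ∈ Set.range p := by
    intro k
    have hp1 : ∀ (v : V) (t : ℝ), q (μ • v, μ⁻¹ * t) ∈ Set.range p ↔ q (v, t) ∈ Set.range p := by
      intro v t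
      rw [← D.gq, D.p_back]
    have e : ∀ (k : ℤ) (v : V) (t : ℝ), (μ ^ (k + 1) • v, (μ ^ (k + 1))⁻¹ * t) =
        ((μ • (μ ^ k • v), μ⁻¹ * ((μ ^ k)⁻¹ * t)) : V × ℝ) := by
      intro k v t
      rw [zpow_add_one₀ (by positivity), smul_smul, mul_inv]
      refine Prod.ext ?_ ?_
      · show (μ ^ k * μ) • v = (μ * μ ^ k) • v
        rw [mul_comm]
      · show (μ ^ k)⁻¹ * μ⁻¹ * t = _
        ring
    induction k with
    | zero => simp
    | succ k ih =>
      intro v t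
      rw [e, hp1, ih]
    | pred k ih =>
      intro v t
      rw [← hp1, ← e, sub_add_cancel]
      exact ih v t
  intro v t hv ht
  have hv' := norm_pos_iff.2 hv
  obtain ⟨k, hk1, hk2⟩ := exists_mem_Ico_zpow hv' hμ
  rw [← inv (-k)]
  have hpk : 0 < μ ^ k := by positivity
  have hn : ‖μ ^ (-k) • v‖ = (μ ^ k)⁻¹ * ‖v‖ := by
    rw [norm_smul, Real.norm_of_nonneg (by positivity), zpow_neg]
  apply huw
  refine Set.mk_mem_prod (hu ?_) (hcw ?_)
  · rw [zpow_add_one₀ (by positivity)] at hk2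
    constructor
    · rw [hn, inv_mul_eq_div, one_le_div hpk]; exact hk1
    · rw [hn, inv_mul_eq_div, div_le_iff₀ hpk]; linarith
  · rw [mem_ball_zero_iff, zpow_neg, inv_inv, Real.norm_eq_abs, abs_mul, abs_of_pos hpk]
    exact lt_of_le_of_lt (by gcongr) ht

/-- points attracted by one of the two fixed points -/
def Dyn.Basin (_ : Dyn g q p μ ν) : Set M :=
  {m | Tendsto (fun k : ℕ => g^[k] m) atTop (𝓝 (p 0)) ∨
    Tendsto (fun k : ℕ => g^[k] m) atTop (𝓝 (q (0, 0)))}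

theorem Dyn.basin_nhd [ProperSpace V] (D : Dyn g q p μ ν) :
    ∃ O : Set M, IsOpen O ∧ O ⊆ D.Basin ∧ (∀ v, q (v, 0) ∈ O) ∧ p 0 ∈ O := by
  obtain ⟨c, hc, h⟩ := D.tube
  refine ⟨q '' {w | ‖w.1‖ * |w.2| < c} ∪ Set.range p, ?_, ?_, ?_, ?_⟩
  · refine (D.hq.isOpenMap _ ?_).union D.hp.isOpen_range
    exact isOpen_lt (f := fun w : V × ℝ => ‖w.1‖ * |w.2|) (by fun_prop) continuous_const
  · rintro m (⟨⟨v, t⟩, hw, rfl⟩ | ⟨z, rfl⟩)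
    · by_cases hv : v = 0
      · subst hv
        exact Or.inr (D.q_tendsto t)
      · obtain ⟨z, hz⟩ := h v t hv hw
        rw [← hz]
        exact Or.inl (D.p_tendsto z)
    · exact Or.inl (D.p_tendsto z)
  · intro v
    exact Or.inl ⟨(v, 0), by simpa using hc, rfl⟩
  · exact Or.inr ⟨0, rfl⟩

theorem Dyn.trap [ProperSpace V] (D : Dyn g q p μ ν) (N I : Set M) (hN : IsCompact N)
    (hNB : N ⊆ D.Basin) (hI : IsOpen I) (hqI : ∀ v, q (v, 0) ∈ I) (hpI : p 0 ∈ I) :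
    ∃ k : ℕ, 0 < k ∧ g^[k] '' N ⊆ I := by
  have hμ := D.hμ
  have hν := D.hν
  obtain ⟨r, hr, hrI⟩ : ∃ r : ℝ, 0 < r ∧ Metric.ball (0 : E) r ⊆ p ⁻¹' I :=
    Metric.mem_nhds_iff.1 ((hI.preimage D.hp.continuous).mem_nhds hpI)
  have hPo : IsOpen (p '' Metric.ball (0 : E) r) := D.hp.isOpenMap _ Metric.isOpen_ball
  obtain ⟨R0, hR0⟩ := D.far _ hPo ⟨0, by simpa using hr, rfl⟩
  set R := max R0 1 with hRdef
  have hR1 : R0 ≤ R := le_max_left _ _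
  have hR2 : 1 ≤ R := le_max_right _ _
  clear_value R
  have hUo : IsOpen (q ⁻¹' (I ∩ (p '' Metric.ball (0 : E) r)) ∪ (q ⁻¹' I ∩ {w | ‖w.1‖ < R})) := by
    refine ((hI.inter hPo).preimage D.hq.continuous).union ((hI.preimage D.hq.continuous).inter ?_)
    exact isOpen_lt (f := fun w : V × ℝ => ‖w.1‖) (by fun_prop) continuous_const
  obtain ⟨u, w, -, hw, hu, h0, huw⟩ := generalized_tube_lemma
    (isCompact_closedBall (0 : V) (μ * R)) (isCompact_singleton (x := (0 : ℝ))) hUo (by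
      rintro ⟨v, t⟩ ⟨hv, ht⟩
      obtain rfl : t = 0 := ht
      rcases lt_or_ge ‖v‖ R with h | h
      · exact Or.inr ⟨hqI v, h⟩
      · exact Or.inl ⟨hqI v, hR0 v (hR1.trans h)⟩)
  obtain ⟨d, hd, hdw⟩ := Metric.isOpen_iff.1 hw 0 (h0 rfl)
  have key : ∀ (v : V) (t : ℝ), ‖v‖ ≤ μ * R → |t| < d → q (v, t) ∈ I ∧
      (q (v, t) ∈ p '' Metric.ball (0 : E) r ∨ ‖v‖ < R) := by
    intro v t hv ht
    have := huw (Set.mk_mem_prod (hu (by simpa using hv)) (hdw (by simpa using ht)))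
    rcases this with h | h
    · exact ⟨h.1, Or.inl h.2⟩
    · exact ⟨h.1, Or.inr h.2⟩
  set P : Set M := q '' {w | ‖w.1‖ < R ∧ |w.2| < d} ∪ p '' Metric.ball (0 : E) r with hP
  have hPopen : IsOpen P := by
    refine (D.hq.isOpenMap _ ?_).union hPo
    exact (isOpen_lt (f := fun w : V × ℝ => ‖w.1‖) (by fun_prop) continuous_const).inter
      (isOpen_lt (f := fun w : V × ℝ => |w.2|) (by fun_prop) continuous_const)
  have hPI : P ⊆ I := by
    rintro m (⟨⟨v, t⟩, ⟨h1, h2⟩, rfl⟩ | ⟨z, hz, rfl⟩)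
    · have h1' : ‖v‖ < R := h1
      exact (key v t (by nlinarith) h2).1
    · exact hrI hz
  have hPg : ∀ m ∈ P, g m ∈ P := by
    rintro m (⟨⟨v, t⟩, ⟨h1, h2⟩, rfl⟩ | ⟨z, hz, rfl⟩)
    · have h1' : ‖v‖ < R := h1
      have h2' : |t| < d := h2
      rw [D.gq]
      have hn : ‖μ • v‖ = μ * ‖v‖ := by rw [norm_smul, Real.norm_of_nonneg (by linarith)]
      have ht : |μ⁻¹ * t| < d := by
        rw [abs_mul, abs_of_pos (by positivity)]
        have h3 := inv_le_one_of_one_le₀ hμ.le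
        have h4 : 0 < μ⁻¹ := by positivity
        nlinarith [abs_nonneg t]
      rcases (key (μ • v) (μ⁻¹ * t) (by rw [hn]; nlinarith) ht).2 with h | h
      · exact Or.inr h
      · exact Or.inl ⟨_, ⟨h, ht⟩, rfl⟩
    · rw [D.gp]
      refine Or.inr ⟨_, ?_, rfl⟩
      rw [mem_ball_zero_iff] at hz ⊢
      rw [norm_smul, Real.norm_of_nonneg (by positivity)]
      have h3 := inv_le_one_of_one_le₀ hν.le
      have h4 : 0 < ν⁻¹ := by positivity
      nlinarith [norm_nonneg z]
  have hPk : ∀ (j : ℕ) (m : M), m ∈ P → g^[j] m ∈ P := by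
    intro j m hm
    induction j with
    | zero => exact hm
    | succ j ih => rw [Function.iterate_succ_apply']; exact hPg _ ih
  have hcov : N ⊆ ⋃ k : ℕ, g^[k] ⁻¹' P := by
    intro m hm
    have hp0 : p 0 ∈ P := Or.inr ⟨0, by simpa using hr, rfl⟩
    have hq0 : q (0, 0) ∈ P := Or.inl ⟨(0, 0), ⟨by simp; linarith, by simpa using hd⟩, rfl⟩
    rw [Set.mem_iUnion]
    rcases hNB hm with h | h
    · exact (h.eventually (hPopen.mem_nhds hp0)).exists
    · exact (h.eventually (hPopen.mem_nhds hq0)).exists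
  obtain ⟨k, hk⟩ := hN.elim_directed_cover (fun k : ℕ => g^[k] ⁻¹' P)
    (fun k => hPopen.preimage (g.continuous.iterate k)) hcov (by
      refine directed_of_isDirected_le ?_
      intro i j hij m hm
      obtain ⟨l, rfl⟩ := Nat.exists_eq_add_of_le' hij
      show g^[l + i] m ∈ P
      rw [Function.iterate_add_apply]
      exact hPk l _ hm)
  refine ⟨k + 1, Nat.succ_pos k, ?_⟩
  rintro _ ⟨m, hm, rfl⟩
  rw [Function.iterate_succ_apply']
  exact hPI (hPg _ (hk hm))

end Dynamics

open Filter Topology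

section Assembly
variable {W : Type*} [NormedAddCommGroup W] [NormedSpace ℝ W]

/-- swap of coordinates `((a,t),x) ↦ ((a,x),t)` -/
noncomputable def sw : ((W × ℝ) × ℝ) ≃ₜ ((W × ℝ) × ℝ) where
  toFun w := ((w.1.1, w.2), w.1.2)
  invFun w := ((w.1.1, w.2), w.1.2)
  left_inv _ := rfl
  right_inv _ := rfl
  continuous_toFun := by fun_prop
  continuous_invFun := by fun_prop

/-- normal rescaling -/
noncomputable def dm (w : (W × ℝ) × ℝ) : (W × ℝ) × ℝ := ((w.1.1, w.2), w.1.2 / rad w ^ 2)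

/-- normal rescaling, inverse -/
noncomputable def dmi (w : (W × ℝ) × ℝ) : (W × ℝ) × ℝ := ((w.1.1, w.2 * rad (sw w) ^ 2), w.1.2)

theorem rad_indep (a : W) (t t' x : ℝ) : rad ((a, t), x) = rad ((a, t'), x) := rfl

theorem rad_ne (v : W × ℝ) (t : ℝ) : 0 < rad ((v.1, t), v.2) ↔ v ≠ 0 := by
  have h1 := norm_le_rad ((v.1, 0), v.2) rfl
  rw [rad_indep _ t 0]
  constructor
  · rintro h rfl
    simp [rad] at h
  · intro h
    refine lt_of_lt_of_le ?_ h1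
    rw [norm_pos_iff]
    rintro h2
    apply h
    rw [Prod.ext_iff, Prod.ext_iff] at h2
    exact Prod.ext h2.1.1 h2.2

theorem norm_le_rad2 (w : (W × ℝ) × ℝ) : ‖((w.1.1, w.2) : W × ℝ)‖ ≤ rad w := by
  rw [Prod.norm_def]
  exact max_le (fst_le_rad w) (snd_le_rad w)

/-- `dm` as a partial homeomorphism -/
noncomputable def dmP : OpenPartialHomeomorph ((W × ℝ) × ℝ) ((W × ℝ) × ℝ) where
  toFun := dm
  invFun := dmi
  source := {w | 0 < rad w}
  target := {w | 0 < rad (sw w)}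
  map_source' := fun w h => h
  map_target' := fun w h => h
  left_inv' := fun w h => by
    have h' : 0 < rad w := h
    refine Prod.ext (Prod.ext rfl ?_) rfl
    show w.1.2 / rad w ^ 2 * rad (sw (dm w)) ^ 2 = w.1.2
    have : rad (sw (dm w)) = rad w := rfl
    rw [this]; field_simp
  right_inv' := fun w h => by
    have h' : 0 < rad (sw w) := h
    refine Prod.ext rfl ?_
    show w.2 * rad (sw w) ^ 2 / rad (dmi w) ^ 2 = w.2
    have : rad (dmi w) = rad (sw w) := rfl
    rw [this]; field_simp
  open_source := isOpen_lt continuous_const rad_cont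
  open_target := isOpen_lt continuous_const (rad_cont.comp sw.continuous)
  continuousOn_toFun := by
    refine ContinuousOn.prodMk (by fun_prop) ?_
    refine ContinuousOn.div (by fun_prop) (rad_cont.pow 2).continuousOn ?_
    intro w h
    have h' : 0 < rad w := h
    positivity
  continuousOn_invFun := by
    have h := rad_cont.comp (sw (W := W)).continuous
    refine Continuous.continuousOn ?_
    refine Continuous.prodMk (Continuous.prodMk (by fun_prop) ?_) (by fun_prop)
    exact continuous_snd.mul (h.pow 2)

theorem dm_smul (μ : ℝ) (hμ : 0 < μ) (w : (W × ℝ) × ℝ) :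
    dm (μ • w) = (μ • (dm w).1, μ⁻¹ * (dm w).2) := by
  unfold dm
  rw [rad_smul μ hμ.le]
  refine Prod.ext rfl ?_
  show μ * w.1.2 / (μ * rad w) ^ 2 = μ⁻¹ * (w.1.2 / rad w ^ 2)
  rw [mul_pow]
  field_simp

variable {M : Type*} [TopologicalSpace M] [CompactSpace M] [T2Space M] {g : M ≃ₜ M}
    {q p : (W × ℝ) × ℝ → M} {μ ν : ℝ}

theorem Dyn.exists_phi [FiniteDimensional ℝ W] (D : Dyn g q p μ ν) :
    ∃ (φ : OpenPartialHomeomorph ((W × ℝ) × ℝ) ((W × ℝ) × ℝ)) (c : ℝ), 0 < c ∧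
      (∀ w : (W × ℝ) × ℝ, 0 < rad w → |w.1.2| < c * rad w → w ∈ φ.source) ∧
      (∀ w : (W × ℝ) × ℝ, 0 < rad w → |w.1.2| < c * rad w → φ (μ • w) = ν • φ w) ∧
      (∀ w : (W × ℝ) × ℝ, 0 < rad w → |w.1.2| < c * rad w → p (nv (φ w)) = q (dm w)) := by
  have : ProperSpace W := FiniteDimensional.proper ℝ W
  have hμ := D.hμ
  have hν := D.hν
  obtain ⟨c, hc, ht⟩ := D.tube
  let P := D.hp.toOpenPartialHomeomorph p
  let Q := D.hq.toOpenPartialHomeomorph q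
  have hPs : ∀ z, P.symm (p z) = z := fun z => P.left_inv (by simp [P])
  let φ := ((dmP.trans Q).trans P.symm).trans nvP
  have hap : ∀ w z, q (dm w) = p z → φ w = nv z := by
    intro w z h
    show nv (P.symm (q (dm w))) = nv z
    rw [h, hPs]
  have hex : ∀ w : (W × ℝ) × ℝ, 0 < rad w → |w.1.2| < c * rad w → ∃ z, p z = q (dm w) := by
    intro w h1 h2
    refine ht _ _ ?_ ?_
    · exact (rad_ne (w.1.1, w.2) w.1.2).1 h1
    · have h3 := norm_le_rad2 w
      rw [abs_div, abs_of_pos (by positivity : 0 < rad w ^ 2), mul_div_assoc', div_lt_iff₀ (by positivity)]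
      nlinarith [abs_nonneg w.1.2]
  refine ⟨φ, c, hc, ?_, ?_, ?_⟩
  · intro w h1 h2
    obtain ⟨z, hz⟩ := hex w h1 h2
    simp only [φ, OpenPartialHomeomorph.trans_source, OpenPartialHomeomorph.symm_source]
    refine ⟨⟨⟨h1, ?_⟩, ?_⟩, ?_⟩
    · simp [Q]
    · show q (dm w) ∈ P.target
      rw [← hz]
      simp [P]
    · show P.symm (q (dm w)) ∈ ({0}ᶜ : Set _)
      rw [← hz, hPs]
      rintro h0
      obtain rfl : z = 0 := h0
      exact D.p0 ⟨_, hz.symm⟩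
  · intro w h1 h2
    obtain ⟨z, hz⟩ := hex w h1 h2
    rw [hap w z hz.symm, hap (μ • w) (ν⁻¹ • z), nv_smul _ (by positivity), inv_inv]
    rw [dm_smul μ (by linarith), ← D.gq, ← D.gp, hz]
  · intro w h1 h2
    obtain ⟨z, hz⟩ := hex w h1 h2
    rw [hap w z hz.symm, nv_nv, hz]

/-- positive continuous factor -/
noncomputable def fac (v : W × ℝ) : ℝ := max 1 ‖v‖ ^ 2 / max 1 (rad ((v.1, 0), v.2)) ^ 2

theorem fac_pos (v : W × ℝ) : 0 < fac v := by
  unfold fac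
  have h1 : 0 < max 1 ‖v‖ := lt_max_of_lt_left one_pos
  have h2 : 0 < max 1 (rad ((v.1, 0), v.2)) := lt_max_of_lt_left one_pos
  positivity

theorem fac_cont : Continuous (fac : W × ℝ → ℝ) := by
  unfold fac
  have h : Continuous fun v : W × ℝ => rad ((v.1, 0), v.2) := rad_cont.comp (by fun_prop)
  refine Continuous.div (by fun_prop) ((continuous_const.max h).pow 2) ?_
  intro v
  have h2 : 0 < max 1 (rad ((v.1, 0), v.2)) := lt_max_of_lt_left one_pos
  positivity

/-- shear -/
noncomputable def shr : ((W × ℝ) × ℝ) ≃ₜ ((W × ℝ) × ℝ) where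
  toFun w := (w.1, w.2 * fac w.1)
  invFun w := (w.1, w.2 / fac w.1)
  left_inv w := by
    have := fac_pos w.1
    refine Prod.ext rfl ?_
    show w.2 * fac w.1 / fac w.1 = w.2
    field_simp
  right_inv w := by
    have := fac_pos w.1
    refine Prod.ext rfl ?_
    show w.2 / fac w.1 * fac w.1 = w.2
    field_simp
  continuous_toFun := by
    have := fac_cont (W := W)
    fun_prop
  continuous_invFun := by
    have := fac_cont.comp (continuous_fst (X := W × ℝ) (Y := ℝ))
    refine continuous_fst.prodMk (continuous_snd.div this fun w => (fac_pos w.1).ne')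

theorem nv_sw (v : W × ℝ) (s : ℝ) (hv : v ≠ 0) (hs : |s| * ‖v‖ < 1) :
    sw.symm (nv v, s) ≠ 0 ∧ nv (sw.symm (nv v, s)) = ((v.1, s * ‖v‖ ^ 2), v.2) := by
  have hv' := norm_pos_iff.2 hv
  have e : sw.symm (nv v, s) = (((nv v).1, s), (nv v).2) := rfl
  have hn : ‖sw.symm (nv v, s)‖ = ‖v‖⁻¹ := by
    rw [← norm_nv v]
    have h1 : |s| ≤ ‖nv v‖ := by
      rw [norm_nv, ← one_div, le_div_iff₀ hv']; exact hs.le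
    rw [e]
    apply le_antisymm
    · rw [Prod.norm_def, Prod.norm_def]
      exact max_le (max_le (norm_fst_le (nv v)) h1) (norm_snd_le (nv v))
    · rw [Prod.norm_def (nv v)]
      refine max_le ?_ (norm_snd_le (((nv v).1, s), (nv v).2))
      exact (norm_fst_le ((nv v).1, s)).trans (norm_fst_le (((nv v).1, s), (nv v).2))
  constructor
  · rw [← norm_ne_zero_iff, hn]; positivity
  · have e2 : nv (sw.symm (nv v, s)) = (‖sw.symm (nv v, s)‖ ^ 2)⁻¹ • sw.symm (nv v, s) := rfl
    rw [e2, hn, e]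
    have e3 : (‖v‖⁻¹ ^ 2)⁻¹ = ‖v‖ ^ 2 := by rw [inv_pow, inv_inv]
    rw [e3]
    have e4 : ‖v‖ ^ 2 • nv v = v := by
      unfold nv
      rw [smul_smul, mul_inv_cancel₀ (by positivity), one_smul]
    have e5 : ‖v‖ ^ 2 • (nv v).1 = v.1 := congrArg Prod.fst e4
    have e6 : ‖v‖ ^ 2 • (nv v).2 = v.2 := congrArg Prod.snd e4
    refine Prod.ext (Prod.ext e5 ?_) e6
    show ‖v‖ ^ 2 * s = _
    ring

theorem Dyn.collar [FiniteDimensional ℝ W] (hd : 2 ≤ Module.finrank ℝ W) (D : Dyn g q p μ ν)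
    (O : Set M) (hO : IsOpen O) (hqO : ∀ v, q (v, 0) ∈ O) (hpO : p 0 ∈ O) :
    ∃ e : OnePoint (W × ℝ) × Set.Icc (-1 : ℝ) 1 → M, IsClosedEmbedding e ∧ (∀ y, e y ∈ O) ∧
      (∀ s : Set.Icc (-1 : ℝ) 1, (s : ℝ) = 0 → (∀ v : W × ℝ, e (v, s) = q (v, 0)) ∧
        e (OnePoint.infty, s) = p 0) ∧
      (∀ v, q (v, 0) ∈ interior (Set.range e)) ∧ p 0 ∈ interior (Set.range e) := by
  classical
  have : ProperSpace W := FiniteDimensional.proper ℝ W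
  obtain ⟨φ, c, hc, hsrc, heq, hφ⟩ := D.exists_phi
  obtain ⟨Γ, Γ', R, hR, hΓc, hΓt, hΓt', hΓΓ', hΓ'Γ, hΓφ⟩ := mtt hd φ c μ ν hc D.hμ D.hν hsrc heq
  obtain ⟨Z, hZ, hZ0, hZΓ⟩ := good_conj Γ Γ' R hR hΓc hΓt hΓt' hΓΓ' hΓ'Γ
  obtain ⟨j, j0, j1, hj⟩ := good_infty (E := W × ℝ)
  set R3 := max R 1 with hR3
  have hR31 : R ≤ R3 := le_max_left _ _
  have hR32 : 1 ≤ R3 := le_max_right _ _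
  clear_value R3
  let A : OnePoint (W × ℝ) × ℝ → M := fun y => p (Z (sw.symm (j y.1, y.2)))
  have agree : ∀ v : W × ℝ, R3 < ‖v‖ →
      ∀ᶠ y in 𝓝 ((v, 0) : (W × ℝ) × ℝ), A ((y.1 : OnePoint (W × ℝ)), y.2) = q (shr y) := by
    intro v hv
    have hk : Continuous fun y : (W × ℝ) × ℝ => (((y.1.1, y.2 * ‖y.1‖ ^ 2), y.1.2) : (W × ℝ) × ℝ) := by
      fun_prop
    have hw0 : R < ‖(((v.1, (0 : ℝ) * ‖v‖ ^ 2), v.2) : (W × ℝ) × ℝ)‖ := by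
      have : ‖v‖ ≤ ‖(((v.1, (0 : ℝ) * ‖v‖ ^ 2), v.2) : (W × ℝ) × ℝ)‖ := by
        rw [Prod.norm_def v]
        refine max_le ?_ (norm_snd_le (((v.1, (0 : ℝ) * ‖v‖ ^ 2), v.2) : (W × ℝ) × ℝ))
        exact (norm_fst_le (v.1, (0 : ℝ) * ‖v‖ ^ 2)).trans
          (norm_fst_le (((v.1, (0 : ℝ) * ‖v‖ ^ 2), v.2) : (W × ℝ) × ℝ))
      linarith
    have e0 : Γ =ᶠ[𝓝 ((v.1, (0 : ℝ) * ‖v‖ ^ 2), v.2)] φ := hΓφ _ hw0 (zero_mul _)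
    have e1 := (hk.continuousAt (x := (v, (0 : ℝ)))).eventually e0
    have hrc : Continuous fun y : (W × ℝ) × ℝ =>
        rad ((y.1.1, y.2 * ‖y.1‖ ^ 2), y.1.2) := rad_cont.comp hk
    have hv0 : v ≠ 0 := by rw [← norm_pos_iff]; linarith
    have hr0 : 0 < rad ((v.1, (0 : ℝ) * ‖v‖ ^ 2), v.2) := (rad_ne v _).2 hv0
    have e2 : ∀ᶠ y in 𝓝 ((v, 0) : (W × ℝ) × ℝ),
        |y.2 * ‖y.1‖ ^ 2| < c * rad ((y.1.1, y.2 * ‖y.1‖ ^ 2), y.1.2) := by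
      refine (isOpen_lt (f := fun y : (W × ℝ) × ℝ => |y.2 * ‖y.1‖ ^ 2|) (by fun_prop)
        (continuous_const.mul hrc)).mem_nhds ?_
      show |(0 : ℝ) * ‖v‖ ^ 2| < c * rad ((v.1, (0 : ℝ) * ‖v‖ ^ 2), v.2)
      rw [zero_mul, abs_zero] at *
      positivity
    have e3 : ∀ᶠ y in 𝓝 ((v, 0) : (W × ℝ) × ℝ), R3 < ‖y.1‖ :=
      (isOpen_lt (g := fun y : (W × ℝ) × ℝ => ‖y.1‖) continuous_const (by fun_prop)).mem_nhds hv
    have e4 : ∀ᶠ y in 𝓝 ((v, 0) : (W × ℝ) × ℝ), |y.2| * ‖y.1‖ < 1 := by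
      refine (isOpen_lt (f := fun y : (W × ℝ) × ℝ => |y.2| * ‖y.1‖) (by fun_prop)
        continuous_const).mem_nhds ?_
      show |(0 : ℝ)| * ‖v‖ < 1
      simp
    filter_upwards [e1, e2, e3, e4] with y h1 h2 h3 h4
    obtain ⟨v', s⟩ := y
    simp only at h1 h2 h3 h4 ⊢
    have hv0 : v' ≠ 0 := by rw [← norm_pos_iff]; linarith
    obtain ⟨n1, n2⟩ := nv_sw v' s hv0 h4
    show p (Z (sw.symm (j v', s))) = _
    rw [j1, hZΓ _ n1, n2, h1, hφ _ ((rad_ne v' _).2 hv0) h2]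
    congr 1
    unfold dm
    refine Prod.ext rfl ?_
    show s * ‖v'‖ ^ 2 / rad ((v'.1, s * ‖v'‖ ^ 2), v'.2) ^ 2 = s * fac v'
    unfold fac
    rw [rad_indep _ (s * ‖v'‖ ^ 2) 0]
    have h5 : ‖v'‖ ≤ rad ((v'.1, 0), v'.2) := norm_le_rad2 ((v'.1, 0), v'.2)
    rw [max_eq_right (by linarith), max_eq_right (by linarith), mul_div_assoc]
  let F : OnePoint (W × ℝ) × ℝ → M := fun y =>
    y.1.elim (A y) (fun v => if R3 + 1 < ‖v‖ then A y else q (shr (v, y.2)))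
  have hemb : IsOpenEmbedding (Prod.map ((↑) : W × ℝ → OnePoint (W × ℝ)) (id : ℝ → ℝ)) :=
    OnePoint.isOpenEmbedding_coe.prodMap IsOpenEmbedding.id
  have hFv : ∀ v : W × ℝ, (F ∘ Prod.map ((↑) : W × ℝ → OnePoint (W × ℝ)) (id : ℝ → ℝ))
      =ᶠ[𝓝 (v, 0)] (q ∘ shr) := by
    intro v
    rcases lt_or_ge R3 ‖v‖ with h | h
    · filter_upwards [agree v h] with y hy
      show (if R3 + 1 < ‖y.1‖ then A ((y.1 : OnePoint (W × ℝ)), y.2) else q (shr y)) = q (shr y)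
      rw [hy]; simp
    · have e3 : ∀ᶠ y in 𝓝 ((v, 0) : (W × ℝ) × ℝ), ‖y.1‖ < R3 + 1 :=
        (isOpen_lt (f := fun y : (W × ℝ) × ℝ => ‖y.1‖) (by fun_prop) continuous_const).mem_nhds
          (show ‖v‖ < R3 + 1 by linarith)
      filter_upwards [e3] with y hy
      show (if R3 + 1 < ‖y.1‖ then A ((y.1 : OnePoint (W × ℝ)), y.2) else q (shr y)) = q (shr y)
      rw [if_neg (by linarith)]
  have hF0 : ∀ v : W × ℝ, F ((v : OnePoint (W × ℝ)), 0) = q (v, 0) := by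
    intro v
    have := (hFv v).self_of_nhds
    have e : shr ((v, 0) : (W × ℝ) × ℝ) = (v, 0) := by
      refine Prod.ext rfl ?_
      show (0 : ℝ) * fac v = 0
      simp
    rw [Function.comp, Function.comp, e] at this
    exact this
  have hFi : F (OnePoint.infty, 0) = p 0 := by
    show p (Z (sw.symm (j OnePoint.infty, 0))) = p 0
    rw [j0]
    have : sw.symm ((0, 0) : (W × ℝ) × ℝ) = 0 := rfl
    rw [this, hZ0]
  have hgood : ∀ x, GoodAt F (x, 0) := by
    intro x
    induction x using OnePoint.rec with
    | coe v =>
      refine GoodAt.of_comp (x := (v, (0 : ℝ))) hemb ?_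
      exact ((GoodAt.of_emb D.hq _).comp (GoodAt.of_emb shr.isOpenEmbedding _)).congr (hFv v)
    | infty =>
      have hA : GoodAt A (OnePoint.infty, 0) := by
        have h1 : GoodAt (sw.symm ∘ Prod.map j (id : ℝ → ℝ)) (OnePoint.infty, 0) :=
          (GoodAt.of_emb sw.symm.isOpenEmbedding _).comp hj
        have h2 : (sw.symm ∘ Prod.map j (id : ℝ → ℝ)) (OnePoint.infty, 0) = 0 := by
          show sw.symm (j OnePoint.infty, (0 : ℝ)) = 0
          rw [j0]; rfl
        have h3 : GoodAt (Z ∘ (sw.symm ∘ Prod.map j (id : ℝ → ℝ))) (OnePoint.infty, 0) :=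
          GoodAt.comp (by rw [h2]; exact hZ) h1
        exact (GoodAt.of_emb D.hp _).comp h3
      refine hA.congr ?_
      have hN : ((↑) '' Metric.closedBall (0 : W × ℝ) (R3 + 1) : Set (OnePoint (W × ℝ)))ᶜ ∈
          𝓝 (OnePoint.infty : OnePoint (W × ℝ)) := by
        refine (OnePoint.isOpen_compl_image_coe.2 ⟨Metric.isClosed_closedBall,
          isCompact_closedBall _ _⟩).mem_nhds ?_
        rintro ⟨v, -, h⟩
        exact OnePoint.coe_ne_infty v h
      have := (continuousAt_fst (p := ((OnePoint.infty : OnePoint (W × ℝ)), (0 : ℝ)))).eventually hN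
      filter_upwards [this] with y hy
      obtain ⟨x, s⟩ := y
      induction x using OnePoint.rec with
      | infty => rfl
      | coe v =>
        show (if R3 + 1 < ‖v‖ then A ((v : OnePoint (W × ℝ)), s) else q (shr (v, s))) = _
        rw [if_pos]
        by_contra hcon
        exact hy ⟨v, by simpa using hcon, rfl⟩
  obtain ⟨e, he, heO, he0, hei⟩ := _root_.collar F hgood (by
    intro x y hxy
    simp only at hxy
    induction x using OnePoint.rec with
    | infty =>
      induction y using OnePoint.rec with
      | infty => rfl
      | coe w =>
        rw [hFi, hF0] at hxy
        exact absurd ⟨_, hxy.symm⟩ D.p0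
    | coe v =>
      induction y using OnePoint.rec with
      | infty =>
        rw [hFi, hF0] at hxy
        exact absurd ⟨_, hxy⟩ D.p0
      | coe w =>
        rw [hF0, hF0] at hxy
        have := D.hq.injective hxy
        rw [Prod.mk.injEq] at this
        rw [this.1]) O hO (by
    intro x
    induction x using OnePoint.rec with
    | infty => rw [hFi]; exact hpO
    | coe v => rw [hF0]; exact hqO v)
  refine ⟨e, he, heO, ?_, ?_, ?_⟩
  · intro s hs
    refine ⟨fun v => ?_, ?_⟩
    · rw [he0 _ s hs, hF0]
    · rw [he0 _ s hs, hFi]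
  · intro v
    rw [← hF0]; exact hei _
  · rw [← hFi]; exact hei _

end Assembly

open Filter Topology

section Final

/-- coordinates -/
noncomputable def chi (k : ℕ) : EuclideanSpace ℝ (Fin (k + 2)) ≃ₜ
    ((EuclideanSpace ℝ (Fin k) × ℝ) × ℝ) where
  toFun x := ((WithLp.toLp 2 fun i : Fin k => x i.castSucc.castSucc, x (Fin.last k).castSucc),
    x (Fin.last (k + 1)))
  invFun w := WithLp.toLp 2 (Fin.snoc (α := fun _ => ℝ)
    (Fin.snoc (α := fun _ => ℝ) (fun i => w.1.1 i) w.1.2) w.2)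
  left_inv x := by
    ext i
    refine Fin.lastCases ?_ (fun i => ?_) i
    · simp
    · refine Fin.lastCases ?_ (fun i => ?_) i
      · simp
      · simp
  right_inv w := by
    refine Prod.ext (Prod.ext ?_ ?_) ?_
    · ext i; simp
    · simp
    · simp
  continuous_toFun := by fun_prop
  continuous_invFun := by
    refine (PiLp.continuous_toLp 2 _).comp (continuous_pi fun i => ?_)
    refine Fin.lastCases ?_ (fun i => ?_) i
    · simp only [Fin.snoc_last]; fun_prop
    · refine Fin.lastCases ?_ (fun i => ?_) i
      · simp only [Fin.snoc_castSucc, Fin.snoc_last]; fun_prop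
      · simp only [Fin.snoc_castSucc]; fun_prop

theorem chi_saddle (k : ℕ) (δu δs : ℝ) (hu : δu = 1 ∨ δu = -1) (hs : δs = 1 ∨ δs = -1)
    (x : EuclideanSpace ℝ (Fin (k + 2))) :
    chi k (modelMap (k + 2) (k + 1) δu δs (modelMap (k + 2) (k + 1) δu δs x)) =
      ((4 : ℝ) • (chi k x).1, (4 : ℝ)⁻¹ * (chi k x).2) := by
  have h1 : δu * δu = 1 := by rcases hu with rfl | rfl <;> norm_num
  have h2 : δs * δs = 1 := by rcases hs with rfl | rfl <;> norm_num
  have low : ∀ j : Fin (k + 2), (j : ℕ) < k + 1 →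
      modelMap (k + 2) (k + 1) δu δs (modelMap (k + 2) (k + 1) δu δs x) j = 4 * x j := by
    intro j hj
    simp only [modelMap, if_pos hj]
    split_ifs
    · linear_combination 4 * x j * h1
    · ring
  have hi : modelMap (k + 2) (k + 1) δu δs (modelMap (k + 2) (k + 1) δu δs x) (Fin.last (k + 1)) =
      4⁻¹ * x (Fin.last (k + 1)) := by
    simp [modelMap]
    linear_combination (1 / 4) * x (Fin.last (k + 1)) * h2
  refine Prod.ext (Prod.ext ?_ ?_) ?_
  · ext i
    exact low i.castSucc.castSucc (by simp)
  · exact low (Fin.last k).castSucc (by simp)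
  · exact hi

theorem chi_sink (k : ℕ) (δu δs : ℝ) (hs : δs = 1 ∨ δs = -1)
    (x : EuclideanSpace ℝ (Fin (k + 2))) :
    chi k (modelMap (k + 2) 0 δu δs (modelMap (k + 2) 0 δu δs x)) = (4 : ℝ)⁻¹ • (chi k x) := by
  have h2 : δs * δs = 1 := by rcases hs with rfl | rfl <;> norm_num
  have low : ∀ j : Fin (k + 2),
      modelMap (k + 2) 0 δu δs (modelMap (k + 2) 0 δu δs x) j = 4⁻¹ * x j := by
    intro j
    simp only [modelMap, Nat.not_lt_zero, if_false]
    split_ifs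
    · linear_combination (1 / 4) * x j * h2
    · ring
  refine Prod.ext (Prod.ext ?_ ?_) ?_
  · ext i
    exact low i.castSucc.castSucc
  · exact low (Fin.last k).castSucc
  · exact low (Fin.last (k + 1))

variable {M : Type*} [MetricSpace M]

/-- charts from conjugacies -/
theorem chart_aux (k i : ℕ) (f : M ≃ₜ M) (s : M) (hs : TopHyperbolic (k + 2) f s i)
    (A : (EuclideanSpace ℝ (Fin k) × ℝ) × ℝ → (EuclideanSpace ℝ (Fin k) × ℝ) × ℝ)
    (hA : ∀ δu δs : ℝ, (δu = 1 ∨ δu = -1) → (δs = 1 ∨ δs = -1) → ∀ x,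
      chi k (modelMap (k + 2) i δu δs (modelMap (k + 2) i δu δs x)) = A (chi k x))
    (hA0 : ∀ w, A w = w → w = 0) :
    0 < Function.minimalPeriod f s ∧ ∃ q : (EuclideanSpace ℝ (Fin k) × ℝ) × ℝ → M,
      IsOpenEmbedding q ∧ q 0 = s ∧ ∀ w, f^[2 * Function.minimalPeriod f s] (q w) = q (A w) := by
  obtain ⟨m, hm, hper, hmin, δu, δs, hu, hs', U, hU, hsU, h, hh⟩ := hs
  refine ⟨by rw [hmin]; exact hm, fun w => ((h.symm ((chi k).symm w) : U) : M), ?_, ?_⟩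
  · exact hU.isOpenEmbedding_subtypeVal.comp
      (h.symm.isOpenEmbedding.comp (chi k).symm.isOpenEmbedding)
  have h2 : ∀ w, f^[2 * Function.minimalPeriod f s] ((h.symm ((chi k).symm w) : U) : M) =
      ((h.symm ((chi k).symm (A w)) : U) : M) := by
    intro w
    rw [hmin, two_mul, Function.iterate_add_apply, hh, hh, Homeomorph.apply_symm_apply,
      Homeomorph.apply_symm_apply]
    have := hA δu δs hu hs' ((chi k).symm w)
    rw [Homeomorph.apply_symm_apply] at this
    rw [← this, Homeomorph.symm_apply_apply]
  refine ⟨?_, h2⟩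
  have h3 := h2 (chi k (h ⟨s, hsU⟩))
  rw [Homeomorph.symm_apply_apply, Homeomorph.symm_apply_apply] at h3
  have h4 : f^[2 * Function.minimalPeriod f s] s = s := by
    rw [hmin]; exact hper.const_mul 2
  have h5 : (⟨s, hsU⟩ : U) = h.symm ((chi k).symm (A (chi k (h ⟨s, hsU⟩)))) := by
    apply Subtype.ext
    rw [← h3]; exact h4.symm
  have h6 : A (chi k (h ⟨s, hsU⟩)) = chi k (h ⟨s, hsU⟩) := by
    conv_rhs => rw [h5]
    rw [Homeomorph.apply_symm_apply, Homeomorph.apply_symm_apply]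
  have h7 := hA0 _ h6
  show ((h.symm ((chi k).symm 0) : U) : M) = s
  rw [← h7, Homeomorph.symm_apply_apply, Homeomorph.symm_apply_apply]

theorem exists_iter (f : M ≃ₜ M) (n : ℕ) : ∃ g : M ≃ₜ M, ⇑g = f^[n] ∧ ⇑g.symm = f.symm^[n] := by
  induction n with
  | zero => exact ⟨Homeomorph.refl M, rfl, rfl⟩
  | succ n ih =>
    obtain ⟨g, h1, h2⟩ := ih
    refine ⟨g.trans f, ?_, ?_⟩
    · ext x
      rw [Function.iterate_succ_apply', ← h1]; rfl
    · ext x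
      rw [Function.iterate_succ_apply, ← h2]; rfl

theorem sub_tendsto (F : M → M) (hF : Continuous F) (s : M) (hs : F s = s) (c : ℕ) (hc : 0 < c)
    (m : M) (h : Tendsto (fun k : ℕ => (F^[c])^[k] m) atTop (𝓝 s)) :
    Tendsto (fun k : ℕ => F^[k] m) atTop (𝓝 s) := by
  intro S hS
  have h1 : ∀ᶠ x in 𝓝 s, ∀ i ∈ Finset.range c, F^[i] x ∈ S := by
    rw [Filter.eventually_all_finset]
    intro i _
    have h2 : Tendsto F^[i] (𝓝 s) (𝓝 s) := by
      have := (hF.iterate i).tendsto s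
      rwa [Function.iterate_fixed hs] at this
    exact h2 hS
  obtain ⟨J, hJ⟩ := eventually_atTop.1 (h.eventually h1)
  rw [Filter.mem_map]
  filter_upwards [eventually_ge_atTop (c * J)] with k hk
  have h3 := hJ (k / c) ((Nat.le_div_iff_mul_le hc).2 (by linarith [mul_comm c J])) (k % c)
    (Finset.mem_range.2 (Nat.mod_lt _ hc))
  rw [← Function.iterate_mul, ← Function.iterate_add_apply, Nat.mod_add_div] at h3
  exact h3

theorem scaled_iter {V : Type*} [NormedAddCommGroup V] [NormedSpace ℝ V] (F : M → M)
    (q : V × ℝ → M) (h : ∀ w : V × ℝ, F (q w) = q ((4 : ℝ) • w.1, (4 : ℝ)⁻¹ * w.2)) (j : ℕ)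
    (v : V) (t : ℝ) : F^[j] (q (v, t)) = q ((4 : ℝ) ^ j • v, ((4 : ℝ) ^ j)⁻¹ * t) := by
  induction j with
  | zero => simp
  | succ j ih =>
    rw [Function.iterate_succ_apply', ih, h]
    simp only [smul_smul]
    rw [← mul_assoc, pow_succ', mul_inv]

theorem scaled_iter2 {V : Type*} [NormedAddCommGroup V] [NormedSpace ℝ V] (F : M → M)
    (p : V → M) (h : ∀ w : V, F (p w) = p ((4 : ℝ)⁻¹ • w)) (j : ℕ)
    (v : V) : F^[j] (p v) = p (((4 : ℝ) ^ j)⁻¹ • v) := by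
  induction j with
  | zero => simp
  | succ j ih =>
    rw [Function.iterate_succ_apply', ih, h, smul_smul, pow_succ', mul_inv]

theorem main_aux (k : ℕ) (hk : 2 ≤ k) [CompactSpace M] (f : M ≃ₜ M)
    (σ : M) (hσ : TopHyperbolic (k + 2) f σ (k + 1))
    (ω : M) (hω : TopHyperbolic (k + 2) f ω 0)
    (hcl : closure (unstableSet f σ) = unstableSet f σ ∪ {ω}) :
    ∃ N : Set M, IsCompact N ∧ N ⊆ stableSet f ω ∪ stableSet f σ ∧
      unstableSet f σ ∪ {ω} ⊆ interior N ∧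
      ∃ e : ((Metric.sphere (0 : EuclideanSpace ℝ (Fin (k + 2))) 1) ×
               (Set.Icc (-1 : ℝ) 1)) ≃ₜ N,
        Subtype.val '' (⇑e '' {p : (Metric.sphere (0 : EuclideanSpace ℝ (Fin (k + 2))) 1) ×
              (Set.Icc (-1 : ℝ) 1) | (p.2 : ℝ) = 0})
          = unstableSet f σ ∪ {ω} ∧
        ∃ m : ℕ, 0 < m ∧ (⇑f)^[m] '' N ⊆ interior N := by
  obtain ⟨hmσ, q, hq, hq0, hqf⟩ := chart_aux k (k + 1) f σ hσ
    (fun w => ((4 : ℝ) • w.1, (4 : ℝ)⁻¹ * w.2)) (fun δu δs hu hs x => chi_saddle k δu δs hu hs x) (by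
      rintro ⟨v, t⟩ h
      rw [Prod.mk.injEq] at h
      refine Prod.ext ?_ ?_
      · have h3 : ((4 : ℝ) - 1) • v = 0 := by rw [sub_smul, one_smul, h.1, sub_self]
        rcases smul_eq_zero.1 h3 with h4 | h4
        · norm_num at h4
        · exact h4
      · have h3 := h.2
        show t = 0
        simp only at h3
        linarith)
  obtain ⟨hmω, p, hp, hp0, hpf⟩ := chart_aux k 0 f ω hω (fun w => (4 : ℝ)⁻¹ • w)
    (fun δu δs hu hs x => chi_sink k δu δs hs x) (by
      intro w h
      have h3 : ((4 : ℝ)⁻¹ - 1) • w = 0 := by rw [sub_smul, one_smul, h, sub_self]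
      rcases smul_eq_zero.1 h3 with h4 | h4
      · norm_num at h4
      · exact h4)
  have hσper : f^[Function.minimalPeriod f σ] σ = σ := Function.isPeriodicPt_minimalPeriod f σ
  have hωper : f^[Function.minimalPeriod f ω] ω = ω := Function.isPeriodicPt_minimalPeriod f ω
  have sS : stableSet f σ = {x | Tendsto (fun k : ℕ => f^[k * Function.minimalPeriod f σ] x) atTop
    (𝓝 σ)} := rfl
  have sO : stableSet f ω = {x | Tendsto (fun k : ℕ => f^[k * Function.minimalPeriod f ω] x) atTop
    (𝓝 ω)} := rfl
  have uS : unstableSet f σ = {x | Tendsto (fun k : ℕ => f.symm^[k * Function.minimalPeriod f σ] x)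
    atTop (𝓝 σ)} := rfl
  generalize Function.minimalPeriod f σ = a at *
  generalize Function.minimalPeriod f ω = b at *
  obtain ⟨g, hg, hgs⟩ := exists_iter f (2 * a * b)
  set μ : ℝ := 4 ^ b with hμdef
  set ν : ℝ := 4 ^ a with hνdef
  have hμ : 1 < μ := one_lt_pow₀ (by norm_num) hmω.ne'
  have hν : 1 < ν := one_lt_pow₀ (by norm_num) hmσ.ne'
  have gq : ∀ v t, g (q (v, t)) = q (μ • v, μ⁻¹ * t) := by
    intro v t
    rw [hg, Function.iterate_mul]
    exact scaled_iter _ q hqf b v t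
  have gp : ∀ z, g (p z) = p (ν⁻¹ • z) := by
    intro z
    rw [hg, show 2 * a * b = 2 * b * a by ring, Function.iterate_mul]
    exact scaled_iter2 _ p hpf a z
  clear_value μ ν
  have gqs : ∀ (j : ℕ) v t, g.symm^[j] (q (v, t)) = q ((μ ^ j)⁻¹ • v, μ ^ j * t) := by
    intro j v t
    induction j with
    | zero => simp
    | succ j ih =>
      rw [Function.iterate_succ_apply', ih, Homeomorph.symm_apply_eq, gq, smul_smul]
      congr 2
      · congr 1
        rw [pow_succ']; field_simp
      · rw [pow_succ']; field_simp
  have q00 : q (0, 0) = σ := hq0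
  have hgs' : ⇑g.symm = (f.symm^[a])^[2 * b] := by
    rw [hgs, ← Function.iterate_mul]; congr 1; ring
  have hsσ : f.symm^[a] σ = σ := by
    conv_lhs => rw [← hσper]
    exact (Function.LeftInverse.iterate f.symm_apply_apply a) σ
  have hWu : unstableSet f σ = Set.range fun v => q (v, 0) := by
    rw [uS]
    ext x
    constructor
    · intro hx
      have hx' : Tendsto (fun k : ℕ => f.symm^[k * a] x) atTop (𝓝 σ) := hx
      have h1 : Tendsto (fun j : ℕ => g.symm^[j] x) atTop (𝓝 σ) := by
        have h2 : Tendsto (fun j : ℕ => 2 * b * j) atTop atTop :=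
          tendsto_id.const_mul_atTop' (by positivity)
        refine (hx'.comp h2).congr fun j => ?_
        simp only [Function.comp]
        rw [hgs, ← Function.iterate_mul, show 2 * a * b * j = 2 * b * j * a by ring]
      have h3 : Set.range q ∈ 𝓝 σ := hq.isOpen_range.mem_nhds ⟨0, hq0⟩
      obtain ⟨j, w, hw⟩ := (h1.eventually h3).exists
      have h4 : x = g^[j] (q w) := by
        rw [hw]
        exact ((Function.LeftInverse.iterate g.apply_symm_apply j) x).symm
      have h5 : ∀ (j : ℕ) (w), g^[j] (q w) ∈ Set.range q := by
        intro j w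
        induction j with
        | zero => exact ⟨w, rfl⟩
        | succ j ih =>
          obtain ⟨w', hw'⟩ := ih
          rw [Function.iterate_succ_apply', ← hw', gq]
          exact ⟨_, rfl⟩
      obtain ⟨⟨v, t⟩, hvt⟩ := h5 j w
      rw [← h4] at hvt
      subst hvt
      simp only [gqs] at h1
      rw [← q00] at h1
      have h6 : Tendsto (fun j : ℕ => ((μ ^ j)⁻¹ • v, μ ^ j * t)) atTop (𝓝 (0, 0)) :=
        hq.isEmbedding.tendsto_nhds_iff.2 h1
      have h7 : Tendsto (fun j : ℕ => μ ^ j * t) atTop (𝓝 0) :=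
        (continuous_snd.tendsto _).comp h6
      have ht : t = 0 := by
        by_contra hne
        have h8 := (h7.abs).eventually (gt_mem_nhds (by rw [abs_zero]; exact abs_pos.2 hne))
        obtain ⟨j, hj⟩ := h8.exists
        rw [abs_mul, abs_of_pos (by positivity)] at hj
        have h9 := one_le_pow₀ hμ.le (n := j)
        nlinarith [abs_nonneg t]
      subst ht
      exact ⟨v, rfl⟩
    · rintro ⟨v, rfl⟩
      have h1 : Tendsto (fun j : ℕ => (μ⁻¹) ^ j) atTop (𝓝 0) :=
        tendsto_pow_atTop_nhds_zero_of_lt_one (by positivity) (inv_lt_one_of_one_lt₀ hμ)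
      have h2 : Tendsto (fun j : ℕ => ((μ ^ j)⁻¹ • v, (0 : ℝ))) atTop (𝓝 (0, 0)) := by
        refine Tendsto.prodMk_nhds ?_ tendsto_const_nhds
        simpa [inv_pow] using h1.smul_const v
      have h3 : Tendsto (fun j : ℕ => g.symm^[j] (q (v, 0))) atTop (𝓝 σ) := by
        simp only [gqs, mul_zero]
        rw [← q00]
        exact (hq.continuous.tendsto _).comp h2
      rw [hgs'] at h3
      have h4 := sub_tendsto _ (f.symm.continuous.iterate a) σ hsσ (2 * b) (by positivity) _ h3
      show Tendsto (fun k : ℕ => f.symm^[k * a] (q (v, 0))) atTop (𝓝 σ)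
      refine h4.congr fun j => ?_
      rw [← Function.iterate_mul, mul_comm]
  rw [hWu] at hcl ⊢
  have hfin : Module.finrank ℝ (EuclideanSpace ℝ (Fin k)) = k := by simp
  have D : Dyn g q p μ ν := ⟨hμ, hν, hq, hp, gq, gp, by rw [hp0]; exact hcl, ⟨(0, 1), by simp⟩⟩
  obtain ⟨O, hO, hOB, hqO, hpO⟩ := D.basin_nhd
  obtain ⟨e, he, heO, he0, heq, hep⟩ := D.collar (by rw [hfin]; exact hk) O hO hqO hpO
  have hgB : ∀ m ∈ D.Basin, m ∈ stableSet f ω ∪ stableSet f σ := by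
    rintro m (h | h)
    · left
      rw [hg, hp0, show 2 * a * b = b * (2 * a) by ring, Function.iterate_mul] at h
      have h4 := sub_tendsto _ (f.continuous.iterate b) ω hωper (2 * a) (by positivity) _ h
      rw [sO]
      show Tendsto (fun k : ℕ => f^[k * b] m) atTop (𝓝 ω)
      refine h4.congr fun j => ?_
      rw [← Function.iterate_mul, mul_comm]
    · right
      rw [hg, q00, show 2 * a * b = a * (2 * b) by ring, Function.iterate_mul] at h
      have h4 := sub_tendsto _ (f.continuous.iterate a) σ hσper (2 * b) (by positivity) _ h
      rw [sS]
      show Tendsto (fun k : ℕ => f^[k * a] m) atTop (𝓝 σ)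
      refine h4.congr fun j => ?_
      rw [← Function.iterate_mul, mul_comm]
  let s : OnePoint (EuclideanSpace ℝ (Fin k) × ℝ) ≃ₜ
      Metric.sphere (0 : EuclideanSpace ℝ (Fin (k + 2))) 1 :=
    onePointEquivSphereOfFinrankEq (ι := Fin (k + 2)) (by simp)
  let s2 := s.symm.prodCongr (Homeomorph.refl (Set.Icc (-1 : ℝ) 1))
  have he2 : IsClosedEmbedding (e ∘ s2) := he.comp s2.isClosedEmbedding
  have hrange : Set.range (e ∘ s2) = Set.range e := s2.surjective.range_comp e
  have hNc : IsCompact (Set.range (e ∘ s2)) := isCompact_range he2.continuous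
  refine ⟨Set.range (e ∘ s2), hNc, ?_, ?_, he2.isEmbedding.toHomeomorph, ?_, ?_⟩
  · rintro _ ⟨y, rfl⟩
    exact hgB _ (hOB (heO _))
  · rw [hrange]
    rintro x (⟨v, rfl⟩ | hx)
    · exact heq v
    · rw [Set.mem_singleton_iff.1 hx, ← hp0]; exact hep
  · rw [Set.image_image]
    ext x
    constructor
    · rintro ⟨⟨y, t⟩, ht, rfl⟩
      have ht' : (t : ℝ) = 0 := ht
      show e (s.symm y, t) ∈ _
      generalize s.symm y = z
      induction z using OnePoint.rec with
      | infty => right; rw [(he0 t ht').2, hp0]; rfl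
      | coe v => left; exact ⟨v, ((he0 t ht').1 v).symm⟩
    · have h0 : ((⟨0, by norm_num⟩ : Set.Icc (-1 : ℝ) 1) : ℝ) = 0 := rfl
      rintro (⟨v, rfl⟩ | hx)
      · refine ⟨(s v, ⟨0, by norm_num⟩), h0, ?_⟩
        show e (s.symm (s v), _) = _
        rw [Homeomorph.symm_apply_apply]
        exact (he0 _ h0).1 v
      · refine ⟨(s OnePoint.infty, ⟨0, by norm_num⟩), h0, ?_⟩
        show e (s.symm (s OnePoint.infty), _) = _
        rw [Homeomorph.symm_apply_apply, Set.mem_singleton_iff.1 hx, ← hp0]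
        exact (he0 _ h0).2
  · obtain ⟨j, hj, hjN⟩ := D.trap _ (interior (Set.range (e ∘ s2))) hNc
      (by rintro _ ⟨y, rfl⟩; exact hOB (heO _)) isOpen_interior
      (by intro v; rw [hrange]; exact heq v) (by rw [hrange]; exact hep)
    refine ⟨2 * a * b * j, by positivity, ?_⟩
    rw [Function.iterate_mul, ← hg]
    exact hjN

end Final

theorem exists_trapping_cylindrical_neighbourhood {n : ℕ} (hn : 4 ≤ n) {M : Type*}
    [MetricSpace M] [CompactSpace M] [ConnectedSpace M] [Nonempty M]
    (hM : IsChartedEuclidean n M)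
    (f : M ≃ₜ M) (hf : RegularHomeo n f)
    (σ : M) (hσ : TopHyperbolic n f σ (n - 1))
    (hsep : ∀ q : M, q ≠ σ → IsSaddlePt n f q → unstableSet f σ ∩ stableSet f q = ∅)
    (ω : M) (hω : TopHyperbolic n f ω 0)
    (hcl : closure (unstableSet f σ) = unstableSet f σ ∪ {ω}) :
    ∃ N : Set M, IsCompact N ∧ N ⊆ stableSet f ω ∪ stableSet f σ ∧
      unstableSet f σ ∪ {ω} ⊆ interior N ∧
      ∃ e : ((Metric.sphere (0 : EuclideanSpace ℝ (Fin n)) 1) ×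
               (Set.Icc (-1 : ℝ) 1)) ≃ₜ N,
        Subtype.val '' (⇑e '' {p : (Metric.sphere (0 : EuclideanSpace ℝ (Fin n)) 1) ×
              (Set.Icc (-1 : ℝ) 1) | (p.2 : ℝ) = 0})
          = unstableSet f σ ∪ {ω} ∧
        ∃ m : ℕ, 0 < m ∧ (⇑f)^[m] '' N ⊆ interior N := by
  obtain ⟨k, rfl⟩ : ∃ k, n = k + 2 := ⟨n - 2, by omega⟩
  exact main_aux k (by omega) f σ hσ ω hω hcl
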